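/- arXiv:1609.08672 — 4 statements merged into one kernel-verified Lean document; each statement's English description precedes it below -/
import Mathlib

section
/- Let 1 < p < 2 and ε > 0, and set c_p = (p/(p−1))^{(3−p)/2} / (1 − p(1−1/p)^{p−1})^{1/2}. Let f, g be discrete-time H-valued martingales on a filtered probability space such that g is differentially subordinate to f, both are L^p-bounded, and f_n → F and g_n → G almost surely as n → ∞. If ‖g‖_p ≥ ((p−1)^{−1} − ε)·‖f‖_p, then ‖ ‖G‖_H − (p−1)^{−1}‖F‖_H ‖_{L^p(Ω)} ≤ c_p · ε^{1/2} · ‖f‖_p. -/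
open MeasureTheory Filter

lemma integrableOn_integral_rpow_mul_ite {p N b c : ℝ} (hp1 : 1 < p) (hp2 : p < 2) (hN : 0 ≤ N)
    (hc : N = 0 → c = 0) :
    IntegrableOn (fun t : ℝ => t ^ (p - 3) * if N ≤ t then c else t ^ 2 + b * t) (Set.Ioi 0) ∧
    ∫ t in Set.Ioi (0 : ℝ), t ^ (p - 3) * (if N ≤ t then c else t ^ 2 + b * t) =
      N ^ p / p + b * N ^ (p - 1) / (p - 1) + c * N ^ (p - 2) / (2 - p) := by
  rcases hN.eq_or_lt with rfl | hN
  · have hzero : ∀ t ∈ Set.Ioi (0 : ℝ),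
        t ^ (p - 3) * (if 0 ≤ t then c else t ^ 2 + b * t) = 0 := by
      intro t ht
      rw [if_pos (le_of_lt ht), hc rfl, mul_zero]
    refine ⟨integrableOn_zero.congr_fun (fun t ht => (hzero t ht).symm) measurableSet_Ioi, ?_⟩
    rw [setIntegral_congr_fun measurableSet_Ioi hzero]
    simp [hc rfl, Real.zero_rpow (by linarith : p ≠ 0), Real.zero_rpow (by linarith : p - 1 ≠ 0)]
  have hnear : ∀ t ∈ Set.Ioo 0 N, t ^ (p - 1) + b * t ^ (p - 2) =
      t ^ (p - 3) * (if N ≤ t then c else t ^ 2 + b * t) := by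
    intro t ht
    have h1 : t ^ (p - 1) = t ^ (p - 3) * t ^ 2 := by
      rw [← Real.rpow_natCast t 2, ← Real.rpow_add ht.1]; norm_num; ring_nf
    have h2 : t ^ (p - 2) = t ^ (p - 3) * t := by
      nth_rewrite 3 [← Real.rpow_one t]
      rw [← Real.rpow_add ht.1]; ring_nf
    rw [if_neg (not_le.2 ht.2), h1, h2]; ring
  have hfar : ∀ t ∈ Set.Ici N, c * t ^ (p - 3) =
      t ^ (p - 3) * (if N ≤ t then c else t ^ 2 + b * t) := by
    intro t ht
    rw [if_pos (show N ≤ t from ht), mul_comm]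
  have i1 : IntervalIntegrable (fun t : ℝ => t ^ (p - 1)) volume 0 N :=
    intervalIntegral.intervalIntegrable_rpow' (by linarith)
  have i2 : IntervalIntegrable (fun t : ℝ => b * t ^ (p - 2)) volume 0 N :=
    (intervalIntegral.intervalIntegrable_rpow' (by linarith)).const_mul b
  have i12 := (intervalIntegrable_iff_integrableOn_Ioo_of_le hN.le).1 (i1.add i2)
  have i3 : IntegrableOn (fun t : ℝ => c * t ^ (p - 3)) (Set.Ici N) :=
    ((integrableOn_Ici_iff_integrableOn_Ioi (by simp)).2
      (integrableOn_Ioi_rpow_of_lt (by linarith) hN)).const_mul c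
  have j12 := i12.congr_fun hnear measurableSet_Ioo
  have j3 := i3.congr_fun hfar measurableSet_Ici
  have hU : Set.Ioo 0 N ∪ Set.Ici N = Set.Ioi 0 := Set.Ioo_union_Ici_eq_Ioi hN
  have hdisj : Disjoint (Set.Ioo 0 N) (Set.Ici N) :=
    Set.disjoint_left.2 fun t h1 h2 => absurd h1.2 (not_lt.2 h2)
  refine ⟨hU ▸ j12.union j3, ?_⟩
  rw [← hU, setIntegral_union hdisj
    measurableSet_Ici j12 j3, ← setIntegral_congr_fun measurableSet_Ioo hnear,
    ← setIntegral_congr_fun measurableSet_Ici hfar, ← integral_Ioc_eq_integral_Ioo,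
    ← intervalIntegral.integral_of_le hN.le, intervalIntegral.integral_add i1 i2,
    intervalIntegral.integral_const_mul, integral_rpow (Or.inl (by linarith)),
    integral_rpow (Or.inl (by linarith)), integral_Ici_eq_integral_Ioi, integral_const_mul,
    integral_Ioi_rpow_of_lt (by linarith) hN]
  have e1 : p - 1 + 1 = p := by ring
  have e2 : p - 2 + 1 = p - 1 := by ring
  have e3 : p - 3 + 1 = p - 2 := by ring
  rw [e1, e2, e3, Real.zero_rpow (by linarith : p ≠ 0), Real.zero_rpow (by linarith : p - 1 ≠ 0)]
  have h1 : p - 1 ≠ 0 := by linarith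
  have h2 : p - 2 ≠ 0 := by linarith
  have h3 : 2 - p ≠ 0 := by linarith
  have h0 : p ≠ 0 := by linarith
  have : (2 - p) = -(p - 2) := by ring
  rw [this]
  field_simp
  ring

section Hilbert

variable {H : Type*} [NormedAddCommGroup H] [InnerProductSpace ℝ H]

lemma ite_norm_sq_sub_le {t : ℝ} (ht : 0 < t) {x y h k : H} (hkh : ‖k‖ ≤ ‖h‖) :
    (if ‖x + h‖ + ‖y + k‖ ≤ t then ‖y + k‖ ^ 2 - ‖x + h‖ ^ 2 else t ^ 2 + -2 * ‖x + h‖ * t) ≤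
      if ‖x‖ + ‖y‖ ≤ t then ‖y‖ ^ 2 - ‖x‖ ^ 2 - 2 * inner ℝ x h + 2 * inner ℝ y k
      else t ^ 2 + (-2 * ‖x‖ - 2 * (‖x‖⁻¹ * inner ℝ x h)) * t := by
  have hxh := norm_add_sq_real x h
  have hyk := norm_add_sq_real y k
  have hx0 := norm_nonneg x
  have hy0 := norm_nonneg y
  have hX0 := norm_nonneg (x + h)
  have hY0 := norm_nonneg (y + k)
  have hk0 := norm_nonneg k
  have hsq : ‖k‖ ^ 2 ≤ ‖h‖ ^ 2 := by gcongr
  by_cases hin : ‖x‖ + ‖y‖ ≤ t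
  · rw [if_pos hin]
    have hquad : ‖y + k‖ ^ 2 - ‖x + h‖ ^ 2 ≤
        ‖y‖ ^ 2 - ‖x‖ ^ 2 - 2 * inner ℝ x h + 2 * inner ℝ y k := by linarith
    split_ifs with hout
    · exact hquad
    by_cases hfar : ‖x + h‖ - t ≤ ‖y + k‖
    · refine le_trans ?_ hquad
      nlinarith
    · push Not at hfar hout
      have h1 : ‖x + h‖ ≤ ‖x‖ + ‖h‖ := norm_add_le _ _
      have h2 : ‖k‖ ≤ ‖y + k‖ + ‖y‖ := by
        simpa using norm_sub_le (y + k) y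
      have h3 : ‖x + h‖ - t + ‖y‖ ≤ ‖h‖ := by linarith
      have h4 : (‖x + h‖ - t + ‖y‖) ^ 2 ≤ ‖h‖ ^ 2 := by
        apply pow_le_pow_left₀; linarith; exact h3
      have h5 : ‖k‖ ^ 2 ≤ (‖y + k‖ + ‖y‖) ^ 2 := by gcongr
      nlinarith [mul_nonneg hy0 (sub_nonneg.2 hfar.le)]
  · rw [if_neg hin]
    have hlin : ‖x‖ + ‖x‖⁻¹ * inner ℝ x h ≤ ‖x + h‖ := by
      rcases hx0.eq_or_lt with h0 | h0
      · simp [← h0]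
      · have := real_inner_le_norm x (x + h)
        rw [inner_add_right, real_inner_self_eq_norm_sq] at this
        have h6 : ‖x‖ * (‖x‖ + ‖x‖⁻¹ * inner ℝ x h) ≤ ‖x‖ * ‖x + h‖ := by
          rw [mul_add, mul_inv_cancel_left₀ h0.ne']
          linarith
        exact le_of_mul_le_mul_left h6 h0
    refine le_trans ?_ (show t ^ 2 + -2 * ‖x + h‖ * t ≤ _ by nlinarith)
    split_ifs with hout
    · nlinarith
    · rfl

/-- Burkholder's function, in terms of the norms of its two arguments. -/
noncomputable def burkholderFun (p a b : ℝ) : ℝ := (b - (p - 1)⁻¹ * a) * (a + b) ^ (p - 1)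

lemma burkholderFun_eq {p a b : ℝ} (hp1 : 1 < p) (hp2 : p < 2) (ha : 0 ≤ a) (hb : 0 ≤ b) :
    (a + b) ^ p / p + -2 * a * (a + b) ^ (p - 1) / (p - 1) +
      (b ^ 2 - a ^ 2) * (a + b) ^ (p - 2) / (2 - p) =
    2 / (p * (2 - p)) * burkholderFun p a b := by
  unfold burkholderFun
  have h1 : p - 1 ≠ 0 := by linarith
  have h3 : 2 - p ≠ 0 := by linarith
  have h0 : p ≠ 0 := by linarith
  rcases (add_nonneg ha hb).eq_or_lt with hN | hN
  · have ha' : a = 0 := by linarith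
    have hb' : b = 0 := by linarith
    simp [ha', hb', Real.zero_rpow h0]
  have e1 : (a + b) ^ p = (a + b) ^ (p - 1) * (a + b) := by
    rw [← Real.rpow_add_one hN.ne']; ring_nf
  have e2 : (a + b) ^ (p - 1) = (a + b) ^ (p - 2) * (a + b) := by
    rw [← Real.rpow_add_one hN.ne']; ring_nf
  rw [e1, e2]
  field_simp
  ring

lemma burkholderFun_norm_add_le {p : ℝ} (hp1 : 1 < p) (hp2 : p < 2) {x y h k : H}
    (hkh : ‖k‖ ≤ ‖h‖) :
    burkholderFun p ‖x + h‖ ‖y + k‖ ≤ burkholderFun p ‖x‖ ‖y‖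
      - (p * (‖x‖ + ‖y‖) ^ (p - 2) + p * (2 - p) / (p - 1) * (‖x‖ + ‖y‖) ^ (p - 1) * ‖x‖⁻¹)
        * inner ℝ x h
      + p * (‖x‖ + ‖y‖) ^ (p - 2) * inner ℝ y k := by
  have hx0 := norm_nonneg x
  have hy0 := norm_nonneg y
  have hX0 := norm_nonneg (x + h)
  have hY0 := norm_nonneg (y + k)
  obtain ⟨i1, e1⟩ := integrableOn_integral_rpow_mul_ite (b := -2 * ‖x + h‖)
    (c := ‖y + k‖ ^ 2 - ‖x + h‖ ^ 2) hp1 hp2 (add_nonneg hX0 hY0) (fun h0 => by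
      rw [show ‖x + h‖ = 0 by linarith, show ‖y + k‖ = 0 by linarith]; norm_num)
  obtain ⟨i2, e2⟩ := integrableOn_integral_rpow_mul_ite
    (b := -2 * ‖x‖ - 2 * (‖x‖⁻¹ * inner ℝ x h))
    (c := ‖y‖ ^ 2 - ‖x‖ ^ 2 - 2 * inner ℝ x h + 2 * inner ℝ y k) hp1 hp2 (add_nonneg hx0 hy0)
    (fun h0 => by
      have hx : x = 0 := norm_eq_zero.1 (by linarith)
      have hy : y = 0 := norm_eq_zero.1 (by linarith)
      simp [hx, hy])
  have hmono := setIntegral_mono_on i1 i2 measurableSet_Ioi (fun t ht =>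
    mul_le_mul_of_nonneg_left (ite_norm_sq_sub_le (x := x) (y := y) ht hkh)
      (Real.rpow_nonneg (le_of_lt ht) _))
  rw [e1, e2, burkholderFun_eq hp1 hp2 hX0 hY0] at hmono
  have hxy := burkholderFun_eq hp1 hp2 hx0 hy0
  have h1 : p - 1 ≠ 0 := by linarith
  have h3 : 0 < 2 - p := by linarith
  have h0 : 0 < p := by linarith
  have hpos : 0 < 2 / (p * (2 - p)) := by positivity
  refine le_of_mul_le_mul_left (hmono.trans_eq ?_) hpos
  have hxy' : burkholderFun p ‖x‖ ‖y‖ = p * (2 - p) / 2 * ((‖x‖ + ‖y‖) ^ p / p +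
      -2 * ‖x‖ * (‖x‖ + ‖y‖) ^ (p - 1) / (p - 1) +
      (‖y‖ ^ 2 - ‖x‖ ^ 2) * (‖x‖ + ‖y‖) ^ (p - 2) / (2 - p)) := by
    rw [hxy]; field_simp
  rw [hxy']
  generalize ‖x‖⁻¹ = r
  field_simp
  ring

end Hilbert

lemma nonneg_of_deriv_concaveOn {h w : ℝ → ℝ} {s₀ : ℝ} (hs₀ : s₀ ∈ Set.Ioo (0 : ℝ) 1)
    (hcont : ContinuousOn h (Set.Icc 0 1)) (hderiv : ∀ s ∈ Set.Ioo (0 : ℝ) 1, HasDerivAt h (w s) s)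
    (hw : ConcaveOn ℝ (Set.Ioo 0 1) w) (h0 : h s₀ = 0) (hw0 : w s₀ = 0) (h1 : h 1 = 0)
    {s : ℝ} (hs : s ∈ Set.Icc (0 : ℝ) 1) : 0 ≤ h s := by
  have hmono : ∀ u v : ℝ, 0 ≤ u → v ≤ 1 → u ≤ v → (∀ r ∈ Set.Ioo u v, 0 ≤ w r) → h u ≤ h v := by
    intro u v hu hv huv hr
    refine monotoneOn_of_deriv_nonneg (convex_Icc u v) (hcont.mono (Set.Icc_subset_Icc hu hv)) ?_ ?_
      (Set.left_mem_Icc.2 huv) (Set.right_mem_Icc.2 huv) huv <;> rw [interior_Icc] <;> intro r hr'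
    · exact (hderiv r (Set.Ioo_subset_Ioo hu hv hr')).differentiableAt.differentiableWithinAt
    · rw [(hderiv r (Set.Ioo_subset_Ioo hu hv hr')).deriv]; exact hr r hr'
  have hanti : ∀ u v : ℝ, 0 ≤ u → v ≤ 1 → u ≤ v → (∀ r ∈ Set.Ioo u v, w r ≤ 0) → h v ≤ h u := by
    intro u v hu hv huv hr
    refine antitoneOn_of_deriv_nonpos (convex_Icc u v) (hcont.mono (Set.Icc_subset_Icc hu hv)) ?_ ?_
      (Set.left_mem_Icc.2 huv) (Set.right_mem_Icc.2 huv) huv <;> rw [interior_Icc] <;> intro r hr'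
    · exact (hderiv r (Set.Ioo_subset_Ioo hu hv hr')).differentiableAt.differentiableWithinAt
    · rw [(hderiv r (Set.Ioo_subset_Ioo hu hv hr')).deriv]; exact hr r hr'
  have hmin : ∀ {x y z : ℝ}, x ∈ Set.Ioo (0 : ℝ) 1 → z ∈ Set.Ioo (0 : ℝ) 1 → x < y → y < z →
      (w z - w y) * (y - x) ≤ (w y - w x) * (z - y) := by
    intro x y z hx hz hxy hyz
    have := hw.slope_anti_adjacent hx hz hxy hyz
    rwa [div_le_div_iff₀ (sub_pos.2 hyz) (sub_pos.2 hxy)] at this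
  rcases lt_trichotomy s s₀ with hlt | rfl | hgt
  · rw [← h0]
    refine hanti s s₀ hs.1 hs₀.2.le hlt.le fun r hr => ?_
    by_contra! hpos
    have hr01 : r ∈ Set.Ioo (0 : ℝ) 1 := ⟨hs.1.trans_lt hr.1, hr.2.trans hs₀.2⟩
    have hneg : ∀ z ∈ Set.Ioo s₀ 1, w z < 0 := by
      intro z hz
      have := hmin hr01 ⟨hs₀.1.trans hz.1, hz.2⟩ hr.2 hz.1
      rw [hw0] at this
      have h2 := sub_pos.2 hz.1
      have h3 := sub_pos.2 hr.2
      by_contra! h4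
      nlinarith [mul_pos hpos h2, mul_nonneg h4 h3.le]
    have : StrictAntiOn h (Set.Icc s₀ 1) := by
      refine strictAntiOn_of_deriv_neg (convex_Icc s₀ 1)
        (hcont.mono (Set.Icc_subset_Icc hs₀.1.le le_rfl)) fun z hz => ?_
      rw [interior_Icc] at hz
      rw [(hderiv z ⟨hs₀.1.trans hz.1, hz.2⟩).deriv]
      exact hneg z hz
    have := this (Set.left_mem_Icc.2 hs₀.2.le) (Set.right_mem_Icc.2 hs₀.2.le) hs₀.2
    linarith
  · exact h0.ge
  · rcases hs.2.eq_or_lt with rfl | hs1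
    · exact h1.ge
    have hs01 : s ∈ Set.Ioo (0 : ℝ) 1 := ⟨hs₀.1.trans hgt, hs1⟩
    rcases le_or_gt 0 (w s) with hws | hws
    · rw [← h0]
      refine hmono s₀ s hs₀.1.le hs.2 hgt.le fun r hr => ?_
      have := hmin hs₀ hs01 hr.1 hr.2
      rw [hw0] at this
      have h2 := sub_pos.2 hr.1
      have h3 := sub_pos.2 hr.2
      by_contra! h4
      nlinarith [mul_pos (neg_pos.2 h4) h2, mul_pos (neg_pos.2 h4) h3, mul_nonneg hws h2.le]
    · rw [← h1]
      refine hanti s 1 hs.1 le_rfl hs.2 fun r hr => ?_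
      have := hmin hs₀ ⟨hs01.1.trans hr.1, hr.2⟩ hgt hr.1
      rw [hw0] at this
      have h2 := sub_pos.2 hr.1
      have h3 := sub_pos.2 hgt
      by_contra! h4
      nlinarith [mul_pos (neg_pos.2 hws) h2, mul_pos (neg_pos.2 hws) h3, mul_pos h4 h3]

/-- The sharp constant in the stability estimate `stabilityConst_mul_le`. -/
noncomputable def stabilityConst (p : ℝ) : ℝ :=
  (p - 1) ^ (2 - p) * (1 - p * (1 - 1 / p) ^ (p - 1))

lemma one_sub_mul_rpow_pos {p : ℝ} (hp1 : 1 < p) (hp2 : p < 2) :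
    0 < 1 - p * (1 - 1 / p) ^ (p - 1) := by
  have hp0 : 0 < p := by linarith
  have hq : 0 < p - 1 := by linarith
  rw [sub_pos, show 1 - 1 / p = (p - 1) / p by field_simp, Real.div_rpow hq.le hp0.le]
  have h1 := Real.log_lt_sub_one_of_pos hp0 hp1.ne'
  have h2 := Real.log_lt_sub_one_of_pos hq (by linarith)
  rw [← Real.log_neg_iff (by positivity), Real.log_mul hp0.ne' (by positivity),
    Real.log_div (by positivity) (by positivity), Real.log_rpow hq, Real.log_rpow hp0]
  nlinarith

lemma stabilityConst_pos {p : ℝ} (hp1 : 1 < p) (hp2 : p < 2) : 0 < stabilityConst p :=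
  mul_pos (Real.rpow_pos_of_pos (by linarith) _) (one_sub_mul_rpow_pos hp1 hp2)

lemma stabilityConst_eq {p : ℝ} (hp1 : 1 < p) :
    stabilityConst p = (p - 1) ^ (2 - p) - (p - 1) * p ^ (2 - p) := by
  have hp0 : 0 < p := by linarith
  have hq : 0 < p - 1 := by linarith
  unfold stabilityConst
  rw [show 1 - 1 / p = (p - 1) / p by field_simp, Real.div_rpow hq.le hp0.le]
  have e1 : (p - 1) ^ (2 - p) * (p - 1) ^ (p - 1) = p - 1 := by
    rw [← Real.rpow_add hq]; ring_nf; simp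
  have e2 : p ^ (2 - p) * p ^ (p - 1) = p := by
    rw [← Real.rpow_add hp0]; ring_nf; simp
  have h3 : p ^ (p - 1) ≠ 0 := by positivity
  field_simp
  linear_combination (-p) * e1 + (p - 1) * e2

lemma stabilityConst_mul_sq_le {p s : ℝ} (hp1 : 1 < p) (hp2 : p < 2) (hs : s ∈ Set.Icc (0 : ℝ) 1) :
    0 ≤ p ^ (2 - p) * (1 - p / (p - 1) * s) - (1 - s) ^ p + ((p - 1)⁻¹) ^ p * s ^ p
      - stabilityConst p * (1 - p / (p - 1) * s) ^ 2 := by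
  have hp0 : 0 < p := by linarith
  have hq : 0 < p - 1 := by linarith
  have hs₀ : (p - 1) / p ∈ Set.Ioo (0 : ℝ) 1 :=
    ⟨by positivity, by rw [div_lt_one hp0]; linarith⟩
  refine nonneg_of_deriv_concaveOn
    (h := fun s => p ^ (2 - p) * (1 - p / (p - 1) * s) - (1 - s) ^ p + ((p - 1)⁻¹) ^ p * s ^ p
      - stabilityConst p * (1 - p / (p - 1) * s) ^ 2)
    (w := fun s => p * (1 - s) ^ (p - 1) + (p * ((p - 1)⁻¹) ^ p) * s ^ (p - 1) +
      (-(p ^ (2 - p) * (p / (p - 1))) + 2 * stabilityConst p * (p / (p - 1)) +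
        -(2 * stabilityConst p * (p / (p - 1)) ^ 2) * s))
    hs₀ ?_ ?_ ?_ ?_ ?_ ?_ hs
  · have c1 : Continuous fun s : ℝ => s ^ p := Real.continuous_rpow_const hp0.le
    have c2 : Continuous fun s : ℝ => (1 - s) ^ p :=
      c1.comp (by fun_prop : Continuous fun s : ℝ => 1 - s)
    exact Continuous.continuousOn (by fun_prop)
  · intro s hs
    have d1 : HasDerivAt (fun s : ℝ => 1 - p / (p - 1) * s) (-(p / (p - 1))) s := by
      simpa using ((hasDerivAt_id s).const_mul (p / (p - 1))).const_sub 1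
    have d2 : HasDerivAt (fun s : ℝ => (1 - s) ^ p) (-1 * p * (1 - s) ^ (p - 1)) s :=
      ((hasDerivAt_id s).const_sub 1).rpow_const (Or.inr hp1.le)
    have d3 : HasDerivAt (fun s : ℝ => s ^ p) (p * s ^ (p - 1)) s :=
      Real.hasDerivAt_rpow_const (Or.inr hp1.le)
    convert! (((d1.const_mul (p ^ (2 - p))).sub d2).add (d3.const_mul (((p - 1)⁻¹) ^ p))).sub
      ((d1.pow 2).const_mul (stabilityConst p)) using 1
    push_cast
    ring
  · have c0 := Real.concaveOn_rpow (p := p - 1) hq.le (by linarith)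
    have hcvx : Convex ℝ (Set.Ioo (0 : ℝ) 1) := convex_Ioo 0 1
    have c1 : ConcaveOn ℝ (Set.Ioo (0 : ℝ) 1) (fun s : ℝ => s ^ (p - 1)) :=
      c0.subset (fun x hx => hx.1.le) hcvx
    have c2 : ConcaveOn ℝ (Set.Ioo (0 : ℝ) 1) (fun s : ℝ => (1 - s) ^ (p - 1)) := by
      refine ⟨hcvx, fun x hx y hy a b ha hb hab => ?_⟩
      have := c0.2 (x := 1 - x) (y := 1 - y) (by simpa using hx.2.le) (by simpa using hy.2.le)
        ha hb hab
      have e : 1 - (a • x + b • y) = a • (1 - x) + b • (1 - y) := by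
        simp only [smul_eq_mul]
        linear_combination (-1 : ℝ) * hab
      simpa only [e] using this
    have c3 : ConcaveOn ℝ (Set.Ioo (0 : ℝ) 1)
        (fun s : ℝ => -(p ^ (2 - p) * (p / (p - 1))) + 2 * stabilityConst p * (p / (p - 1)) +
        -(2 * stabilityConst p * (p / (p - 1)) ^ 2) * s) := by
      refine ⟨hcvx, fun x hx y hy a b ha hb hab => le_of_eq ?_⟩
      simp only [smul_eq_mul]
      linear_combination (-(p ^ (2 - p) * (p / (p - 1))) +
        2 * stabilityConst p * (p / (p - 1))) * hab
    exact ((c2.smul hp0.le).add (c1.smul (by positivity))).add c3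
  · have e1 : 1 - (p - 1) / p = p⁻¹ := by field_simp; ring
    have e2 : (1 : ℝ) - p / (p - 1) * ((p - 1) / p) = 0 := by field_simp; ring
    simp only [e1, e2]
    rw [← Real.mul_rpow (by positivity) (by positivity),
      show (p - 1)⁻¹ * ((p - 1) / p) = p⁻¹ by field_simp]
    simp
  · have e1 : 1 - (p - 1) / p = p⁻¹ := by field_simp; ring
    have e2 : ((p - 1)⁻¹) ^ p * ((p - 1) / p) ^ (p - 1) = (p - 1)⁻¹ * p⁻¹ ^ (p - 1) := by
      have : ((p - 1)⁻¹) ^ p = (p - 1)⁻¹ * ((p - 1)⁻¹) ^ (p - 1) := by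
        rw [mul_comm, ← Real.rpow_add_one (by positivity)]; ring_nf
      rw [this, mul_assoc, ← Real.mul_rpow (by positivity) (by positivity),
        show (p - 1)⁻¹ * ((p - 1) / p) = p⁻¹ by field_simp]
    have e3 : p ^ (2 - p) = p * p⁻¹ ^ (p - 1) := by
      rw [Real.inv_rpow hp0.le, ← Real.rpow_neg hp0.le, mul_comm, ← Real.rpow_add_one hp0.ne']
      ring_nf
    simp only [e1]
    rw [mul_assoc p, e2, e3]
    field_simp
    ring
  · have e1 : p / (p - 1) = 1 + (p - 1)⁻¹ := by field_simp; ring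
    have e2 : ((p - 1)⁻¹) ^ p = (p - 1) ^ (2 - p) * ((p - 1)⁻¹) ^ 2 := by
      rw [Real.inv_rpow hq.le, ← Real.rpow_neg hq.le, inv_pow, ← Real.rpow_natCast (p - 1) 2,
        ← Real.rpow_neg hq.le, ← Real.rpow_add hq]
      push_cast; ring_nf
    simp only [sub_self, Real.zero_rpow hp0.ne', Real.one_rpow, e2, e1, stabilityConst_eq hp1]
    field_simp
    ring

lemma stabilityConst_mul_le {p a b : ℝ} (hp1 : 1 < p) (hp2 : p < 2) (ha : 0 ≤ a) (hb : 0 ≤ b) :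
    stabilityConst p * ((b - (p - 1)⁻¹ * a) ^ 2 * (a + b) ^ (p - 2)) ≤
      p ^ (2 - p) * burkholderFun p a b - b ^ p + ((p - 1)⁻¹) ^ p * a ^ p := by
  have hp0 : 0 < p := by linarith
  have hq : 0 < p - 1 := by linarith
  rcases (add_nonneg ha hb).eq_or_lt with hN | hN
  · have ha' : a = 0 := by linarith
    have hb' : b = 0 := by linarith
    simp [burkholderFun, ha', hb', Real.zero_rpow hp0.ne']
  obtain ⟨s, hs⟩ : ∃ s, s = a / (a + b) := ⟨_, rfl⟩
  obtain ⟨N, hNe⟩ : ∃ N, N = a + b := ⟨_, rfl⟩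
  have hs01 : s ∈ Set.Icc (0 : ℝ) 1 := by
    rw [hs]; exact ⟨by positivity, by rw [div_le_one hN]; linarith⟩
  have ea : a = N * s := by rw [hs, hNe]; field_simp
  have eb : b = N * (1 - s) := by linear_combination -hNe - ea
  rw [← hNe] at hN
  have key := mul_nonneg (Real.rpow_nonneg hN.le p) (stabilityConst_mul_sq_le hp1 hp2 hs01)
  have eD : b - (p - 1)⁻¹ * a = N * (1 - p / (p - 1) * s) := by
    rw [ea, eb]; field_simp; ring
  have e1 : N ^ p = N * N ^ (p - 1) := by
    rw [mul_comm, ← Real.rpow_add_one hN.ne']; ring_nf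
  have e2 : N ^ (p - 1) = N * N ^ (p - 2) := by
    rw [mul_comm, ← Real.rpow_add_one hN.ne']; ring_nf
  have e3 : a ^ p = N ^ p * s ^ p := by rw [ea, Real.mul_rpow hN.le hs01.1]
  have e4 : b ^ p = N ^ p * (1 - s) ^ p := by
    rw [eb, Real.mul_rpow hN.le (by linarith [hs01.2])]
  rw [burkholderFun, eD, ← hNe, e3, e4]
  rw [e1, e2] at key ⊢
  linarith

lemma rpow_sub_mul_le_max_rpow {p q ε : ℝ} (hp : 1 ≤ p) (hq : 0 < q) :
    q ^ p - p * q ^ (p - 1) * ε ≤ max (q - ε) 0 ^ p := by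
  have e : q ^ p = q ^ (p - 1) * q := by
    rw [← Real.rpow_add_one hq.ne']; ring_nf
  rcases le_total ε q with h | h
  · rw [max_eq_left (sub_nonneg.2 h)]
    have hs : -1 ≤ -(ε / q) := by
      rw [neg_le_neg_iff, div_le_one hq]; exact h
    have := mul_le_mul_of_nonneg_left (one_add_mul_self_le_rpow_one_add hs hp)
      (Real.rpow_nonneg hq.le p)
    rw [← Real.mul_rpow hq.le (by linarith),
      show q * (1 + -(ε / q)) = q - ε by field_simp; ring] at this
    refine le_trans (le_of_eq ?_) this
    rw [e]
    field_simp
    ring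
  · refine le_trans ?_ (Real.rpow_nonneg (le_max_right _ _) _)
    have h1 : 0 ≤ q ^ (p - 1) := by positivity
    rw [e]
    nlinarith [mul_nonneg h1 (sub_nonneg.2 h), mul_nonneg (mul_nonneg h1 hq.le) (sub_nonneg.2 hp),
      mul_nonneg (mul_nonneg h1 (hq.le.trans h)) (sub_nonneg.2 hp)]

lemma stability_bound_le {p ε S T : ℝ} (hp1 : 1 < p) (hp2 : p < 2) (hε : 0 < ε) (hS : 0 ≤ S)
    (hlow : max ((p - 1)⁻¹ - ε) 0 * S ≤ T) (hT : T ^ p ≤ ((p - 1)⁻¹ * S) ^ p) :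
    (((((p - 1)⁻¹ * S) ^ p - T ^ p) / stabilityConst p) ^ (p / 2) *
        ((p / (p - 1) * S) ^ p) ^ (1 - p / 2)) ^ p⁻¹ ≤
      (p / (p - 1)) ^ ((3 - p) / 2) / (1 - p * (1 - 1 / p) ^ (p - 1)) ^ ((1 : ℝ) / 2) *
        ε ^ ((1 : ℝ) / 2) * S := by
  have hp0 : 0 < p := by linarith
  have hq : 0 < p - 1 := by linarith
  have hB := one_sub_mul_rpow_pos hp1 hp2
  have hκ := stabilityConst_pos hp1 hp2
  have hP : 0 < p / (p - 1) := by positivity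
  have hdiff : ((p - 1)⁻¹ * S) ^ p - T ^ p ≤ p * (p - 1)⁻¹ ^ (p - 1) * ε * S ^ p := by
    have h1 := Real.rpow_le_rpow (by positivity) hlow hp0.le
    rw [Real.mul_rpow (by positivity) hS] at h1 ⊢
    have h2 := mul_le_mul_of_nonneg_right
      (rpow_sub_mul_le_max_rpow (ε := ε) hp1.le (inv_pos.2 hq)) (Real.rpow_nonneg hS p)
    linarith
  have hconst : p * (p - 1)⁻¹ ^ (p - 1) * ε * S ^ p / stabilityConst p =
      p / (p - 1) * ε / (1 - p * (1 - 1 / p) ^ (p - 1)) * S ^ p := by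
    have e1 : (p - 1) ^ (2 - p) * (p - 1) ^ (p - 1) = p - 1 := by
      rw [← Real.rpow_add hq]; ring_nf; simp
    have e2 : (p - 1)⁻¹ ^ (p - 1) = (p - 1) ^ (2 - p) / (p - 1) := by
      rw [Real.inv_rpow hq.le]
      field_simp
      linarith
    have h3 : (p - 1) ^ (2 - p) ≠ 0 := by positivity
    rw [e2, stabilityConst]
    field_simp
  have hsq : (((p - 1)⁻¹ * S) ^ p - T ^ p) / stabilityConst p ≤
      p / (p - 1) * ε / (1 - p * (1 - 1 / p) ^ (p - 1)) * S ^ p := by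
    rw [← hconst]; gcongr
  have hnonneg : 0 ≤ (((p - 1)⁻¹ * S) ^ p - T ^ p) / stabilityConst p :=
    div_nonneg (sub_nonneg.2 hT) hκ.le
  generalize 1 - p * (1 - 1 / p) ^ (p - 1) = B at *
  generalize p / (p - 1) = P at *
  have hSp : 0 ≤ S ^ p := by positivity
  have hR : 0 ≤ P * ε / B := by positivity
  calc _ ≤ ((P * ε / B * S ^ p) ^ (p / 2) * ((P * S) ^ p) ^ (1 - p / 2)) ^ p⁻¹ := by
        gcongr
    _ = ((P * ε / B) ^ (p / 2) * P ^ (p * (1 - p / 2)) * S ^ p) ^ p⁻¹ := by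
        rw [Real.mul_rpow hR hSp, Real.mul_rpow hP.le hS, Real.mul_rpow (by positivity) hSp,
          ← Real.rpow_mul hP.le]
        have : S ^ p = (S ^ p) ^ (p / 2) * (S ^ p) ^ (1 - p / 2) := by
          rw [← Real.rpow_add_of_nonneg hSp (by linarith) (by linarith), add_sub_cancel,
            Real.rpow_one]
        nth_rewrite 3 [this]
        ring_nf
    _ = (P * ε / B) ^ ((1 : ℝ) / 2) * P ^ (1 - p / 2) * S := by
        rw [Real.mul_rpow (by positivity) hSp, Real.mul_rpow (by positivity) (by positivity),
          ← Real.rpow_mul hR, ← Real.rpow_mul hP.le, ← Real.rpow_mul hS,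
          mul_inv_cancel₀ hp0.ne', Real.rpow_one]
        congr 3
        · field_simp
        · field_simp
    _ = _ := by
        rw [Real.div_rpow (by positivity) hB.le, Real.mul_rpow hP.le hε.le,
          show (3 - p) / 2 = 1 / 2 + (1 - p / 2) by ring, Real.rpow_add hP]
        ring

section Probability

variable {Ω : Type*} {m0 : MeasurableSpace Ω} {μ : Measure Ω} {p : ℝ}

lemma MeasureTheory.MemLp.integrable_of_norm_le_mul_rpow {E : Type*} [NormedAddCommGroup E]
    {r : Ω → E} {u : Ω → ℝ} {C : ℝ} (hp : 0 < p) (hr : MemLp r (ENNReal.ofReal p) μ)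
    (hu : AEStronglyMeasurable u μ) (h : ∀ ω, ‖u ω‖ ≤ C * ‖r ω‖ ^ p) : Integrable u μ := by
  have := hr.integrable_norm_rpow (by simpa using hp) ENNReal.ofReal_ne_top
  rw [ENNReal.toReal_ofReal hp.le] at this
  exact (this.const_mul C).mono' hu (ae_of_all _ h)

lemma MeasureTheory.MemLp.integral_norm_rpow_eq {E : Type*} [NormedAddCommGroup E]
    {r : Ω → E} (hp : 0 < p) (hr : MemLp r (ENNReal.ofReal p) μ) :
    ∫ ω, ‖r ω‖ ^ p ∂μ = (eLpNorm r (ENNReal.ofReal p) μ).toReal ^ p := by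
  have h0 : 0 ≤ ∫ ω, ‖r ω‖ ^ p ∂μ := integral_nonneg fun ω => by positivity
  rw [hr.eLpNorm_eq_integral_rpow_norm (by simpa using hp) ENNReal.ofReal_ne_top,
    ENNReal.toReal_ofReal hp.le, ENNReal.toReal_ofReal (by positivity), ← Real.rpow_mul h0,
    inv_mul_cancel₀ hp.ne', Real.rpow_one]

lemma rpow_sub_two_mul_le {a N : ℝ} (ha : 0 ≤ a) (haN : a ≤ N) :
    N ^ (p - 2) * a ≤ N ^ (p - 1) := by
  rcases (ha.trans haN).eq_or_lt with rfl | hN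
  · rw [le_antisymm haN ha, mul_zero]
    exact Real.rpow_nonneg le_rfl _
  · have : N ^ (p - 1) = N ^ (p - 2) * N := by
      rw [← Real.rpow_add_one hN.ne']; ring_nf
    rw [this]
    gcongr

lemma rpow_sub_one_mul_le {a N : ℝ} (ha : 0 ≤ a) (haN : a ≤ N) :
    N ^ (p - 1) * a ≤ N ^ p := by
  rcases (ha.trans haN).eq_or_lt with rfl | hN
  · rw [le_antisymm haN ha, mul_zero]
    exact Real.rpow_nonneg le_rfl _
  · have : N ^ p = N ^ (p - 1) * N := by
      rw [← Real.rpow_add_one hN.ne']; ring_nf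
    rw [this]
    gcongr

lemma abs_sub_inv_mul_le {a b : ℝ} (hp1 : 1 < p) (hp2 : p < 2) (ha : 0 ≤ a) (hb : 0 ≤ b) :
    |b - (p - 1)⁻¹ * a| ≤ (p - 1)⁻¹ * (a + b) := by
  have hq : 1 ≤ (p - 1)⁻¹ := (one_le_inv₀ (by linarith)).2 (by linarith)
  rw [abs_le]
  constructor <;> nlinarith [mul_nonneg (sub_nonneg.2 hq) hb, mul_nonneg (sub_nonneg.2 hq) ha]

lemma abs_burkholderFun_le {a b : ℝ} (hp1 : 1 < p) (hp2 : p < 2) (ha : 0 ≤ a) (hb : 0 ≤ b) :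
    |burkholderFun p a b| ≤ (p - 1)⁻¹ * (a + b) ^ p := by
  have hq : 0 < p - 1 := by linarith
  have hN := add_nonneg ha hb
  rw [burkholderFun, abs_mul, abs_of_nonneg (Real.rpow_nonneg hN _)]
  calc |b - (p - 1)⁻¹ * a| * (a + b) ^ (p - 1)
      ≤ (p - 1)⁻¹ * (a + b) * (a + b) ^ (p - 1) := by
        gcongr; exact abs_sub_inv_mul_le hp1 hp2 ha hb
    _ = (p - 1)⁻¹ * ((a + b) ^ (p - 1) * (a + b)) := by ring
    _ ≤ _ := by gcongr; exact rpow_sub_one_mul_le hN le_rfl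

lemma sq_mul_rpow_le {a b : ℝ} (hp1 : 1 < p) (hp2 : p < 2) (ha : 0 ≤ a) (hb : 0 ≤ b) :
    (b - (p - 1)⁻¹ * a) ^ 2 * (a + b) ^ (p - 2) ≤ ((p - 1)⁻¹) ^ 2 * (a + b) ^ p := by
  have hq : 0 < p - 1 := by linarith
  have hN := add_nonneg ha hb
  calc (b - (p - 1)⁻¹ * a) ^ 2 * (a + b) ^ (p - 2)
      ≤ ((p - 1)⁻¹ * (a + b)) ^ 2 * (a + b) ^ (p - 2) := by
        rw [← sq_abs]; gcongr; exact abs_sub_inv_mul_le hp1 hp2 ha hb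
    _ = ((p - 1)⁻¹) ^ 2 * ((a + b) ^ (p - 2) * (a + b) * (a + b)) := by ring
    _ ≤ ((p - 1)⁻¹) ^ 2 * ((a + b) ^ (p - 1) * (a + b)) := by
        gcongr; exact rpow_sub_two_mul_le hN le_rfl
    _ ≤ _ := by gcongr; exact rpow_sub_one_mul_le hN le_rfl

lemma lintegral_ofReal_rpow_mul_rpow_le {u v : Ω → ℝ} (hu : Integrable u μ) (hv : Integrable v μ)
    (hu0 : ∀ ω, 0 ≤ u ω) (hv0 : ∀ ω, 0 ≤ v ω) {r s : ℝ} (hr : 0 ≤ r) (hs : 0 ≤ s)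
    (hrs : r + s = 1) :
    ∫⁻ ω, ENNReal.ofReal (u ω ^ r * v ω ^ s) ∂μ ≤
      ENNReal.ofReal ((∫ ω, u ω ∂μ) ^ r * (∫ ω, v ω ∂μ) ^ s) := by
  have hu1 : 0 ≤ ∫ ω, u ω ∂μ := integral_nonneg hu0
  have hv1 : 0 ≤ ∫ ω, v ω ∂μ := integral_nonneg hv0
  rw [ENNReal.ofReal_mul (by positivity), ← ENNReal.ofReal_rpow_of_nonneg hu1 hr,
    ← ENNReal.ofReal_rpow_of_nonneg hv1 hs, ofReal_integral_eq_lintegral_ofReal hu (ae_of_all _ hu0),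
    ofReal_integral_eq_lintegral_ofReal hv (ae_of_all _ hv0)]
  refine le_of_eq_of_le (lintegral_congr fun ω => ?_) (ENNReal.lintegral_mul_norm_pow_le
    hu.1.aemeasurable.ennreal_ofReal hv.1.aemeasurable.ennreal_ofReal hr hs hrs)
  rw [ENNReal.ofReal_mul (Real.rpow_nonneg (hu0 ω) _), ENNReal.ofReal_rpow_of_nonneg (hu0 ω) hr,
    ENNReal.ofReal_rpow_of_nonneg (hv0 ω) hs]

lemma abs_rpow_eq_mul {a b : ℝ} (hp1 : 1 < p) (hp2 : p < 2) (ha : 0 ≤ a) (hb : 0 ≤ b) :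
    |b - (p - 1)⁻¹ * a| ^ p =
      ((b - (p - 1)⁻¹ * a) ^ 2 * (a + b) ^ (p - 2)) ^ (p / 2) * ((a + b) ^ p) ^ (1 - p / 2) := by
  have hp0 : 0 < p := by linarith
  rcases (add_nonneg ha hb).eq_or_lt with hN | hN
  · have ha' : a = 0 := by linarith
    have hb' : b = 0 := by linarith
    simp [ha', hb', Real.zero_rpow hp0.ne', Real.zero_rpow (by linarith : p / 2 ≠ 0)]
  · rw [Real.mul_rpow (sq_nonneg _) (by positivity), ← Real.rpow_mul hN.le, ← Real.rpow_mul hN.le,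
      mul_assoc, ← Real.rpow_add hN, show (p - 2) * (p / 2) + p * (1 - p / 2) = 0 by ring,
      Real.rpow_zero, mul_one, ← sq_abs, ← Real.rpow_natCast, ← Real.rpow_mul (abs_nonneg _)]
    congr 1
    push_cast
    ring

lemma add_rpow_le_mul {a b q : ℝ} (hp1 : 1 < p) (hq : 0 < q) (ha : 0 ≤ a) (hb : 0 ≤ b) :
    (a + b) ^ p ≤ (1 + q) ^ (p - 1) * (a ^ p + q * (b ^ p / q ^ p)) := by
  have := (convexOn_rpow hp1.le).2 (show a ∈ Set.Ici 0 from ha)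
    (show b / q ∈ Set.Ici 0 from div_nonneg hb hq.le) (show 0 ≤ 1 / (1 + q) by positivity)
    (show 0 ≤ q / (1 + q) by positivity) (by field_simp)
  simp only [smul_eq_mul] at this
  rw [show 1 / (1 + q) * a + q / (1 + q) * (b / q) = (a + b) / (1 + q) by field_simp,
    Real.div_rpow (by positivity) (by positivity), Real.div_rpow hb hq.le,
    div_le_iff₀ (by positivity)] at this
  refine this.trans_eq ?_
  have e : (1 + q) ^ p = (1 + q) ^ (p - 1) * (1 + q) := by
    rw [← Real.rpow_add_one (by positivity)]; ring_nf
  rw [e]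
  field_simp

variable {H : Type*} [NormedAddCommGroup H]

lemma MeasureTheory.MemLp.integrable_burkholderFun (hp1 : 1 < p) (hp2 : p < 2) {x y : Ω → H}
    (hx : MemLp x (ENNReal.ofReal p) μ) (hy : MemLp y (ENNReal.ofReal p) μ) :
    Integrable (fun ω => burkholderFun p ‖x ω‖ ‖y ω‖) μ := by
  refine (hx.norm.add hy.norm).integrable_of_norm_le_mul_rpow (C := (p - 1)⁻¹) (by linarith) ?_
    fun ω => ?_
  · have h1 := hx.1.norm.aemeasurable
    have h2 := hy.1.norm.aemeasurable
    unfold burkholderFun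
    exact AEMeasurable.aestronglyMeasurable (by fun_prop)
  · have hN := add_nonneg (norm_nonneg (x ω)) (norm_nonneg (y ω))
    simp only [Pi.add_apply, Real.norm_eq_abs]
    rw [abs_of_nonneg hN]
    exact abs_burkholderFun_le hp1 hp2 (norm_nonneg _) (norm_nonneg _)

lemma MeasureTheory.MemLp.integrable_sq_mul_rpow (hp1 : 1 < p) (hp2 : p < 2) {x y : Ω → H}
    (hx : MemLp x (ENNReal.ofReal p) μ) (hy : MemLp y (ENNReal.ofReal p) μ) :
    Integrable (fun ω => (‖y ω‖ - (p - 1)⁻¹ * ‖x ω‖) ^ 2 * (‖x ω‖ + ‖y ω‖) ^ (p - 2)) μ := by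
  refine (hx.norm.add hy.norm).integrable_of_norm_le_mul_rpow (C := ((p - 1)⁻¹) ^ 2)
    (by linarith) ?_ fun ω => ?_
  · have h1 := hx.1.norm.aemeasurable
    have h2 := hy.1.norm.aemeasurable
    exact AEMeasurable.aestronglyMeasurable (by fun_prop)
  · have hN := add_nonneg (norm_nonneg (x ω)) (norm_nonneg (y ω))
    simp only [Pi.add_apply, Real.norm_eq_abs]
    rw [abs_of_nonneg hN, abs_of_nonneg (by positivity)]
    exact sq_mul_rpow_le hp1 hp2 (norm_nonneg _) (norm_nonneg _)

/-- If `y` satisfies Burkholder's inequality relative to `x`, so does `‖x‖ + ‖y‖`. -/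
lemma integral_add_rpow_le (hp1 : 1 < p) {x y : Ω → H}
    (hx : MemLp x (ENNReal.ofReal p) μ) (hy : MemLp y (ENNReal.ofReal p) μ)
    (hyx : ∫ ω, ‖y ω‖ ^ p ∂μ ≤ ((p - 1)⁻¹) ^ p * ∫ ω, ‖x ω‖ ^ p ∂μ) :
    ∫ ω, (‖x ω‖ + ‖y ω‖) ^ p ∂μ ≤ (p / (p - 1)) ^ p * ∫ ω, ‖x ω‖ ^ p ∂μ := by
  have hp0 : 0 < p := by linarith
  have hq : 0 < p - 1 := by linarith
  have hqi : 0 < (p - 1)⁻¹ := inv_pos.2 hq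
  have iF : Integrable (fun ω => ‖x ω‖ ^ p) μ := by
    simpa [hp0.le] using hx.integrable_norm_rpow (by simpa using hp0) ENNReal.ofReal_ne_top
  have iG : Integrable (fun ω => ‖y ω‖ ^ p) μ := by
    simpa [hp0.le] using hy.integrable_norm_rpow (by simpa using hp0) ENNReal.ofReal_ne_top
  have iG' := (iG.div_const (((p - 1)⁻¹) ^ p)).const_mul (p - 1)⁻¹
  refine (integral_mono_of_nonneg (ae_of_all _ fun ω => by positivity)
    ((iF.add iG').const_mul ((1 + (p - 1)⁻¹) ^ (p - 1))) (ae_of_all _ fun ω =>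
      add_rpow_le_mul hp1 hqi (norm_nonneg (x ω)) (norm_nonneg (y ω)))).trans ?_
  simp only [Pi.add_apply]
  rw [integral_const_mul, integral_add iF iG', integral_const_mul, integral_div]
  have e1 : p / (p - 1) = 1 + (p - 1)⁻¹ := by field_simp; ring
  have e : (1 + (p - 1)⁻¹) ^ p = (1 + (p - 1)⁻¹) ^ (p - 1) * (1 + (p - 1)⁻¹) := by
    rw [← Real.rpow_add_one (by positivity)]; ring_nf
  have hdiv : (∫ ω, ‖y ω‖ ^ p ∂μ) / ((p - 1)⁻¹) ^ p ≤ ∫ ω, ‖x ω‖ ^ p ∂μ := by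
    rw [div_le_iff₀ (by positivity)]; linarith
  rw [e1, e, mul_assoc]
  gcongr
  nlinarith

variable [InnerProductSpace ℝ H] [CompleteSpace H] {ℱ : Filtration ℕ m0} {f g : ℕ → Ω → H}

lemma integrable_inner_smul_sub (hp1 : 1 < p) (hf : Martingale f ℱ μ)
    (hfp : ∀ n, MemLp (f n) (ENNReal.ofReal p) μ) (hgp : ∀ n, MemLp (g n) (ENNReal.ofReal p) μ)
    {n : ℕ} {ψ : Ω → H} {C : ℝ} (hC : 0 ≤ C) (hψ : StronglyMeasurable[ℱ n] ψ)
    (hbound : ∀ ω, ‖ψ ω‖ ≤ C * (‖f n ω‖ + ‖g n ω‖) ^ (p - 1)) :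
    Integrable (fun ω => inner ℝ (ψ ω) (f (n + 1) ω - f n ω)) μ := by
  refine (((hfp n).norm.add (hgp n).norm).add
    ((hfp (n + 1)).sub (hfp n)).norm).integrable_of_norm_le_mul_rpow (C := C) (by linarith) ?_
    fun ω => ?_
  · exact (hψ.mono (ℱ.le n)).aestronglyMeasurable.inner
      ((hf.integrable _).1.sub (hf.integrable _).1)
  · have h1 := norm_nonneg (f n ω)
    have h2 := norm_nonneg (g n ω)
    have h3 := norm_nonneg (f (n + 1) ω - f n ω)
    simp only [Pi.add_apply, Pi.sub_apply]
    rw [Real.norm_of_nonneg (by positivity : 0 ≤ ‖f n ω‖ + ‖g n ω‖ + ‖f (n + 1) ω - f n ω‖)]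
    calc ‖inner ℝ (ψ ω) (f (n + 1) ω - f n ω)‖
        ≤ ‖ψ ω‖ * ‖f (n + 1) ω - f n ω‖ := norm_inner_le_norm _ _
      _ ≤ C * (‖f n ω‖ + ‖g n ω‖) ^ (p - 1) * ‖f (n + 1) ω - f n ω‖ := by
          gcongr; exact hbound ω
      _ ≤ C * (‖f n ω‖ + ‖g n ω‖ + ‖f (n + 1) ω - f n ω‖) ^ (p - 1) * ‖f (n + 1) ω - f n ω‖ := by
          have := Real.rpow_le_rpow (add_nonneg h1 h2) (le_add_of_nonneg_right h3)
            (by linarith : 0 ≤ p - 1)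
          gcongr
      _ = C * ((‖f n ω‖ + ‖g n ω‖ + ‖f (n + 1) ω - f n ω‖) ^ (p - 1) *
            ‖f (n + 1) ω - f n ω‖) := by ring
      _ ≤ _ := by
          gcongr; exact rpow_sub_one_mul_le h3 (by linarith)

lemma MeasureTheory.Martingale.monotone_eLpNorm {q : ENNReal} (hq : 1 ≤ q)
    (hf : Martingale f ℱ μ) : Monotone fun n => eLpNorm (f n) q μ := fun _ _ hij =>
  (eLpNorm_congr_ae (hf.condExp_ae_eq hij)).symm.le.trans (eLpNorm_condExp_le_eLpNorm _ hq)

variable [IsProbabilityMeasure μ]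

lemma MeasureTheory.Martingale.integral_inner_sub_eq_zero (hf : Martingale f ℱ μ) {n : ℕ}
    {ψ : Ω → H} (hψ : StronglyMeasurable[ℱ n] ψ)
    (hint : Integrable (fun ω => inner ℝ (ψ ω) (f (n + 1) ω - f n ω)) μ) :
    ∫ ω, inner ℝ (ψ ω) (f (n + 1) ω - f n ω) ∂μ = 0 := by
  have hd : Integrable (f (n + 1) - f n) μ := (hf.integrable _).sub (hf.integrable _)
  have hpull := condExp_bilin_of_stronglyMeasurable_left (m := ℱ n) (μ := μ) (innerSL ℝ)
    (g := f (n + 1) - f n) hψ hint hd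
  have hzero : μ[f (n + 1) - f n | ℱ n] =ᵐ[μ] 0 := by
    filter_upwards [condExp_sub (hf.integrable (n + 1)) (hf.integrable n) (ℱ n),
      hf.condExp_ae_eq (Nat.le_succ n), hf.condExp_ae_eq (le_refl n)] with ω h1 h2 h3
    rw [h1, Pi.sub_apply, h2, h3, sub_self, Pi.zero_apply]
  rw [← integral_condExp (ℱ.le n)]
  refine integral_eq_zero_of_ae ?_
  filter_upwards [hpull, hzero] with ω h1 h2
  exact h1.trans (by rw [h2, Pi.zero_apply, map_zero, Pi.zero_apply])

lemma integral_burkholderFun_succ_le (hp1 : 1 < p) (hp2 : p < 2)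
    (hf : Martingale f ℱ μ) (hg : Martingale g ℱ μ)
    (hfp : ∀ n, MemLp (f n) (ENNReal.ofReal p) μ) (hgp : ∀ n, MemLp (g n) (ENNReal.ofReal p) μ)
    {n : ℕ} (hsub : ∀ᵐ ω ∂μ, ‖g (n + 1) ω - g n ω‖ ≤ ‖f (n + 1) ω - f n ω‖) :
    ∫ ω, burkholderFun p ‖f (n + 1) ω‖ ‖g (n + 1) ω‖ ∂μ ≤
      ∫ ω, burkholderFun p ‖f n ω‖ ‖g n ω‖ ∂μ := by
  have hq : 0 < p - 1 := by linarith
  have hp0 : 0 < p := by linarith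
  have hp2' : 0 < 2 - p := by linarith
  let ψ : Ω → H := fun ω => (p * (‖f n ω‖ + ‖g n ω‖) ^ (p - 2) +
    p * (2 - p) / (p - 1) * (‖f n ω‖ + ‖g n ω‖) ^ (p - 1) * ‖f n ω‖⁻¹) • f n ω
  let φ : Ω → H := fun ω => (p * (‖f n ω‖ + ‖g n ω‖) ^ (p - 2)) • g n ω
  have mf : Measurable[ℱ n] fun ω => ‖f n ω‖ := (hf.stronglyMeasurable n).norm.measurable
  have mg : Measurable[ℱ n] fun ω => ‖g n ω‖ := (hg.stronglyMeasurable n).norm.measurable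
  have hψ : StronglyMeasurable[ℱ n] ψ :=
    (Measurable.stronglyMeasurable (by fun_prop)).smul (hf.stronglyMeasurable n)
  have hφ : StronglyMeasurable[ℱ n] φ :=
    (Measurable.stronglyMeasurable (by fun_prop)).smul (hg.stronglyMeasurable n)
  have hψb : ∀ ω, ‖ψ ω‖ ≤ (p + p * (2 - p) / (p - 1)) * (‖f n ω‖ + ‖g n ω‖) ^ (p - 1) := by
    intro ω
    have h1 := norm_nonneg (f n ω)
    have h2 := norm_nonneg (g n ω)
    simp only [ψ]
    rw [norm_smul, Real.norm_of_nonneg (by positivity), add_mul, add_mul]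
    have h3 := rpow_sub_two_mul_le (p := p) h1 (le_add_of_nonneg_right h2 : _ ≤ _ + ‖g n ω‖)
    have h4 : ‖f n ω‖⁻¹ * ‖f n ω‖ ≤ 1 := inv_mul_le_one
    refine add_le_add ?_ ?_
    · rw [mul_assoc]; gcongr
    · rw [mul_assoc]
      exact mul_le_of_le_one_right (by positivity) h4
  have hφb : ∀ ω, ‖φ ω‖ ≤ p * (‖g n ω‖ + ‖f n ω‖) ^ (p - 1) := by
    intro ω
    have h1 := norm_nonneg (f n ω)
    have h2 := norm_nonneg (g n ω)
    simp only [φ]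
    rw [norm_smul, Real.norm_of_nonneg (by positivity), mul_assoc, add_comm ‖f n ω‖]
    gcongr
    exact rpow_sub_two_mul_le h2 (le_add_of_nonneg_right h1)
  have iψ := integrable_inner_smul_sub hp1 hf hfp hgp (by positivity) hψ hψb
  have iφ := integrable_inner_smul_sub hp1 hg hgp hfp hp0.le hφ hφb
  have iU := (hfp n).integrable_burkholderFun hp1 hp2 (hgp n)
  calc ∫ ω, burkholderFun p ‖f (n + 1) ω‖ ‖g (n + 1) ω‖ ∂μ
      ≤ ∫ ω, (burkholderFun p ‖f n ω‖ ‖g n ω‖ - inner ℝ (ψ ω) (f (n + 1) ω - f n ω) +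
          inner ℝ (φ ω) (g (n + 1) ω - g n ω)) ∂μ := by
        refine integral_mono_ae ((hfp _).integrable_burkholderFun hp1 hp2 (hgp _))
          ((iU.sub iψ).add iφ) ?_
        filter_upwards [hsub] with ω hω
        have := burkholderFun_norm_add_le (x := f n ω) (y := g n ω) hp1 hp2 hω
        simpa only [ψ, φ, inner_smul_left, add_sub_cancel, conj_trivial] using this
    _ = _ := by
        rw [integral_add (by exact iU.sub iψ) iφ, integral_sub iU iψ,
          hf.integral_inner_sub_eq_zero hψ iψ, hg.integral_inner_sub_eq_zero hφ iφ, sub_zero,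
          add_zero]

lemma integral_burkholderFun_nonpos (hp1 : 1 < p) (hp2 : p < 2)
    (hf : Martingale f ℱ μ) (hg : Martingale g ℱ μ)
    (hfp : ∀ n, MemLp (f n) (ENNReal.ofReal p) μ) (hgp : ∀ n, MemLp (g n) (ENNReal.ofReal p) μ)
    (hsub0 : ∀ᵐ ω ∂μ, ‖g 0 ω‖ ≤ ‖f 0 ω‖)
    (hsub : ∀ n : ℕ, ∀ᵐ ω ∂μ, ‖g (n + 1) ω - g n ω‖ ≤ ‖f (n + 1) ω - f n ω‖) (n : ℕ) :
    ∫ ω, burkholderFun p ‖f n ω‖ ‖g n ω‖ ∂μ ≤ 0 := by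
  induction n with
  | zero =>
    refine integral_nonpos_of_ae ?_
    filter_upwards [hsub0] with ω hω
    have hq : 1 ≤ (p - 1)⁻¹ := (one_le_inv₀ (by linarith)).2 (by linarith)
    refine mul_nonpos_of_nonpos_of_nonneg ?_ (by positivity)
    nlinarith [norm_nonneg (f 0 ω)]
  | succ n ih => exact (integral_burkholderFun_succ_le hp1 hp2 hf hg hfp hgp (hsub n)).trans ih

lemma stabilityConst_mul_integral_le (hp1 : 1 < p) (hp2 : p < 2)
    (hf : Martingale f ℱ μ) (hg : Martingale g ℱ μ)
    (hfp : ∀ n, MemLp (f n) (ENNReal.ofReal p) μ) (hgp : ∀ n, MemLp (g n) (ENNReal.ofReal p) μ)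
    (hsub0 : ∀ᵐ ω ∂μ, ‖g 0 ω‖ ≤ ‖f 0 ω‖)
    (hsub : ∀ n : ℕ, ∀ᵐ ω ∂μ, ‖g (n + 1) ω - g n ω‖ ≤ ‖f (n + 1) ω - f n ω‖) (n : ℕ) :
    stabilityConst p *
        ∫ ω, (‖g n ω‖ - (p - 1)⁻¹ * ‖f n ω‖) ^ 2 * (‖f n ω‖ + ‖g n ω‖) ^ (p - 2) ∂μ ≤
      ((p - 1)⁻¹) ^ p * ∫ ω, ‖f n ω‖ ^ p ∂μ - ∫ ω, ‖g n ω‖ ^ p ∂μ := by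
  have hp0 : 0 < p := by linarith
  have iU := (hfp n).integrable_burkholderFun hp1 hp2 (hgp n)
  have iF : Integrable (fun ω => ‖f n ω‖ ^ p) μ := by
    simpa [hp0.le] using (hfp n).integrable_norm_rpow (by simpa using hp0) ENNReal.ofReal_ne_top
  have iG : Integrable (fun ω => ‖g n ω‖ ^ p) μ := by
    simpa [hp0.le] using (hgp n).integrable_norm_rpow (by simpa using hp0) ENNReal.ofReal_ne_top
  have hneg := integral_burkholderFun_nonpos hp1 hp2 hf hg hfp hgp hsub0 hsub n
  have hmono := integral_mono
    (((hfp n).integrable_sq_mul_rpow hp1 hp2 (hgp n)).const_mul (stabilityConst p))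
    (((iU.const_mul (p ^ (2 - p))).sub iG).add (iF.const_mul (((p - 1)⁻¹) ^ p)))
    fun ω => stabilityConst_mul_le hp1 hp2 (norm_nonneg (f n ω)) (norm_nonneg (g n ω))
  rw [integral_const_mul] at hmono
  refine hmono.trans ?_
  simp only [Pi.add_apply, Pi.sub_apply]
  rw [integral_add (by exact (iU.const_mul _).sub iG) (iF.const_mul _),
    integral_sub (iU.const_mul _) iG, integral_const_mul, integral_const_mul]
  nlinarith [mul_nonneg (Real.rpow_nonneg hp0.le (2 - p)) (neg_nonneg.2 hneg)]

lemma integral_norm_rpow_le (hp1 : 1 < p) (hp2 : p < 2)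
    (hf : Martingale f ℱ μ) (hg : Martingale g ℱ μ)
    (hfp : ∀ n, MemLp (f n) (ENNReal.ofReal p) μ) (hgp : ∀ n, MemLp (g n) (ENNReal.ofReal p) μ)
    (hsub0 : ∀ᵐ ω ∂μ, ‖g 0 ω‖ ≤ ‖f 0 ω‖)
    (hsub : ∀ n : ℕ, ∀ᵐ ω ∂μ, ‖g (n + 1) ω - g n ω‖ ≤ ‖f (n + 1) ω - f n ω‖) (n : ℕ) :
    ∫ ω, ‖g n ω‖ ^ p ∂μ ≤ ((p - 1)⁻¹) ^ p * ∫ ω, ‖f n ω‖ ^ p ∂μ := by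
  have hQ0 : 0 ≤ ∫ ω, (‖g n ω‖ - (p - 1)⁻¹ * ‖f n ω‖) ^ 2 * (‖f n ω‖ + ‖g n ω‖) ^ (p - 2) ∂μ :=
    integral_nonneg fun ω => by positivity
  have hmain := stabilityConst_mul_integral_le hp1 hp2 hf hg hfp hgp hsub0 hsub n
  have := mul_nonneg (stabilityConst_pos hp1 hp2).le hQ0
  linarith

lemma eLpNorm_norm_sub_le (hp1 : 1 < p) (hp2 : p < 2)
    (hf : Martingale f ℱ μ) (hg : Martingale g ℱ μ)
    (hfp : ∀ n, MemLp (f n) (ENNReal.ofReal p) μ) (hgp : ∀ n, MemLp (g n) (ENNReal.ofReal p) μ)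
    (hsub0 : ∀ᵐ ω ∂μ, ‖g 0 ω‖ ≤ ‖f 0 ω‖)
    (hsub : ∀ n : ℕ, ∀ᵐ ω ∂μ, ‖g (n + 1) ω - g n ω‖ ≤ ‖f (n + 1) ω - f n ω‖) (n : ℕ) {S : ℝ}
    (hS : (eLpNorm (f n) (ENNReal.ofReal p) μ).toReal ≤ S) :
    eLpNorm (fun ω => ‖g n ω‖ - (p - 1)⁻¹ * ‖f n ω‖) (ENNReal.ofReal p) μ ≤
      ENNReal.ofReal (((((p - 1)⁻¹ * S) ^ p - (eLpNorm (g n) (ENNReal.ofReal p) μ).toReal ^ p) /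
        stabilityConst p) ^ (p / 2) * ((p / (p - 1) * S) ^ p) ^ (1 - p / 2)) ^ p⁻¹ := by
  have hp0 : 0 < p := by linarith
  have hq : 0 < p - 1 := by linarith
  have hκ := stabilityConst_pos hp1 hp2
  have hS0 : 0 ≤ S := ENNReal.toReal_nonneg.trans hS
  have hSp : (eLpNorm (f n) (ENNReal.ofReal p) μ).toReal ^ p ≤ S ^ p := by gcongr
  have hmain := stabilityConst_mul_integral_le hp1 hp2 hf hg hfp hgp hsub0 hsub n
  have iQ := (hfp n).integrable_sq_mul_rpow hp1 hp2 (hgp n)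
  have iN : Integrable (fun ω => (‖f n ω‖ + ‖g n ω‖) ^ p) μ := by
    refine (((hfp n).norm.add (hgp n).norm).integrable_norm_rpow (by simpa using hp0)
      ENNReal.ofReal_ne_top).congr (ae_of_all _ fun ω => ?_)
    simp only [Pi.add_apply, ENNReal.toReal_ofReal hp0.le]
    rw [Real.norm_of_nonneg (by positivity)]
  have hQ0 : 0 ≤ ∫ ω, (‖g n ω‖ - (p - 1)⁻¹ * ‖f n ω‖) ^ 2 * (‖f n ω‖ + ‖g n ω‖) ^ (p - 2) ∂μ :=
    integral_nonneg fun ω => by positivity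
  have hN0 : 0 ≤ ∫ ω, (‖f n ω‖ + ‖g n ω‖) ^ p ∂μ := integral_nonneg fun ω => by positivity
  have hN := integral_add_rpow_le hp1 (hfp n) (hgp n)
    (integral_norm_rpow_le hp1 hp2 hf hg hfp hgp hsub0 hsub n)
  rw [(hfp n).integral_norm_rpow_eq hp0, (hgp n).integral_norm_rpow_eq hp0] at hmain
  rw [(hfp n).integral_norm_rpow_eq hp0] at hN
  have hQle : ∫ ω, (‖g n ω‖ - (p - 1)⁻¹ * ‖f n ω‖) ^ 2 * (‖f n ω‖ + ‖g n ω‖) ^ (p - 2) ∂μ ≤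
      (((p - 1)⁻¹ * S) ^ p - (eLpNorm (g n) (ENNReal.ofReal p) μ).toReal ^ p) /
        stabilityConst p := by
    rw [le_div_iff₀ hκ, Real.mul_rpow (by positivity) hS0, mul_comm]
    exact hmain.trans (by gcongr)
  rw [eLpNorm_eq_lintegral_rpow_enorm_toReal (by simpa using hp0) ENNReal.ofReal_ne_top,
    ENNReal.toReal_ofReal hp0.le, one_div]
  gcongr
  calc ∫⁻ ω, ‖‖g n ω‖ - (p - 1)⁻¹ * ‖f n ω‖‖ₑ ^ p ∂μ
      = ∫⁻ ω, ENNReal.ofReal (((‖g n ω‖ - (p - 1)⁻¹ * ‖f n ω‖) ^ 2 *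
          (‖f n ω‖ + ‖g n ω‖) ^ (p - 2)) ^ (p / 2) *
          ((‖f n ω‖ + ‖g n ω‖) ^ p) ^ (1 - p / 2)) ∂μ := by
        refine lintegral_congr fun ω => ?_
        rw [← abs_rpow_eq_mul hp1 hp2 (norm_nonneg _) (norm_nonneg _), Real.enorm_eq_ofReal_abs,
          ENNReal.ofReal_rpow_of_nonneg (abs_nonneg _) hp0.le]
    _ ≤ _ := lintegral_ofReal_rpow_mul_rpow_le iQ iN (fun ω => by positivity)
          (fun ω => by positivity) (by linarith) (by linarith) (by ring)
    _ ≤ _ := by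
        apply ENNReal.ofReal_le_ofReal
        refine mul_le_mul (Real.rpow_le_rpow hQ0 hQle (by linarith))
          (Real.rpow_le_rpow hN0 ?_ (by linarith)) (Real.rpow_nonneg hN0 _)
          (Real.rpow_nonneg (hQ0.trans hQle) _)
        rw [Real.mul_rpow (by positivity) hS0]
        exact hN.trans (by gcongr)

end Probability

theorem stmt_4 {Ω : Type*} {m0 : MeasurableSpace Ω} {μ : Measure Ω} [IsProbabilityMeasure μ]
    {H : Type*} [NormedAddCommGroup H] [InnerProductSpace ℝ H]
    [SecondCountableTopology H] [CompleteSpace H]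
    (ℱ : Filtration ℕ m0)
    (p ε : ℝ) (hp1 : 1 < p) (hp2 : p < 2) (hε : 0 < ε)
    (c : ℝ)
    (hc : c = (p / (p - 1)) ^ ((3 - p) / 2) /
        (1 - p * (1 - 1 / p) ^ (p - 1)) ^ ((1 : ℝ) / 2))
    (f g : ℕ → Ω → H) (hf : Martingale f ℱ μ) (hg : Martingale g ℱ μ)
    (hsub0 : ∀ᵐ ω ∂μ, ‖g 0 ω‖ ≤ ‖f 0 ω‖)
    (hsub : ∀ n : ℕ, ∀ᵐ ω ∂μ, ‖g (n + 1) ω - g n ω‖ ≤ ‖f (n + 1) ω - f n ω‖)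
    (hfb : (⨆ n, eLpNorm (f n) (ENNReal.ofReal p) μ) < ⊤)
    (hgb : (⨆ n, eLpNorm (g n) (ENNReal.ofReal p) μ) < ⊤)
    (F G : Ω → H)
    (hF : ∀ᵐ ω ∂μ, Tendsto (fun n => f n ω) atTop (nhds (F ω)))
    (hG : ∀ᵐ ω ∂μ, Tendsto (fun n => g n ω) atTop (nhds (G ω)))
    (hlow : ENNReal.ofReal ((p - 1)⁻¹ - ε) * (⨆ n, eLpNorm (f n) (ENNReal.ofReal p) μ) ≤
        ⨆ n, eLpNorm (g n) (ENNReal.ofReal p) μ) :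
    eLpNorm (fun ω => ‖G ω‖ - (p - 1)⁻¹ * ‖F ω‖) (ENNReal.ofReal p) μ ≤
      ENNReal.ofReal (c * ε ^ ((1 : ℝ) / 2)) *
        ⨆ n, eLpNorm (f n) (ENNReal.ofReal p) μ := by
  have hp0 : 0 < p := by linarith
  have hone : 1 ≤ ENNReal.ofReal p := by simpa using hp1.le
  have hfp : ∀ n, MemLp (f n) (ENNReal.ofReal p) μ := fun n =>
    ⟨(hf.integrable n).1, (le_iSup (fun n => eLpNorm (f n) (ENNReal.ofReal p) μ) n).trans_lt hfb⟩
  have hgp : ∀ n, MemLp (g n) (ENNReal.ofReal p) μ := fun n =>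
    ⟨(hg.integrable n).1, (le_iSup (fun n => eLpNorm (g n) (ENNReal.ofReal p) μ) n).trans_lt hgb⟩
  have hbound : ∀ n, (eLpNorm (f n) (ENNReal.ofReal p) μ).toReal ≤
      (⨆ n, eLpNorm (f n) (ENNReal.ofReal p) μ).toReal := fun n =>
    ENNReal.toReal_mono hfb.ne (le_iSup (fun n => eLpNorm (f n) (ENNReal.ofReal p) μ) n)
  have hlim : Tendsto (fun n => (eLpNorm (g n) (ENNReal.ofReal p) μ).toReal) atTop
      (nhds (⨆ n, eLpNorm (g n) (ENNReal.ofReal p) μ).toReal) :=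
    (ENNReal.tendsto_toReal hgb.ne).comp (tendsto_atTop_iSup (hg.monotone_eLpNorm hone))
  have hlow' := ENNReal.toReal_mono hgb.ne hlow
  rw [ENNReal.toReal_mul, ENNReal.toReal_ofReal'] at hlow'
  rw [← ENNReal.ofReal_toReal hfb.ne]
  generalize (⨆ n, eLpNorm (f n) (ENNReal.ofReal p) μ).toReal = S at hbound hlow' ⊢
  generalize (⨆ n, eLpNorm (g n) (ENNReal.ofReal p) μ).toReal = T at hlim hlow'
  have hS : 0 ≤ S := ENNReal.toReal_nonneg.trans (hbound 0)
  have hlim' := (Real.continuous_rpow_const hp0.le).continuousAt.tendsto.comp hlim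
  have hT : T ^ p ≤ ((p - 1)⁻¹ * S) ^ p := by
    refine le_of_tendsto' hlim' fun n => ?_
    have h := integral_norm_rpow_le hp1 hp2 hf hg hfp hgp hsub0 hsub n
    rw [(hfp n).integral_norm_rpow_eq hp0, (hgp n).integral_norm_rpow_eq hp0] at h
    have hq : 0 ≤ (p - 1)⁻¹ := inv_nonneg.2 (by linarith)
    rw [Real.mul_rpow hq hS]
    refine h.trans ?_
    gcongr
    exact hbound n
  have hD : ∀ᵐ ω ∂μ, Tendsto (fun n => ‖g n ω‖ - (p - 1)⁻¹ * ‖f n ω‖) atTop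
      (nhds (‖G ω‖ - (p - 1)⁻¹ * ‖F ω‖)) := by
    filter_upwards [hF, hG] with ω h1 h2
    exact h2.norm.sub (h1.norm.const_mul _)
  have hRlim := (ENNReal.continuous_rpow_const (y := p⁻¹)).continuousAt.tendsto.comp
    (ENNReal.tendsto_ofReal ((((hlim'.const_sub (((p - 1)⁻¹ * S) ^ p)).div_const
      (stabilityConst p)).rpow_const (p := p / 2) (Or.inr (by positivity))).mul_const
        (((p / (p - 1) * S) ^ p) ^ (1 - p / 2))))
  have hfatou := Lp.eLpNorm_lim_le_liminf_eLpNorm (p := ENNReal.ofReal p)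
    (fun n => ((hgp n).1.norm.sub ((hfp n).1.norm.const_mul (p - 1)⁻¹))) _ hD
  refine hfatou.trans ((liminf_le_liminf (Eventually.of_forall fun n =>
    eLpNorm_norm_sub_le hp1 hp2 hf hg hfp hgp hsub0 hsub n (hbound n))).trans ?_)
  refine hRlim.liminf_eq.le.trans ?_
  have hκ := stabilityConst_pos hp1 hp2
  have hdiff := div_nonneg (sub_nonneg.2 hT) hκ.le
  have hP : 0 < p / (p - 1) := div_pos hp0 (by linarith)
  have hB := one_sub_mul_rpow_pos hp1 hp2
  rw [ENNReal.ofReal_rpow_of_nonneg (by positivity) (by positivity),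
    ← ENNReal.ofReal_mul (by rw [hc]; positivity), hc]
  exact ENNReal.ofReal_le_ofReal (stability_bound_le hp1 hp2 hε hS hlow' hT)
end

section
/- Let 2 < p < ∞ and ε > 0, and set c_p = (p−1)·(2pe/((p−2)(e−2)))^{1/p}. Let f, g be discrete-time H-valued martingales on a filtered probability space such that g is differentially subordinate to f, both are L^p-bounded, and f_n → F and g_n → G almost surely as n → ∞. If ‖g‖_p ≥ (p−1−ε)·‖f‖_p, then ‖ ‖G‖_H − (p−1)‖F‖_H ‖_{L^p(Ω)} ≤ c_p · ε^{1/p} · ‖f‖_p. -/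
open MeasureTheory Filter

lemma nonneg_of_concaveOn_deriv {m m' : ℝ → ℝ} (hcont : ContinuousOn m (Set.Icc 0 1))
    (hderiv : ∀ x ∈ Set.Ioo (0 : ℝ) 1, HasDerivAt m (m' x) x)
    (hconc : ConcaveOn ℝ (Set.Icc 0 1) m') (h0' : 0 ≤ m' 0) (h0 : 0 ≤ m 0) (h1 : 0 ≤ m 1)
    {t : ℝ} (ht : t ∈ Set.Icc (0 : ℝ) 1) : 0 ≤ m t := by
  obtain ⟨ht0, ht1⟩ := ht
  by_contra! hneg
  have ht0' : 0 < t := lt_of_le_of_ne ht0 (by rintro rfl; linarith)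
  have ht1' : t < 1 := lt_of_le_of_ne ht1 (by rintro rfl; linarith)
  obtain ⟨x, hx, hxd⟩ := exists_hasDerivAt_eq_slope m m' ht0'
    (hcont.mono (Set.Icc_subset_Icc le_rfl ht1))
    (fun y hy => hderiv y ⟨hy.1, hy.2.trans ht1'⟩)
  obtain ⟨y, hy, hyd⟩ := exists_hasDerivAt_eq_slope m m' ht1'
    (hcont.mono (Set.Icc_subset_Icc ht0 le_rfl))
    (fun y hy => hderiv y ⟨ht0'.trans hy.1, hy.2⟩)
  have hx' : m' x < 0 := by
    rw [hxd]
    exact div_neg_of_neg_of_pos (by linarith) (by linarith)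
  have hy' : 0 < m' y := by
    rw [hyd]
    exact div_pos (by linarith) (by linarith)
  have hy0 : 0 < y := ht0'.trans hy.1
  have hxy : x < y := hx.2.trans hy.1
  have key := hconc.2 (show (0 : ℝ) ∈ Set.Icc 0 1 by simp)
    (show y ∈ Set.Icc (0 : ℝ) 1 from ⟨hy0.le, hy.2.le⟩)
    (show 0 ≤ 1 - x / y by rw [sub_nonneg, div_le_one hy0]; exact hxy.le)
    (show 0 ≤ x / y from div_nonneg hx.1.le hy0.le) (by ring)
  have e : (1 - x / y) • (0 : ℝ) + (x / y) • y = x := by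
    simp only [smul_eq_mul]; field_simp; ring
  rw [e] at key
  simp only [smul_eq_mul] at key
  have h3 : 0 ≤ (1 - x / y) * m' 0 := mul_nonneg
    (by rw [sub_nonneg, div_le_one hy0]; exact hxy.le) h0'
  have h4 : 0 ≤ x / y * m' y := mul_nonneg (div_nonneg hx.1.le hy0.le) hy'.le
  linarith

lemma hasDerivAt_affine_rpow {p : ℝ} (hp : 1 ≤ p) (a x : ℝ) :
    HasDerivAt (fun t : ℝ => (1 + a * t) ^ p) (p * a * (1 + a * x) ^ (p - 1)) x := by
  have h : HasDerivAt (fun t : ℝ => 1 + a * t) a x := by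
    simpa using ((hasDerivAt_id x).const_mul a).const_add 1
  convert h.rpow_const (p := p) (Or.inr hp) using 1
  ring

lemma convexOn_affine_rpow {q : ℝ} (hq : 1 ≤ q) {a : ℝ} (ha : -1 ≤ a) :
    ConvexOn ℝ (Set.Icc 0 1) (fun t : ℝ => (1 + a * t) ^ q) := by
  have h := (convexOn_rpow hq).comp_affineMap (AffineMap.lineMap (k := ℝ) (1 : ℝ) (1 + a))
  have h2 := h.subset (s := Set.Icc (0 : ℝ) 1) (by
    rintro t ⟨h0, h1⟩
    simp only [Set.mem_preimage, AffineMap.lineMap_apply, Set.mem_Ici, vsub_eq_sub, vadd_eq_add,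
      smul_eq_mul]
    nlinarith) (convex_Icc _ _)
  refine h2.congr ?_
  intro t _
  simp [AffineMap.lineMap_apply]
  congr 1
  ring

/-- The positive half of the quantitative comparison, in normalized coordinates. -/
lemma mul_rpow_le_of_nonneg {p c : ℝ} (hp : 2 < p) (hc : 0 ≤ c)
    (hc1 : c ≤ p ^ 2 / (p - 1) - (1 + 1 / (p - 1)) ^ p) {t : ℝ} (ht : t ∈ Set.Icc (0 : ℝ) 1) :
    c * t ^ p ≤ p ^ 2 / (p - 1) * t - (1 + 1 / (p - 1) * t) ^ p + (1 - t) ^ p := by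
  have hq : 0 < p - 1 := by linarith
  suffices h : 0 ≤ p ^ 2 / (p - 1) * t - (1 + 1 / (p - 1) * t) ^ p + (1 + -1 * t) ^ p
      - c * t ^ p by
    have e : 1 + -1 * t = 1 - t := by ring
    rw [e] at h
    linarith
  have hd : ∀ x : ℝ, HasDerivAt (fun t : ℝ => p ^ 2 / (p - 1) * t - (1 + 1 / (p - 1) * t) ^ p
      + (1 + -1 * t) ^ p - c * t ^ p)
      (p ^ 2 / (p - 1) - p * (1 / (p - 1)) * (1 + 1 / (p - 1) * x) ^ (p - 1)
        + p * (-1) * (1 + -1 * x) ^ (p - 1) - c * (p * x ^ (p - 1))) x := by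
    intro x
    have h1 : HasDerivAt (fun t : ℝ => p ^ 2 / (p - 1) * t) (p ^ 2 / (p - 1)) x := by
      simpa using (hasDerivAt_id x).const_mul (p ^ 2 / (p - 1))
    exact ((h1.sub (hasDerivAt_affine_rpow (by linarith) (1 / (p - 1)) x)).add
      (hasDerivAt_affine_rpow (by linarith) (-1) x)).sub
      ((Real.hasDerivAt_rpow_const (x := x) (p := p) (Or.inr (by linarith))).const_mul c)
  refine nonneg_of_concaveOn_deriv
    (m := fun t : ℝ => p ^ 2 / (p - 1) * t - (1 + 1 / (p - 1) * t) ^ p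
      + (1 + -1 * t) ^ p - c * t ^ p) (m' := fun x => _)
    (fun x _ => (hd x).continuousAt.continuousWithinAt) (fun x _ => hd x) ?_ ?_ ?_ ?_ ht
  · have c1 := (convexOn_affine_rpow (q := p - 1) (by linarith) (a := 1 / (p - 1))
      (by have : 0 < 1 / (p - 1) := by positivity
          linarith)).smul (c := p * (1 / (p - 1))) (by positivity)
    have c2 := (convexOn_affine_rpow (q := p - 1) (by linarith) (a := -1) le_rfl).smul
      (c := p) (by linarith)
    have c3 := ((convexOn_rpow (p := p - 1) (by linarith)).subset (s := Set.Icc (0 : ℝ) 1)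
      Set.Icc_subset_Ici_self (convex_Icc _ _)).smul (c := c * p) (by nlinarith)
    refine (((c1.add c2).add c3).neg.add_const (p ^ 2 / (p - 1))).congr ?_
    intro x _
    simp only [Pi.add_apply, Pi.neg_apply, smul_eq_mul]
    ring
  · have : (0 : ℝ) ^ (p - 1) = 0 := Real.zero_rpow (by linarith)
    simp only [mul_zero, add_zero, Real.one_rpow, this]
    apply le_of_eq
    field_simp
    ring
  · have : (0 : ℝ) ^ p = 0 := Real.zero_rpow (by linarith)
    simp [this]
  · have : (0 : ℝ) ^ p = 0 := Real.zero_rpow (by linarith)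
    simp only [mul_one, Real.one_rpow]
    norm_num
    rw [this]
    simp only [one_div] at hc1
    linarith

/-- The negative half of the quantitative comparison, in normalized coordinates. -/
lemma mul_rpow_le_of_neg {p c : ℝ} (hp : 2 < p) (hc : 0 ≤ c)
    (hc1 : c ≤ 1 - 1 / (p - 1) ^ 2) {t : ℝ} (ht : t ∈ Set.Icc (0 : ℝ) (p - 1)) :
    c * t ^ p ≤ -(p ^ 2 / (p - 1) * t) - (1 - 1 / (p - 1) * t) ^ p + (1 + t) ^ p := by
  have hq : 0 < p - 1 := by linarith
  have hd : ∀ x : ℝ, HasDerivAt (fun t : ℝ => -(p ^ 2 / (p - 1) * t)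
      - (1 + -(1 / (p - 1)) * t) ^ p + (1 + 1 * t) ^ p - c * t ^ p)
      (-(p ^ 2 / (p - 1)) - p * (-(1 / (p - 1))) * (1 + -(1 / (p - 1)) * x) ^ (p - 1)
        + p * 1 * (1 + 1 * x) ^ (p - 1) - c * (p * x ^ (p - 1))) x := by
    intro x
    have h1 : HasDerivAt (fun t : ℝ => -(p ^ 2 / (p - 1) * t)) (-(p ^ 2 / (p - 1))) x := by
      simpa using (hasDerivAt_id x).const_mul (-(p ^ 2 / (p - 1)))
    exact ((h1.sub (hasDerivAt_affine_rpow (by linarith) (-(1 / (p - 1))) x)).add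
      (hasDerivAt_affine_rpow (by linarith) 1 x)).sub
      ((Real.hasDerivAt_rpow_const (x := x) (p := p) (Or.inr (by linarith))).const_mul c)
  have hmono := monotoneOn_of_deriv_nonneg (convex_Icc 0 (p - 1))
    (fun x _ => (hd x).continuousAt.continuousWithinAt)
    (fun x _ => (hd x).differentiableAt.differentiableWithinAt)
    (fun x hx => by
      rw [interior_Icc] at hx
      rw [(hd x).deriv]
      obtain ⟨hx0, hx1⟩ := hx
      have hxq : 1 / (p - 1) * x ≤ 1 := by
        rw [div_mul_eq_mul_div, one_mul, div_le_one hq]; exact hx1.le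
      have b1 := one_add_mul_self_le_rpow_one_add (s := -(1 / (p - 1)) * x) (by linarith)
        (p := p - 1) (by linarith)
      have b2 := one_add_mul_self_le_rpow_one_add (s := x) (by linarith)
        (p := p - 1) (by linarith)
      have b3 := Real.add_rpow_le_rpow_add zero_le_one hx0.le (p := p - 1) (by linarith)
      rw [Real.one_rpow] at b3
      have e1 : (p - 1) * (-(1 / (p - 1)) * x) = -x := by field_simp
      rw [e1] at b1
      have hc2 : c ≤ 1 := hc1.trans (by
        have : 0 < 1 / (p - 1) ^ 2 := by positivity
        linarith)
      have hc3 : 1 / (p - 1) ≤ (1 - c) * (p - 1) := by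
        have : 1 / (p - 1) = 1 / (p - 1) ^ 2 * (p - 1) := by field_simp
        rw [this]
        exact mul_le_mul_of_nonneg_right (by linarith) hq.le
      have b4 : 1 + 1 / (p - 1) * x ≤ (1 + x) ^ (p - 1) - c * x ^ (p - 1) := by
        have k1 := mul_le_mul_of_nonneg_left b3 hc
        have k2 := mul_le_mul_of_nonneg_left b2 (sub_nonneg.2 hc2)
        have k3 := mul_le_mul_of_nonneg_right hc3 hx0.le
        nlinarith
      have k4 := mul_le_mul_of_nonneg_left b4 (show 0 ≤ p by linarith)
      have k5 := mul_le_mul_of_nonneg_left b1 (show 0 ≤ p * (1 / (p - 1)) by positivity)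
      have e2 : p ^ 2 / (p - 1) = p + p * (1 / (p - 1)) := by field_simp; ring
      rw [e2, one_mul]
      nlinarith)
  have h := hmono (show (0 : ℝ) ∈ Set.Icc 0 (p - 1) from ⟨le_rfl, hq.le⟩) ht ht.1
  have : (0 : ℝ) ^ p = 0 := Real.zero_rpow (by linarith)
  simp only [mul_zero, add_zero, Real.one_rpow, this, one_mul, neg_zero] at h
  have e : 1 + -(1 / (p - 1)) * t = 1 - 1 / (p - 1) * t := by ring
  rw [e] at h
  linarith

lemma exp_neg_one_le_div_rpow {q : ℝ} (hq : 0 < q) :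
    Real.exp (-1) ≤ (q / (q + 1)) ^ q := by
  have h1 : 0 < q / (q + 1) := by positivity
  rw [Real.rpow_def_of_pos h1, Real.exp_le_exp]
  have h2 := Real.one_sub_inv_le_log_of_pos h1
  have h3 : 1 - (q / (q + 1))⁻¹ = -1 / q := by field_simp; ring
  rw [h3] at h2
  calc (-1 : ℝ) = -1 / q * q := by field_simp
    _ ≤ _ := mul_le_mul_of_nonneg_right h2 hq.le

lemma half_sub_exp_neg_one_lt : 1 / 2 - Real.exp (-1) < 0.1323 := by
  have h := Real.exp_one_lt_d9
  rw [Real.exp_neg]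
  have : (0.3678 : ℝ) ≤ (Real.exp 1)⁻¹ := by
    rw [le_inv_comm₀ (by norm_num) (Real.exp_pos 1)]
    exact h.le.trans (by norm_num)
  linarith

lemma half_sub_exp_neg_one_pos : 0 < 1 / 2 - Real.exp (-1) := by
  have h2 := Real.exp_one_gt_d9
  rw [Real.exp_neg]
  have : (Real.exp 1)⁻¹ < 1 / 2 := by
    rw [inv_lt_comm₀ (Real.exp_pos 1) (by norm_num)]
    norm_num
    linarith
  linarith

lemma log_three_halves_le : Real.log 1.5 ≤ 0.42 := by
  rw [Real.log_le_iff_le_exp (by norm_num)]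
  exact le_trans (by norm_num) (Real.quadratic_le_exp_of_nonneg (x := 0.42) (by norm_num))

lemma one_add_le_mul_div_rpow {p : ℝ} (hp : 2 < p) :
    1 + (p - 2) / (p - 1) * (1 / 2 - Real.exp (-1)) ≤ p * ((p - 1) / p) ^ (p - 1) := by
  have hq : 0 < p - 1 := by linarith
  have hp0 : 0 < p := by linarith
  have hk := half_sub_exp_neg_one_lt
  have hk0 := half_sub_exp_neg_one_pos.le
  have hr : (p - 2) / (p - 1) = 1 - 1 / (p - 1) := by field_simp; ring
  have hu : 0 < 1 / (p - 1) := by positivity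
  have hu1 : 1 / (p - 1) < 1 := by rw [div_lt_one hq]; linarith
  rcases le_total 3.1 p with h | h
  · have h1 := exp_neg_one_le_div_rpow hq
    rw [sub_add_cancel] at h1
    have h2 : 3.1 * 0.3677 ≤ p * ((p - 1) / p) ^ (p - 1) :=
      mul_le_mul h (le_trans (by linarith) h1) (by norm_num) hp0.le
    rw [hr]
    nlinarith
  · have hpos : 0 < (p - 1) / p := by positivity
    have e : p * ((p - 1) / p) ^ (p - 1)
        = Real.exp (Real.log p - (p - 1) * Real.log (p / (p - 1))) := by
      rw [Real.exp_sub, Real.exp_log hp0, Real.rpow_def_of_pos hpos,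
        show Real.log ((p - 1) / p) = - Real.log (p / (p - 1)) by
          rw [← Real.log_inv, inv_div], div_eq_mul_inv _ (Real.exp _), ← Real.exp_neg]
      congr 2
      ring
    rw [e]
    refine le_trans ?_ (Real.add_one_le_exp _)
    have e2 : Real.log p = Real.log (p - 1) + Real.log (p / (p - 1)) := by
      rw [← Real.log_mul hq.ne' (by positivity)]
      congr 1
      field_simp
    have l1 := Real.one_sub_inv_le_log_of_pos hq
    have l2 : Real.log (p / (p - 1)) ≤ 0.42 + (p / (p - 1) / 1.5 - 1) := by
      have e3 : Real.log (p / (p - 1)) = Real.log 1.5 + Real.log (p / (p - 1) / 1.5) := by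
        rw [← Real.log_mul (by norm_num) (by positivity)]
        congr 1
        field_simp
      rw [e3]
      exact add_le_add log_three_halves_le (Real.log_le_sub_one_of_pos (by positivity))
    set L := Real.log (p / (p - 1))
    have l3 : (p - 1) * L ≤ 1 - (1 / 2 - Real.exp (-1)) := by
      have := mul_le_mul_of_nonneg_left l2 hq.le
      have e4 : (p - 1) * (0.42 + (p / (p - 1) / 1.5 - 1)) = p / 1.5 - 0.58 * (p - 1) := by
        field_simp
        ring
      rw [e4] at this
      norm_num at this hk h ⊢
      linarith
    rw [e2, hr]
    rw [inv_eq_one_div] at l1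
    have e5 : L - (p - 1) * L = -((1 - 1 / (p - 1)) * ((p - 1) * L)) := by
      field_simp
      ring
    have := mul_le_mul_of_nonneg_left l3 (sub_nonneg.2 hu1.le)
    nlinarith

/-- Burkholder's majorization `|y|^p - (p-1)^p |x|^p ≤ U(x, y)`, with a quantitative gap. -/
lemma mul_abs_rpow_le_gap {p a b : ℝ} (hp : 2 < p) (ha : 0 ≤ a) (hb : 0 ≤ b) :
    (p - 2) / (p - 1) * (1 / 2 - Real.exp (-1)) * |b - (p - 1) * a| ^ p ≤
      p * ((p - 1) / p) ^ (p - 1) * ((b - (p - 1) * a) * (a + b) ^ (p - 1))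
        - b ^ p + (p - 1) ^ p * a ^ p := by
  have hq : 0 < p - 1 := by linarith
  have hp0 : 0 < p := by linarith
  rcases (add_nonneg ha hb).eq_or_lt' with hL | hL
  · obtain rfl : a = 0 := by linarith
    obtain rfl : b = 0 := by linarith
    have : (0 : ℝ) ^ p = 0 := Real.zero_rpow (by linarith)
    simp [this]
  set L := a + b with hLdef
  set k := 1 / 2 - Real.exp (-1) with hkdef
  have hk0 : 0 ≤ k := half_sub_exp_neg_one_pos.le
  have hk1 : k ≤ Real.exp (-1) := by
    have := half_sub_exp_neg_one_lt
    linarith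
  have hγ := exp_neg_one_le_div_rpow hq
  rw [sub_add_cancel] at hγ
  have hα := one_add_le_mul_div_rpow hp
  set γ := ((p - 1) / p) ^ (p - 1) with hγdef
  have hγ0 : 0 < γ := by positivity
  set β := ((p - 1) / p) ^ p with hβdef
  have hβ0 : 0 < β := by positivity
  have hβγ : β = γ * ((p - 1) / p) := by
    rw [hβdef, hγdef, ← Real.rpow_add_one (by positivity), sub_add_cancel]
  set K := (p - 2) / (p - 1) * k with hK
  have hK0 : 0 ≤ K := mul_nonneg (div_nonneg (by linarith) hq.le) hk0
  have hc0 : 0 ≤ K / β := by positivity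
  have hc1 : K / β ≤ p ^ 2 / (p - 1) - (1 + 1 / (p - 1)) ^ p := by
    rw [div_le_iff₀ hβ0, sub_mul, hβdef, ← Real.mul_rpow (by positivity) (by positivity),
      show (1 + 1 / (p - 1)) * ((p - 1) / p) = 1 by field_simp; ring, Real.one_rpow,
      ← hβdef, hβγ, show p ^ 2 / (p - 1) * (γ * ((p - 1) / p)) = p * γ by field_simp]
    linarith
  have hc2 : K / β ≤ 1 - 1 / (p - 1) ^ 2 := by
    rw [div_le_iff₀ hβ0, hβγ, hK,
      show (1 - 1 / (p - 1) ^ 2) * (γ * ((p - 1) / p)) = (p - 2) / (p - 1) * γ by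
        field_simp; ring]
    exact mul_le_mul_of_nonneg_left (hk1.trans hγ) (div_nonneg (by linarith) hq.le)
  have hβL : 0 ≤ β * L ^ p := by positivity
  have hLp : L ^ p = L ^ (p - 1) * L := by
    rw [← Real.rpow_add_one hL.ne', sub_add_cancel]
  have hsc : ∀ r : ℝ, 0 ≤ r → β * L ^ p * r ^ p = ((p - 1) / p * L * r) ^ p := by
    intro r hr
    rw [Real.mul_rpow (by positivity) hr, Real.mul_rpow (by positivity) hL.le]
  have e1 : (p - 1) / p * L * (1 + 1 / (p - 1) * ((b - (p - 1) * a) / L)) = b := by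
    field_simp
    rw [hLdef]
    ring
  have e2 : (p - 1) / p * L * (1 - (b - (p - 1) * a) / L) = (p - 1) * a := by
    field_simp
    rw [hLdef]
    ring
  have e3 : p ^ 2 / (p - 1) * ((b - (p - 1) * a) / L) * (β * L ^ p)
      = p * γ * ((b - (p - 1) * a) * L ^ (p - 1)) := by
    rw [hLp, hβγ]
    field_simp
  have e4 : (p - 1) ^ p * a ^ p = ((p - 1) * a) ^ p := (Real.mul_rpow hq.le ha).symm
  have e6 : K * |b - (p - 1) * a| ^ p
      = K / β * |(b - (p - 1) * a) / L| ^ p * (β * L ^ p) := by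
    rw [abs_div, abs_of_pos hL, Real.div_rpow (abs_nonneg _) hL.le]
    have : 0 < L ^ p := by positivity
    field_simp
  set t := (b - (p - 1) * a) / L with ht
  rw [e6, e4, ← e3]
  rcases le_total 0 t with h | h
  · have h1 : t ≤ 1 := by
      rw [ht, div_le_one hL, hLdef]
      nlinarith
    have hm := mul_le_mul_of_nonneg_right (mul_rpow_le_of_nonneg hp hc0 hc1 ⟨h, h1⟩) hβL
    rw [abs_of_nonneg h]
    have f1 := hsc (1 + 1 / (p - 1) * t) (by positivity)
    have f2 := hsc (1 - t) (by linarith)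
    rw [e1] at f1
    rw [e2] at f2
    rw [← f1, ← f2]
    linarith
  · have h1 : -t ≤ p - 1 := by
      rw [ht, ← neg_div, div_le_iff₀ hL, hLdef]
      nlinarith
    have hm := mul_le_mul_of_nonneg_right
      (mul_rpow_le_of_neg hp hc0 hc2 ⟨neg_nonneg.2 h, h1⟩) hβL
    rw [abs_of_nonpos h]
    have h2 : 1 / (p - 1) * -t ≤ 1 := by
      rw [div_mul_eq_mul_div, one_mul, div_le_one hq]
      exact h1
    have f1 := hsc (1 + 1 / (p - 1) * t) (by linarith)
    have f2 := hsc (1 - t) (by linarith)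
    rw [e1] at f1
    rw [e2] at f2
    rw [← f1, ← f2]
    rw [show 1 - 1 / (p - 1) * -t = 1 + 1 / (p - 1) * t by ring,
      show 1 + -t = 1 - t by ring] at hm
    linarith

lemma one_add_rpow_le_trapezoid {p w : ℝ} (hp : 2 ≤ p) (hw : 0 ≤ w) :
    (1 + w) ^ p ≤ 1 + p * w / 2 * (1 + (1 + w) ^ (p - 1)) := by
  have hd : ∀ x : ℝ, HasDerivAt (fun w : ℝ => 1 + p * w / 2 * (1 + (1 + 1 * w) ^ (p - 1))
      - (1 + 1 * w) ^ p)
      (p / 2 * (1 + (1 + 1 * x) ^ (p - 1))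
        + p * x / 2 * ((p - 1) * 1 * (1 + 1 * x) ^ (p - 1 - 1))
        - p * 1 * (1 + 1 * x) ^ (p - 1)) x := by
    intro x
    have h1 : HasDerivAt (fun t : ℝ => p * t / 2) (p / 2) x := by
      simpa using ((hasDerivAt_id x).const_mul p).div_const 2
    exact ((h1.mul ((hasDerivAt_affine_rpow (p := p - 1) (by linarith) 1 x).const_add
      1)).const_add 1).sub (hasDerivAt_affine_rpow (by linarith) 1 x)
  have hmono := monotoneOn_of_deriv_nonneg (convex_Ici 0)
    (fun x _ => (hd x).continuousAt.continuousWithinAt)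
    (fun x _ => (hd x).differentiableAt.differentiableWithinAt)
    (fun x hx => by
      rw [interior_Ici] at hx
      rw [(hd x).deriv]
      have hx0 : 0 < x := hx
      have h1 : 0 < 1 + x := by linarith
      have b1 := one_add_mul_self_le_rpow_one_add (s := -(x / (1 + x)))
        (by rw [neg_le_neg_iff, div_le_one h1]; linarith) (p := p - 1) (by linarith)
      rw [show 1 + -(x / (1 + x)) = (1 + x)⁻¹ by field_simp; ring, Real.inv_rpow h1.le] at b1
      have e : (1 + x) ^ (p - 1) = (1 + x) ^ (p - 1 - 1) * (1 + x) := by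
        rw [← Real.rpow_add_one h1.ne', sub_add_cancel]
      have hR : 0 < (1 + x) ^ (p - 1 - 1) := by positivity
      rw [one_mul, e]
      rw [e] at b1
      set R := (1 + x) ^ (p - 1 - 1)
      have b2 := mul_le_mul_of_nonneg_left b1 (show 0 ≤ R * (1 + x) by positivity)
      rw [mul_inv_cancel₀ (by positivity)] at b2
      have e2 : R * (1 + x) * (1 + (p - 1) * -(x / (1 + x))) = R * (1 + x) - (p - 1) * x * R := by
        field_simp
        ring
      rw [e2] at b2
      have b3 := mul_le_mul_of_nonneg_left b2 (show 0 ≤ p / 2 by linarith)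
      linarith)
  have h := hmono (Set.self_mem_Ici (a := (0 : ℝ))) hw hw
  simp only [mul_zero, zero_div, zero_mul, add_zero, Real.one_rpow, one_mul] at h
  linarith

lemma one_add_rpow_le_quadratic {p w : ℝ} (hp : 2 ≤ p) (hw : -1 ≤ w) (hw0 : w ≤ 0) :
    (1 + w) ^ p ≤ 1 + p * w + p * (p - 1) * w ^ 2 / 2 := by
  have hd : ∀ x : ℝ, HasDerivAt (fun w : ℝ => 1 + p * w + p * (p - 1) * w ^ 2 / 2
      - (1 + 1 * w) ^ p) (p + p * (p - 1) * x - p * 1 * (1 + 1 * x) ^ (p - 1)) x := by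
    intro x
    have h1 : HasDerivAt (fun t : ℝ => 1 + p * t) p x := by
      simpa using ((hasDerivAt_id x).const_mul p).const_add 1
    have h2 : HasDerivAt (fun t : ℝ => p * (p - 1) * t ^ 2 / 2) (p * (p - 1) * x) x := by
      have := ((hasDerivAt_pow 2 x).const_mul (p * (p - 1))).div_const 2
      rwa [show p * (p - 1) * (((2 : ℕ) : ℝ) * x ^ (2 - 1)) / 2 = p * (p - 1) * x by
        norm_num
        ring] at this
    exact (h1.add h2).sub (hasDerivAt_affine_rpow (by linarith) 1 x)
  have hanti := antitoneOn_of_deriv_nonpos (convex_Icc (-1) 0)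
    (fun x _ => (hd x).continuousAt.continuousWithinAt)
    (fun x _ => (hd x).differentiableAt.differentiableWithinAt)
    (fun x hx => by
      rw [interior_Icc] at hx
      rw [(hd x).deriv, one_mul]
      have b1 := one_add_mul_self_le_rpow_one_add (s := x) hx.1.le (p := p - 1) (by linarith)
      have := mul_le_mul_of_nonneg_left b1 (show 0 ≤ p by linarith)
      linarith)
  have h := hanti (show w ∈ Set.Icc (-1) 0 from ⟨hw, hw0⟩)
    (show (0 : ℝ) ∈ Set.Icc (-1) 0 by simp) hw0
  norm_num at h
  linarith

lemma burkholder_scalar_normalized {p a u v m : ℝ} (hp : 2 ≤ p) (ha : 0 ≤ a)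
    (hw : -1 ≤ u + v) (hA : 0 ≤ a + u) (hum : |u| ≤ m) (hvm : |v| ≤ m)
    (hm : m ≤ 2 * a + u) :
    (1 + (u + v)) ^ p - p * (a + u) * (1 + (u + v)) ^ (p - 1) ≤
      1 - p * a - p * (p - 1) * (a * u + (u ^ 2 - m ^ 2) / 2)
        + p * ((1 - a) * v + (v ^ 2 - m ^ 2) / 2) - p * (p - 2) * a * v := by
  have hp0 : 0 ≤ p := by linarith
  have hu2 : u ^ 2 ≤ m ^ 2 := by rw [← sq_abs u]; gcongr
  have hv2 : v ^ 2 ≤ m ^ 2 := by rw [← sq_abs v]; gcongr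
  have E1 := one_add_mul_self_le_rpow_one_add hw (p := p - 1) (by linarith)
  have hpp : 0 ≤ p * (p - 2) := mul_nonneg hp0 (by linarith)
  obtain ⟨w, rfl⟩ : ∃ w, v = w - u := ⟨u + v, by ring⟩
  rw [show u + (w - u) = w by ring] at *
  rcases le_total |u| |w - u| with h | h
  · have h2 : u ^ 2 ≤ (w - u) ^ 2 := sq_le_sq.2 h
    have hmm := mul_le_mul_of_nonneg_left hv2 hpp
    rcases le_total 0 w with hw0 | hw0
    · have E3 := one_add_rpow_le_trapezoid hp hw0
      set Q := (1 + w) ^ (p - 1)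
      set P := (1 + w) ^ p
      have h3 : w / 2 ≤ a + u := by
        have := (le_abs_self (w - u)).trans hvm
        linarith
      have k := mul_nonneg (mul_nonneg hp0 (sub_nonneg.2 h3)) (sub_nonneg.2 E1)
      nlinarith
    · have E2 := one_add_rpow_le_quadratic hp hw hw0
      set Q := (1 + w) ^ (p - 1)
      set P := (1 + w) ^ p
      have k := mul_nonneg (mul_nonneg hp0 hA) (sub_nonneg.2 E1)
      nlinarith
  · have h2 : (w - u) ^ 2 ≤ u ^ 2 := sq_le_sq.2 h
    have hmm := mul_le_mul_of_nonneg_left hu2 hpp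
    rcases lt_trichotomy 0 w with hw0 | rfl | hw0
    · have E3 := one_add_rpow_le_trapezoid hp hw0.le
      have h3 : w / 2 ≤ u := by
        by_contra! hcon
        nlinarith
      have E4 : 1 + w ≤ (1 + w) ^ (p - 1) := by nlinarith
      set Q := (1 + w) ^ (p - 1)
      set P := (1 + w) ^ p
      have k1 := mul_nonneg (mul_nonneg hp0 ha) (sub_nonneg.2 E1)
      have k2 := mul_nonneg (mul_nonneg hp0 (sub_nonneg.2 h3)) (sub_nonneg.2 E4)
      nlinarith
    · norm_num
      nlinarith
    · have E2 := one_add_rpow_le_quadratic hp hw hw0.le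
      have h3 : u ≤ w / 2 := by
        by_contra! hcon
        nlinarith
      set Q := (1 + w) ^ (p - 1)
      set P := (1 + w) ^ p
      have k1 := mul_nonneg (mul_nonneg hp0 hA) (sub_nonneg.2 E1)
      have k2 := mul_nonneg (mul_nonneg hpp (neg_nonneg.2 hw0.le)) (sub_nonneg.2 h3)
      nlinarith

lemma burkholder_scalar {p a b A B m : ℝ} (hp : 2 ≤ p) (ha : 0 ≤ a) (hA : 0 ≤ A)
    (hB : 0 ≤ B) (hS : 0 < a + b) (h1 : |A - a| ≤ m) (h2 : |B - b| ≤ m) (h3 : m ≤ A + a) :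
    (B - (p - 1) * A) * (A + B) ^ (p - 1) ≤ (b - (p - 1) * a) * (a + b) ^ (p - 1)
      + (a + b) ^ (p - 2) * (-(p * (p - 1)) * (a * (A - a) + ((A - a) ^ 2 - m ^ 2) / 2)
        + p * (b * (B - b) + ((B - b) ^ 2 - m ^ 2) / 2) - p * (p - 2) * a * (B - b)) := by
  obtain ⟨S, hSdef⟩ : ∃ S, S = a + b := ⟨_, rfl⟩
  rw [← hSdef] at hS ⊢
  have hT : (A - a) / S + (B - b) / S = (A + B) / S - 1 := by
    field_simp
    rw [hSdef]
    ring
  have hT0 : 0 ≤ (A + B) / S := by positivity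
  have key := burkholder_scalar_normalized (p := p) (a := a / S) (u := (A - a) / S)
    (v := (B - b) / S) (m := m / S) hp (by positivity) (by linarith)
    (by rw [← add_div]; exact div_nonneg (by linarith) hS.le)
    (by rw [abs_div, abs_of_pos hS]; gcongr) (by rw [abs_div, abs_of_pos hS]; gcongr)
    (by rw [← mul_div_assoc, ← add_div]; gcongr; linarith)
  rw [hT, add_sub_cancel, show a / S + (A - a) / S = A / S by ring] at key
  have e1 : S ^ (p - 1) = S ^ (p - 2) * S := by
    rw [← Real.rpow_add_one hS.ne']
    congr 1
    ring
  have e2 : S ^ p = S ^ (p - 2) * S ^ 2 := by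
    rw [← Real.rpow_add_natCast hS.ne']
    congr 1
    push_cast
    ring
  have e3 : (A + B) ^ p = (A + B) ^ (p - 1) * (A + B) := by
    rw [← Real.rpow_add_one' (by positivity) (by linarith), sub_add_cancel]
  rw [Real.div_rpow (by positivity) hS.le, Real.div_rpow (by positivity) hS.le, e1, e2, e3] at key
  rw [e1]
  have hσ : 0 < S ^ (p - 2) := by positivity
  have hm := mul_le_mul_of_nonneg_right key (show 0 ≤ S ^ (p - 2) * S ^ 2 by positivity)
  set σ := S ^ (p - 2)
  set X := (A + B) ^ (p - 1)
  have l : (X * (A + B) / (σ * S ^ 2) - p * (A / S) * (X / (σ * S))) * (σ * S ^ 2)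
      = (B - (p - 1) * A) * X := by
    field_simp
    ring
  rw [l] at hm
  refine hm.trans (le_of_eq ?_)
  have hb : b = S - a := by linarith
  rw [hb]
  field_simp
  ring

lemma integrable_norm_rpow_of_memLp {Ω E : Type*} {m0 : MeasurableSpace Ω} {μ : Measure Ω}
    [NormedAddCommGroup E] {p : ℝ} (hp : 0 < p) {u : Ω → E}
    (hu : MemLp u (ENNReal.ofReal p) μ) : Integrable (fun ω => ‖u ω‖ ^ p) μ := by
  have h := (integrable_norm_rpow_iff hu.1 (by simpa using hp) ENNReal.ofReal_ne_top).2 hu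
  rwa [ENNReal.toReal_ofReal hp.le] at h

section Martingale

variable {H : Type*} [NormedAddCommGroup H]

/-- Burkholder's special function, without its multiplicative constant. -/
noncomputable def burkholderU (p : ℝ) (x y : H) : ℝ :=
  (‖y‖ - (p - 1) * ‖x‖) * (‖x‖ + ‖y‖) ^ (p - 1)

lemma burkholderU_nonpos {p : ℝ} (hp : 2 < p) {x y : H} (h : ‖y‖ ≤ ‖x‖) :
    burkholderU p x y ≤ 0 := by
  refine mul_nonpos_of_nonpos_of_nonneg ?_ (by positivity)
  nlinarith [norm_nonneg x]

lemma abs_burkholderU_le {p : ℝ} (hp : 2 < p) (x y : H) :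
    |burkholderU p x y| ≤ (p - 1) * (‖x‖ + ‖y‖) ^ p := by
  have e3 : (‖x‖ + ‖y‖) ^ p = (‖x‖ + ‖y‖) ^ (p - 1) * (‖x‖ + ‖y‖) := by
    rw [← Real.rpow_add_one' (by positivity) (by linarith), sub_add_cancel]
  have h : |‖y‖ - (p - 1) * ‖x‖| ≤ (p - 1) * (‖x‖ + ‖y‖) := by
    have hx := norm_nonneg x
    have hy := norm_nonneg y
    rw [abs_le]
    constructor <;> nlinarith
  rw [burkholderU, abs_mul, abs_of_nonneg (Real.rpow_nonneg (by positivity) _), e3]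
  calc _ ≤ (p - 1) * (‖x‖ + ‖y‖) * (‖x‖ + ‖y‖) ^ (p - 1) := by gcongr
    _ = _ := by ring

/-- Stability form of Burkholder's inequality at a fixed time. -/
lemma mul_integral_abs_sub_rpow_le {Ω : Type*} {m0 : MeasurableSpace Ω} {μ : Measure Ω}
    {p : ℝ} (hp : 2 < p) {f g : Ω → H}
    (hfp : MemLp f (ENNReal.ofReal p) μ) (hgp : MemLp g (ENNReal.ofReal p) μ)
    (hU : ∫ ω, burkholderU p (f ω) (g ω) ∂μ ≤ 0) :
    (p - 2) / (p - 1) * (1 / 2 - Real.exp (-1)) * ∫ ω, |‖g ω‖ - (p - 1) * ‖f ω‖| ^ p ∂μ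
      ≤ (p - 1) ^ p * ∫ ω, ‖f ω‖ ^ p ∂μ - ∫ ω, ‖g ω‖ ^ p ∂μ := by
  have hp0 : 0 < p := by linarith
  have hf := integrable_norm_rpow_of_memLp hp0 hfp
  have hg := integrable_norm_rpow_of_memLp hp0 hgp
  have hW : Integrable (fun ω => |‖g ω‖ - (p - 1) * ‖f ω‖| ^ p) μ :=
    integrable_norm_rpow_of_memLp hp0 (hgp.norm.sub (hfp.norm.const_mul (p - 1)))
  have hUint : Integrable (fun ω => burkholderU p (f ω) (g ω)) μ := by
    have h1 := hfp.1.norm.aemeasurable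
    have h2 := hgp.1.norm.aemeasurable
    have hS : Integrable (fun ω => (‖f ω‖ + ‖g ω‖) ^ p) μ := by
      refine (integrable_norm_rpow_of_memLp hp0 (hfp.norm.add hgp.norm)).congr (ae_of_all _ fun ω => ?_)
      simp only [Pi.add_apply]
      rw [Real.norm_of_nonneg (by positivity)]
    exact (hS.const_mul (p - 1)).mono'
      ((h2.sub (h1.const_mul _)).mul ((h1.add h2).pow_const _)).aestronglyMeasurable
      (ae_of_all _ fun ω => abs_burkholderU_le hp _ _)
  have hα : 0 ≤ p * ((p - 1) / p) ^ (p - 1) :=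
    mul_nonneg hp0.le (Real.rpow_nonneg (div_nonneg (by linarith) hp0.le) _)
  have hUg : Integrable (fun ω => p * ((p - 1) / p) ^ (p - 1) * burkholderU p (f ω) (g ω)
      - ‖g ω‖ ^ p) μ := (hUint.const_mul _).sub hg
  calc _ = ∫ ω, (p - 2) / (p - 1) * (1 / 2 - Real.exp (-1))
        * |‖g ω‖ - (p - 1) * ‖f ω‖| ^ p ∂μ := (integral_const_mul _ _).symm
    _ ≤ ∫ ω, (p * ((p - 1) / p) ^ (p - 1) * burkholderU p (f ω) (g ω) - ‖g ω‖ ^ p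
        + (p - 1) ^ p * ‖f ω‖ ^ p) ∂μ :=
      integral_mono (hW.const_mul _) (hUg.add (hf.const_mul _))
        fun ω => mul_abs_rpow_le_gap hp (norm_nonneg _) (norm_nonneg _)
    _ = p * ((p - 1) / p) ^ (p - 1) * ∫ ω, burkholderU p (f ω) (g ω) ∂μ
        - ∫ ω, ‖g ω‖ ^ p ∂μ + (p - 1) ^ p * ∫ ω, ‖f ω‖ ^ p ∂μ := by
      rw [integral_add hUg (hf.const_mul _),
        integral_sub (hUint.const_mul _) hg, integral_const_mul, integral_const_mul]
    _ ≤ _ := by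
      have := mul_nonpos_of_nonneg_of_nonpos hα hU
      linarith

variable [InnerProductSpace ℝ H]

lemma burkholderU_add_le {p : ℝ} (hp : 2 < p) {x y h k : H} (hkh : ‖k‖ ≤ ‖h‖) :
    burkholderU p (x + h) (y + k) ≤ burkholderU p x y
      - p * (p - 1) * inner ℝ ((‖x‖ + ‖y‖) ^ (p - 2) • x) h
      + p * inner ℝ (((‖x‖ + ‖y‖) ^ (p - 2) * (1 - (p - 2) * (‖x‖ / ‖y‖))) • y) k := by
  rw [real_inner_smul_left, real_inner_smul_left]
  rcases (add_nonneg (norm_nonneg x) (norm_nonneg y)).eq_or_lt' with hS | hS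
  · have hx : ‖x‖ = 0 := by linarith [norm_nonneg x, norm_nonneg y]
    have hy : ‖y‖ = 0 := by linarith [norm_nonneg x, norm_nonneg y]
    rw [norm_eq_zero] at hx hy
    subst hx hy
    have h0 : (0 : ℝ) ^ (p - 2) = 0 := Real.zero_rpow (by linarith)
    have h1 : burkholderU p (0 : H) (0 : H) = 0 := by simp [burkholderU]
    simpa [h0, h1] using burkholderU_nonpos hp hkh
  have hx2 : inner ℝ x h = ‖x‖ * (‖x + h‖ - ‖x‖) + ((‖x + h‖ - ‖x‖) ^ 2 - ‖h‖ ^ 2) / 2 := by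
    have := norm_add_sq_real x h
    linarith
  have hy2 : ‖y‖ * (‖y + k‖ - ‖y‖) + ((‖y + k‖ - ‖y‖) ^ 2 - ‖h‖ ^ 2) / 2 ≤ inner ℝ y k := by
    have := norm_add_sq_real y k
    have : ‖k‖ ^ 2 ≤ ‖h‖ ^ 2 := by gcongr
    linarith
  have hy3 : inner ℝ y k / ‖y‖ ≤ ‖y + k‖ - ‖y‖ := by
    rcases eq_or_ne y 0 with rfl | hy
    · simp
    · have hy0 : 0 < ‖y‖ := norm_pos_iff.2 hy
      rw [div_le_iff₀ hy0]
      have := real_inner_le_norm y (y + k)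
      rw [inner_add_right, real_inner_self_eq_norm_sq] at this
      linarith
  have ht1 : |‖x + h‖ - ‖x‖| ≤ ‖h‖ := by
    simpa using abs_norm_sub_norm_le (x + h) x
  have ht2 : |‖y + k‖ - ‖y‖| ≤ ‖h‖ := by
    refine le_trans ?_ hkh
    simpa using abs_norm_sub_norm_le (y + k) y
  have ht3 : ‖h‖ ≤ ‖x + h‖ + ‖x‖ := by
    simpa using norm_sub_le (x + h) x
  have key := burkholder_scalar (b := ‖y‖) hp.le (norm_nonneg x) (norm_nonneg (x + h))
    (norm_nonneg (y + k)) hS ht1 ht2 ht3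
  rw [← hx2] at key
  refine key.trans ?_
  have hσ : 0 ≤ (‖x‖ + ‖y‖) ^ (p - 2) := by positivity
  have e : (1 - (p - 2) * (‖x‖ / ‖y‖)) * inner ℝ y k
      = inner ℝ y k - (p - 2) * ‖x‖ * (inner ℝ y k / ‖y‖) := by ring
  have l1 : (p - 2) * ‖x‖ * (inner ℝ y k / ‖y‖) ≤ (p - 2) * ‖x‖ * (‖y + k‖ - ‖y‖) :=
    mul_le_mul_of_nonneg_left hy3 (mul_nonneg (by linarith) (norm_nonneg x))
  have l2 : ‖y‖ * (‖y + k‖ - ‖y‖) + ((‖y + k‖ - ‖y‖) ^ 2 - ‖h‖ ^ 2) / 2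
      - (p - 2) * ‖x‖ * (‖y + k‖ - ‖y‖) ≤ (1 - (p - 2) * (‖x‖ / ‖y‖)) * inner ℝ y k := by
    linarith
  have l3 := mul_le_mul_of_nonneg_left l2 (mul_nonneg (show 0 ≤ p by linarith) hσ)
  unfold burkholderU
  linarith

variable {Ω : Type*} {m0 : MeasurableSpace Ω} {μ : Measure Ω} [CompleteSpace H]

lemma integral_inner_martingale_sub_eq_zero [IsFiniteMeasure μ] {ℱ : Filtration ℕ m0}
    {f : ℕ → Ω → H} (hf : Martingale f ℱ μ) (n : ℕ) {φ : Ω → H}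
    (hφ : StronglyMeasurable[ℱ n] φ)
    (hint : Integrable (fun ω => inner ℝ (φ ω) (f (n + 1) ω - f n ω)) μ) :
    ∫ ω, inner ℝ (φ ω) (f (n + 1) ω - f n ω) ∂μ = 0 := by
  have h := condExp_bilin_of_stronglyMeasurable_left (m := ℱ n) (innerSL ℝ (E := H)) hφ
    (g := f (n + 1) - f n) hint ((hf.integrable _).sub (hf.integrable _))
  have h2 : μ[f (n + 1) - f n | ℱ n] =ᵐ[μ] 0 := by
    refine (condExp_sub (hf.integrable _) (hf.integrable _) _).trans ?_
    filter_upwards [hf.condExp_ae_eq n.le_succ, hf.condExp_ae_eq (le_refl n)] with ω h1 h2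
    simp [h1, h2]
  rw [← integral_condExp (ℱ.le n)]
  refine integral_eq_zero_of_ae ?_
  filter_upwards [h, h2] with ω h h2
  refine h.trans ?_
  simp [h2]

lemma integral_burkholderU_succ_le [IsFiniteMeasure μ] {ℱ : Filtration ℕ m0}
    {p : ℝ} (hp : 2 < p) {f g : ℕ → Ω → H} (hf : Martingale f ℱ μ) (hg : Martingale g ℱ μ)
    (hfp : ∀ n, MemLp (f n) (ENNReal.ofReal p) μ) (hgp : ∀ n, MemLp (g n) (ENNReal.ofReal p) μ)
    (n : ℕ) (hsub : ∀ᵐ ω ∂μ, ‖g (n + 1) ω - g n ω‖ ≤ ‖f (n + 1) ω - f n ω‖) :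
    ∫ ω, burkholderU p (f (n + 1) ω) (g (n + 1) ω) ∂μ
      ≤ ∫ ω, burkholderU p (f n ω) (g n ω) ∂μ := by
  have hp0 : 0 < p := by linarith
  let R : Ω → ℝ := fun ω => ‖f n ω‖ + ‖g n ω‖ + ‖f (n + 1) ω‖ + ‖g (n + 1) ω‖
  have hR0 : ∀ ω, 0 ≤ R ω := fun ω => by positivity
  have hR : MemLp R (ENNReal.ofReal p) μ :=
    (((hfp n).norm.add (hgp n).norm).add (hfp (n + 1)).norm).add (hgp (n + 1)).norm
  have hRint : Integrable (fun ω => R ω ^ p) μ := by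
    refine (integrable_norm_rpow_of_memLp hp0 hR).congr (ae_of_all _ fun ω => ?_)
    simp only [Real.norm_of_nonneg (hR0 ω)]
  have hfm : ∀ k, StronglyMeasurable[ℱ k] (f k) := fun k => hf.stronglyAdapted k
  have hgm : ∀ k, StronglyMeasurable[ℱ k] (g k) := fun k => hg.stronglyAdapted k
  have hpow : ∀ (r : ℝ), StronglyMeasurable[ℱ n] (fun ω => (‖f n ω‖ + ‖g n ω‖) ^ r) := fun r =>
    (((hfm n).norm.measurable.add (hgm n).norm.measurable).pow_const r).stronglyMeasurable
  have hφm : StronglyMeasurable[ℱ n] (fun ω => (‖f n ω‖ + ‖g n ω‖) ^ (p - 2) • f n ω) :=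
    (hpow _).smul (hfm n)
  have hψm : StronglyMeasurable[ℱ n] (fun ω => ((‖f n ω‖ + ‖g n ω‖) ^ (p - 2)
      * (1 - (p - 2) * (‖f n ω‖ / ‖g n ω‖))) • g n ω) := by
    refine StronglyMeasurable.smul ((hpow _).mul ?_) (hgm n)
    exact (((hfm n).norm.measurable.div (hgm n).norm.measurable).const_mul
      _).const_sub _ |>.stronglyMeasurable
  have hUm : ∀ k, AEStronglyMeasurable (fun ω => burkholderU p (f k ω) (g k ω)) μ := by
    intro k
    have h1 := ((hfp k).1.norm.aemeasurable)
    have h2 := ((hgp k).1.norm.aemeasurable)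
    exact ((h2.sub (h1.const_mul _)).mul ((h1.add h2).pow_const _)).aestronglyMeasurable
  have hU : ∀ k, (∀ ω, ‖f k ω‖ + ‖g k ω‖ ≤ R ω) →
      Integrable (fun ω => burkholderU p (f k ω) (g k ω)) μ := by
    intro k hk
    refine (hRint.const_mul (p - 1)).mono' (hUm k) (ae_of_all _ fun ω => ?_)
    refine (abs_burkholderU_le hp _ _).trans ?_
    have := hk ω
    gcongr
    linarith
  have hUn := hU n fun ω => by
    have := norm_nonneg (f (n + 1) ω)
    have := norm_nonneg (g (n + 1) ω)
    simp only [R]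
    linarith
  have hUn1 := hU (n + 1) fun ω => by
    have := norm_nonneg (f n ω)
    have := norm_nonneg (g n ω)
    simp only [R]
    linarith
  have hRp : ∀ ω, R ω ^ (p - 2) * R ω * R ω = R ω ^ p := by
    intro ω
    rw [← Real.rpow_add_one' (hR0 ω) (by linarith), ← Real.rpow_add_one' (hR0 ω) (by linarith)]
    congr 1
    ring
  have hSR : ∀ ω, (‖f n ω‖ + ‖g n ω‖) ^ (p - 2) ≤ R ω ^ (p - 2) := by
    intro ω
    have := norm_nonneg (f (n + 1) ω)
    have := norm_nonneg (g (n + 1) ω)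
    refine Real.rpow_le_rpow (by positivity) ?_ (by linarith)
    simp only [R]
    linarith
  have hφ : Integrable (fun ω => inner ℝ ((‖f n ω‖ + ‖g n ω‖) ^ (p - 2) • f n ω)
      (f (n + 1) ω - f n ω)) μ := by
    refine hRint.mono' (AEStronglyMeasurable.inner
      (hφm.mono (ℱ.le n)).aestronglyMeasurable ((hfp _).1.sub (hfp _).1))
      (ae_of_all _ fun ω => ?_)
    refine (norm_inner_le_norm _ _).trans ?_
    rw [norm_smul, Real.norm_of_nonneg (by positivity), ← hRp ω]
    have h1 := hR0 ω
    have h2 : ‖f n ω‖ ≤ R ω := by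
      simp only [R]
      linarith [norm_nonneg (g n ω), norm_nonneg (f (n + 1) ω), norm_nonneg (g (n + 1) ω)]
    have h3 : ‖f (n + 1) ω - f n ω‖ ≤ R ω := (norm_sub_le _ _).trans (by
      simp only [R]; linarith [norm_nonneg (g n ω), norm_nonneg (g (n + 1) ω)])
    have h4 := hSR ω
    gcongr
  have hψ : Integrable (fun ω => inner ℝ (((‖f n ω‖ + ‖g n ω‖) ^ (p - 2)
      * (1 - (p - 2) * (‖f n ω‖ / ‖g n ω‖))) • g n ω) (g (n + 1) ω - g n ω)) μ := by
    refine (hRint.const_mul (p - 1)).mono' (AEStronglyMeasurable.inner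
      (hψm.mono (ℱ.le n)).aestronglyMeasurable ((hgp _).1.sub (hgp _).1))
      (ae_of_all _ fun ω => ?_)
    refine (norm_inner_le_norm _ _).trans ?_
    rw [norm_smul, norm_mul, Real.norm_of_nonneg (by positivity), ← hRp ω]
    have h1 := hR0 ω
    have h2 : ‖1 - (p - 2) * (‖f n ω‖ / ‖g n ω‖)‖ * ‖g n ω‖ ≤ (p - 1) * R ω := by
      have h5 : ‖f n ω‖ / ‖g n ω‖ * ‖g n ω‖ ≤ ‖f n ω‖ := by
        rcases eq_or_ne ‖g n ω‖ 0 with h | h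
        · simp [h]
        · rw [div_mul_cancel₀ _ h]
      have h6 : 0 ≤ ‖f n ω‖ / ‖g n ω‖ * ‖g n ω‖ := by positivity
      have h7 : ‖f n ω‖ + ‖g n ω‖ ≤ R ω := by
        simp only [R]
        linarith [norm_nonneg (f (n + 1) ω), norm_nonneg (g (n + 1) ω)]
      have h8 := norm_nonneg (f n ω)
      have h9 := norm_nonneg (g n ω)
      have h10 : ‖1 - (p - 2) * (‖f n ω‖ / ‖g n ω‖)‖ * ‖g n ω‖
          = |‖g n ω‖ - (p - 2) * (‖f n ω‖ / ‖g n ω‖ * ‖g n ω‖)| := by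
        rw [Real.norm_eq_abs, ← abs_of_nonneg h9, ← abs_mul, abs_of_nonneg h9]
        congr 1
        ring
      rw [h10, abs_le]
      constructor <;> nlinarith
    have h3 : ‖g (n + 1) ω - g n ω‖ ≤ R ω := (norm_sub_le _ _).trans (by
      simp only [R]; linarith [norm_nonneg (f n ω), norm_nonneg (f (n + 1) ω)])
    have h4 := hSR ω
    calc _ = (‖f n ω‖ + ‖g n ω‖) ^ (p - 2) * (‖1 - (p - 2) * (‖f n ω‖ / ‖g n ω‖)‖ * ‖g n ω‖)
          * ‖g (n + 1) ω - g n ω‖ := by ring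
      _ ≤ R ω ^ (p - 2) * ((p - 1) * R ω) * R ω := by
          have : 0 ≤ (p - 1) * R ω := mul_nonneg (by linarith) h1
          gcongr
      _ = _ := by ring
  have hUφ : Integrable (fun ω => burkholderU p (f n ω) (g n ω) - p * (p - 1)
      * inner ℝ ((‖f n ω‖ + ‖g n ω‖) ^ (p - 2) • f n ω) (f (n + 1) ω - f n ω)) μ :=
    hUn.sub (hφ.const_mul _)
  calc _ ≤ ∫ ω, (burkholderU p (f n ω) (g n ω)
        - p * (p - 1) * inner ℝ ((‖f n ω‖ + ‖g n ω‖) ^ (p - 2) • f n ω) (f (n + 1) ω - f n ω)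
        + p * inner ℝ (((‖f n ω‖ + ‖g n ω‖) ^ (p - 2)
          * (1 - (p - 2) * (‖f n ω‖ / ‖g n ω‖))) • g n ω) (g (n + 1) ω - g n ω)) ∂μ := by
        refine integral_mono_ae hUn1 (hUφ.add (hψ.const_mul _)) ?_
        filter_upwards [hsub] with ω hω
        have := burkholderU_add_le hp (x := f n ω) (y := g n ω) hω
        rwa [add_sub_cancel, add_sub_cancel] at this
    _ = _ := by
        rw [integral_add hUφ (hψ.const_mul _),
          integral_sub hUn (hφ.const_mul _), integral_const_mul, integral_const_mul,
          integral_inner_martingale_sub_eq_zero hf n hφm hφ,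
          integral_inner_martingale_sub_eq_zero hg n hψm hψ]
        ring

lemma integral_burkholderU_nonpos [IsFiniteMeasure μ] {ℱ : Filtration ℕ m0}
    {p : ℝ} (hp : 2 < p) {f g : ℕ → Ω → H} (hf : Martingale f ℱ μ) (hg : Martingale g ℱ μ)
    (hfp : ∀ n, MemLp (f n) (ENNReal.ofReal p) μ) (hgp : ∀ n, MemLp (g n) (ENNReal.ofReal p) μ)
    (hsub0 : ∀ᵐ ω ∂μ, ‖g 0 ω‖ ≤ ‖f 0 ω‖)
    (hsub : ∀ n, ∀ᵐ ω ∂μ, ‖g (n + 1) ω - g n ω‖ ≤ ‖f (n + 1) ω - f n ω‖) (n : ℕ) :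
    ∫ ω, burkholderU p (f n ω) (g n ω) ∂μ ≤ 0 := by
  induction n with
  | zero =>
    refine integral_nonpos_of_ae ?_
    filter_upwards [hsub0] with ω hω using burkholderU_nonpos hp hω
  | succ n ih => exact (integral_burkholderU_succ_le hp hf hg hfp hgp n (hsub n)).trans ih

lemma eLpNorm_martingale_mono [IsFiniteMeasure μ] {ℱ : Filtration ℕ m0} {p : ENNReal}
    (hp : 1 ≤ p) {f : ℕ → Ω → H} (hf : Martingale f ℱ μ) :
    Monotone fun n => eLpNorm (f n) p μ := by
  intro i j hij
  refine le_trans (le_of_eq ?_) (eLpNorm_condExp_le_eLpNorm (m := ℱ i) (f j) hp)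
  exact eLpNorm_congr_ae (hf.condExp_ae_eq hij).symm

end Martingale

lemma integral_norm_rpow_eq_toReal_eLpNorm_rpow {Ω E : Type*} {m0 : MeasurableSpace Ω}
    {μ : Measure Ω} [NormedAddCommGroup E] {p : ℝ} (hp : 0 < p) {u : Ω → E}
    (hu : MemLp u (ENNReal.ofReal p) μ) :
    ∫ ω, ‖u ω‖ ^ p ∂μ = (eLpNorm u (ENNReal.ofReal p) μ).toReal ^ p := by
  have h0 : 0 ≤ ∫ ω, ‖u ω‖ ^ p ∂μ := integral_nonneg fun ω => by positivity
  rw [hu.eLpNorm_eq_integral_rpow_norm (by simpa using hp) ENNReal.ofReal_ne_top,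
    ENNReal.toReal_ofReal hp.le, ENNReal.toReal_ofReal (by positivity),
    ← Real.rpow_mul h0, inv_mul_cancel₀ hp.ne', Real.rpow_one]

/-- The deficit in Burkholder's inequality is at most linear in `ε`. -/
lemma rpow_sub_rpow_le_mul {p ε a b : ℝ} (hp : 2 < p) (hε : 0 ≤ ε) (ha : 0 ≤ a) (hb : 0 ≤ b)
    (h : (p - 1 - ε) * a ≤ b) :
    (p - 1) ^ p * a ^ p - b ^ p ≤ p * (p - 1) ^ (p - 1) * ε * a ^ p := by
  have hq : 0 < p - 1 := by linarith
  have ep : (p - 1) ^ p = (p - 1) ^ (p - 1) * (p - 1) := by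
    rw [← Real.rpow_add_one hq.ne', sub_add_cancel]
  have hX : 0 < (p - 1) ^ (p - 1) := by positivity
  have hap : 0 ≤ a ^ p := by positivity
  rcases le_total ε (p - 1) with hεp | hεp
  · have h1 : (p - 1 - ε) ^ p * a ^ p ≤ b ^ p := by
      rw [← Real.mul_rpow (by linarith) ha]
      exact Real.rpow_le_rpow (mul_nonneg (by linarith) ha) h (by linarith)
    have h2 := one_add_mul_self_le_rpow_one_add (s := -(ε / (p - 1)))
      (by rw [neg_le_neg_iff, div_le_one hq]; exact hεp) (p := p) (by linarith)
    have h3 : (p - 1) ^ p * (1 + -(ε / (p - 1))) ^ p = (p - 1 - ε) ^ p := by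
      rw [← Real.mul_rpow hq.le (by
        rw [← sub_eq_add_neg, sub_nonneg, div_le_one hq]; exact hεp)]
      congr 1
      field_simp
      ring
    have h4 := mul_le_mul_of_nonneg_left h2 (show 0 ≤ (p - 1) ^ p by positivity)
    rw [h3, ep] at h4
    have h5 : (p - 1) ^ (p - 1) * (p - 1) * (1 + p * -(ε / (p - 1)))
        = (p - 1) ^ (p - 1) * (p - 1) - p * (p - 1) ^ (p - 1) * ε := by
      field_simp
      ring
    rw [h5] at h4
    have h6 := mul_le_mul_of_nonneg_right h4 hap
    rw [ep]
    linarith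
  · have h1 : (p - 1) ^ p ≤ p * (p - 1) ^ (p - 1) * ε := by
      have h2 : p - 1 ≤ p * ε := by nlinarith
      have h3 := mul_le_mul_of_nonneg_left h2 hX.le
      linarith
    have h2 := mul_le_mul_of_nonneg_right h1 hap
    have h3 : 0 ≤ b ^ p := by positivity
    linarith

theorem stmt_5 {Ω : Type*} {m0 : MeasurableSpace Ω} {μ : Measure Ω} [IsProbabilityMeasure μ]
    {H : Type*} [NormedAddCommGroup H] [InnerProductSpace ℝ H]
    [SecondCountableTopology H] [CompleteSpace H]
    (ℱ : Filtration ℕ m0)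
    (p ε : ℝ) (hp : 2 < p) (hε : 0 < ε)
    (c : ℝ)
    (hc : c = (p - 1) * (2 * p * Real.exp 1 /
        ((p - 2) * (Real.exp 1 - 2))) ^ (1 / p))
    (f g : ℕ → Ω → H) (hf : Martingale f ℱ μ) (hg : Martingale g ℱ μ)
    (hsub0 : ∀ᵐ ω ∂μ, ‖g 0 ω‖ ≤ ‖f 0 ω‖)
    (hsub : ∀ n : ℕ, ∀ᵐ ω ∂μ, ‖g (n + 1) ω - g n ω‖ ≤ ‖f (n + 1) ω - f n ω‖)
    (hfb : (⨆ n, eLpNorm (f n) (ENNReal.ofReal p) μ) < ⊤)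
    (hgb : (⨆ n, eLpNorm (g n) (ENNReal.ofReal p) μ) < ⊤)
    (F G : Ω → H)
    (hF : ∀ᵐ ω ∂μ, Tendsto (fun n => f n ω) atTop (nhds (F ω)))
    (hG : ∀ᵐ ω ∂μ, Tendsto (fun n => g n ω) atTop (nhds (G ω)))
    (hlow : ENNReal.ofReal (p - 1 - ε) * (⨆ n, eLpNorm (f n) (ENNReal.ofReal p) μ) ≤
        ⨆ n, eLpNorm (g n) (ENNReal.ofReal p) μ) :
    eLpNorm (fun ω => ‖G ω‖ - (p - 1) * ‖F ω‖) (ENNReal.ofReal p) μ ≤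
      ENNReal.ofReal (c * ε ^ (1 / p)) *
        ⨆ n, eLpNorm (f n) (ENNReal.ofReal p) μ := by
  have hp0 : 0 < p := by linarith
  have hq : 0 < p - 1 := by linarith
  have hp1 : 1 ≤ ENNReal.ofReal p := by
    rw [← ENNReal.ofReal_one]
    exact ENNReal.ofReal_le_ofReal (by linarith)
  set P := ENNReal.ofReal p with hP
  have hfp : ∀ n, MemLp (f n) P μ := fun n =>
    ⟨(hf.integrable n).1, (le_iSup (fun n => eLpNorm (f n) P μ) n).trans_lt hfb⟩
  have hgp : ∀ n, MemLp (g n) P μ := fun n =>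
    ⟨(hg.integrable n).1, (le_iSup (fun n => eLpNorm (g n) P μ) n).trans_lt hgb⟩
  set Mf := ⨆ n, eLpNorm (f n) P μ with hMf
  set Mg := ⨆ n, eLpNorm (g n) P μ with hMg
  have hK : 0 < (p - 2) / (p - 1) * (1 / 2 - Real.exp (-1)) :=
    mul_pos (div_pos (by linarith) hq) half_sub_exp_neg_one_pos
  set K := (p - 2) / (p - 1) * (1 / 2 - Real.exp (-1)) with hKdef
  have hstep : ∀ n, K * ∫ ω, |‖g n ω‖ - (p - 1) * ‖f n ω‖| ^ p ∂μ ≤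
      (p - 1) ^ p * Mf.toReal ^ p - (eLpNorm (g n) P μ).toReal ^ p := by
    intro n
    refine (mul_integral_abs_sub_rpow_le hp (hfp n) (hgp n)
      (integral_burkholderU_nonpos hp hf hg hfp hgp hsub0 hsub n)).trans ?_
    rw [integral_norm_rpow_eq_toReal_eLpNorm_rpow hp0 (hfp n),
      integral_norm_rpow_eq_toReal_eLpNorm_rpow hp0 (hgp n)]
    gcongr
    · exact hfb.ne
    · exact le_iSup (fun n => eLpNorm (f n) P μ) n
  have hWp : ∀ n, MemLp (fun ω => ‖g n ω‖ - (p - 1) * ‖f n ω‖) P μ := fun n =>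
    (hgp n).norm.sub ((hfp n).norm.const_mul (p - 1))
  have hnorm : ∀ n, eLpNorm (fun ω => ‖g n ω‖ - (p - 1) * ‖f n ω‖) P μ ≤ ENNReal.ofReal
      ((((p - 1) ^ p * Mf.toReal ^ p - (eLpNorm (g n) P μ).toReal ^ p) / K) ^ (1 / p)) := by
    intro n
    rw [(hWp n).eLpNorm_eq_integral_rpow_norm (by simpa [hP] using hp0) ENNReal.ofReal_ne_top,
      ENNReal.toReal_ofReal hp0.le, ← one_div]
    refine ENNReal.ofReal_le_ofReal (Real.rpow_le_rpow
      (integral_nonneg fun ω => by positivity) ?_ (by positivity))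
    rw [le_div_iff₀ hK, mul_comm]
    exact hstep n
  have hlim : Tendsto (fun n => (eLpNorm (g n) P μ).toReal) atTop (nhds Mg.toReal) :=
    (ENNReal.tendsto_toReal hgb.ne).comp (tendsto_atTop_iSup (eLpNorm_martingale_mono hp1 hg))
  have hlimD : Tendsto (fun n => ((p - 1) ^ p * Mf.toReal ^ p
      - (eLpNorm (g n) P μ).toReal ^ p) / K) atTop
      (nhds (((p - 1) ^ p * Mf.toReal ^ p - Mg.toReal ^ p) / K)) :=
    ((hlim.rpow_const (Or.inr hp0.le)).const_sub _).div_const K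
  have hD0 : 0 ≤ ((p - 1) ^ p * Mf.toReal ^ p - Mg.toReal ^ p) / K := by
    refine ge_of_tendsto' hlimD fun n => div_nonneg ?_ hK.le
    exact (mul_nonneg hK.le (integral_nonneg fun ω => by positivity)).trans (hstep n)
  have hfatou : eLpNorm (fun ω => ‖G ω‖ - (p - 1) * ‖F ω‖) P μ ≤ ENNReal.ofReal
      ((((p - 1) ^ p * Mf.toReal ^ p - Mg.toReal ^ p) / K) ^ (1 / p)) := by
    refine (Lp.eLpNorm_lim_le_liminf_eLpNorm (fun n => (hWp n).1) _ ?_).trans ?_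
    · filter_upwards [hF, hG] with ω h1 h2
      exact h2.norm.sub (h1.norm.const_mul _)
    · refine (liminf_le_liminf (Eventually.of_forall hnorm)).trans (le_of_eq ?_)
      exact Tendsto.liminf_eq ((ENNReal.continuous_ofReal.tendsto _).comp
        (hlimD.rpow_const (Or.inr (by positivity))))
  refine hfatou.trans ?_
  have hlow' : (p - 1 - ε) * Mf.toReal ≤ Mg.toReal := by
    refine (mul_le_mul_of_nonneg_right (Real.le_coe_toNNReal _) ENNReal.toReal_nonneg).trans ?_
    have := ENNReal.toReal_mono hgb.ne hlow
    rwa [ENNReal.toReal_mul] at this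
  have hdef := rpow_sub_rpow_le_mul hp hε.le ENNReal.toReal_nonneg ENNReal.toReal_nonneg hlow'
  have hexp : 0 < Real.exp 1 - 2 := by linarith [Real.exp_one_gt_d9]
  have hB : 0 ≤ 2 * p * Real.exp 1 / ((p - 2) * (Real.exp 1 - 2)) :=
    div_nonneg (by positivity) (mul_nonneg (by linarith) hexp.le)
  have hc0 : 0 ≤ c * ε ^ (1 / p) := by
    rw [hc]
    exact mul_nonneg (mul_nonneg hq.le (Real.rpow_nonneg hB _)) (by positivity)
  conv_rhs => rw [← ENNReal.ofReal_toReal hfb.ne, ← ENNReal.ofReal_mul hc0]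
  refine ENNReal.ofReal_le_ofReal ?_
  have hcp : c * ε ^ (1 / p) * Mf.toReal = ((p - 1) ^ p * (2 * p * Real.exp 1 /
      ((p - 2) * (Real.exp 1 - 2))) * ε * Mf.toReal ^ p) ^ (1 / p) := by
    have hinv : ∀ x : ℝ, 0 ≤ x → (x ^ p) ^ (1 / p) = x := fun x hx => by
      rw [← Real.rpow_mul hx, mul_one_div_cancel hp0.ne', Real.rpow_one]
    have h0 : 0 ≤ (p - 1) ^ p := by positivity
    rw [Real.mul_rpow (by positivity) (by positivity), Real.mul_rpow (by positivity) hε.le,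
      Real.mul_rpow h0 hB, hinv _ hq.le, hinv _ ENNReal.toReal_nonneg, hc]
  rw [hcp]
  refine Real.rpow_le_rpow hD0 ?_ (by positivity)
  rw [div_le_iff₀ hK]
  refine hdef.trans (le_of_eq ?_)
  have ep : (p - 1) ^ p = (p - 1) ^ (p - 1) * (p - 1) := by
    rw [← Real.rpow_add_one hq.ne', sub_add_cancel]
  have hp2 : p - 2 ≠ 0 := by linarith
  have he : Real.exp 1 - 2 ≠ 0 := hexp.ne'
  rw [ep, hKdef, Real.exp_neg]
  field_simp
end

section
/- Let 1 < p < 2, set β_p = sin^{p−1}(π/(2p))/cos(π/(2p)) and κ_p = −((p−1)/8)·tan^{p−2}(π/(2p))·cos(π/p), and define V_p : ℝ × ℝ → ℝ by V_p(x,y) = −β_p · Re(((|x| : ℂ) + i y)^p) with the principal complex power. Then for all (x,y) ∈ ℝ² with (x,y) ≠ (0,0), V_p(x,y) ≥ |y|^p − tan^p(π/(2p))·|x|^p + κ_p·(|y| − tan(π/(2p))·|x|)²·(|x|+|y|)^{p−2}. -/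
open Real

theorem sin_le_four_mul_div_pi_mul_cos {z : ℝ} (h0 : 0 ≤ z) (h1 : z ≤ π / 4) :
    sin z ≤ 4 * z / π * cos z := by
  have hπ := pi_gt_three
  have hconc : ConcaveOn ℝ (Set.Icc 0 (π / 4)) (fun x => 4 * x / π * cos x - sin x) := by
    refine concaveOn_of_hasDerivWithinAt2_nonpos (convex_Icc _ _) (by fun_prop)
      (f' := fun x => 4 / π * cos x - 4 * x / π * sin x - cos x)
      (f'' := fun x => -(8 / π) * sin x - 4 * x / π * cos x + sin x) ?_ ?_ ?_
    · intro x hx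
      refine HasDerivAt.hasDerivWithinAt ?_
      refine ((((hasDerivAt_id x).const_mul 4).div_const π).mul (hasDerivAt_cos x)).sub
        (hasDerivAt_sin x) |>.congr_deriv ?_
      simp; ring
    · intro x hx
      refine HasDerivAt.hasDerivWithinAt ?_
      refine (((hasDerivAt_cos x).const_mul (4 / π)).sub
        ((((hasDerivAt_id x).const_mul 4).div_const π).mul (hasDerivAt_sin x))).sub
        (hasDerivAt_cos x) |>.congr_deriv ?_
      simp; ring
    · intro x hx
      rw [interior_Icc] at hx
      have hs : 0 ≤ sin x := sin_nonneg_of_nonneg_of_le_pi hx.1.le (by linarith [hx.2])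
      have hc : 0 ≤ cos x := cos_nonneg_of_neg_pi_div_two_le_of_le (by linarith [hx.1])
        (by linarith [hx.2])
      have h8 : 1 ≤ 8 / π := by rw [le_div_iff₀ pi_pos]; linarith [pi_lt_four]
      have hx4 : 0 ≤ 4 * x / π * cos x :=
        mul_nonneg (div_nonneg (by linarith [hx.1]) pi_pos.le) hc
      nlinarith
  have hmin := hconc.min_le_of_mem_Icc (x := 0) (y := π / 4) (z := z)
    ⟨le_rfl, by positivity⟩ ⟨by positivity, le_rfl⟩ ⟨h0, h1⟩
  have hend : 4 * (π / 4) / π = 1 := by field_simp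
  simp only [hend, cos_pi_div_four, sin_pi_div_four] at hmin
  simp at hmin
  linarith

theorem trig_poly_ineq {s c : ℝ} (hs : 0 < s) (hc : 0 < c) (hcs : c < s) (h : s ^ 2 + c ^ 2 = 1) :
    (1 + s) * ((s + c) * (2 * s - c) ^ 2) ≤ 8 * s * (1 + s - 2 * c) := by
  obtain ⟨τ, hτ⟩ : ∃ τ, τ = c / (1 + s) := ⟨_, rfl⟩
  have hτ0 : 0 < τ := by rw [hτ]; positivity
  have h1 : c = τ * (1 + s) := by rw [hτ]; field_simp
  have hd : 0 < 1 + τ ^ 2 := by positivity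
  have hs' : s = (1 - τ ^ 2) / (1 + τ ^ 2) := by
    rw [eq_div_iff hd.ne']
    have : (1 + s) * (s * (1 + τ ^ 2) - (1 - τ ^ 2)) = 0 := by
      rw [h1] at h; linear_combination h
    rcases mul_eq_zero.1 this with h | h <;> linarith
  have hc' : c = 2 * τ / (1 + τ ^ 2) := by
    rw [h1, hs']; field_simp; ring
  have hτ1 : 2 * τ < 1 - τ ^ 2 := by
    rw [hs', hc', div_lt_div_iff_of_pos_right hd] at hcs; exact hcs
  have hτ2 : τ < 5 / 12 := by nlinarith
  have key : (1 - τ ^ 2 + 2 * τ) * (2 * (1 - τ ^ 2) - 2 * τ) ^ 2 ≤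
      8 * (1 - τ ^ 2) * (1 - 2 * τ) * (1 + τ ^ 2) ^ 2 := by
    nlinarith [mul_pos hτ0 hτ0, pow_pos hτ0 3, pow_pos hτ0 4, pow_pos hτ0 5]
  have e1 : (1 + s) * ((s + c) * (2 * s - c) ^ 2) = 2 / (1 + τ ^ 2) ^ 4 *
      ((1 - τ ^ 2 + 2 * τ) * (2 * (1 - τ ^ 2) - 2 * τ) ^ 2) := by
    rw [hs', hc']; field_simp; ring
  have e2 : 8 * s * (1 + s - 2 * c) = 2 / (1 + τ ^ 2) ^ 4 *
      (8 * (1 - τ ^ 2) * (1 - 2 * τ) * (1 + τ ^ 2) ^ 2) := by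
    rw [hs', hc']; field_simp; ring
  rw [e1, e2]
  gcongr

theorem one_sub_le_of_sin_cos {s c r : ℝ} (hs : 0 < s) (hc : 0 < c) (hcs : c < s)
    (h : s ^ 2 + c ^ 2 = 1) (hr : c ≤ r * (2 * s - c)) :
    1 - r * (1 - c) ≤ s * (1 - r * (s ^ 2 - c ^ 2) / (2 * (1 + r) ^ 2)) := by
  have hd : 0 < 2 * s - c := by linarith
  have hr0 : 0 < r := by
    by_contra! h0
    nlinarith
  have hinv : 1 / (1 + r) ^ 2 ≤ (2 * s - c) ^ 2 / (4 * s ^ 2) := by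
    rw [div_le_div_iff₀ (by positivity) (by positivity)]
    nlinarith
  have hC : 0 < s ^ 2 - c ^ 2 := by nlinarith
  set B := 1 - c - (s ^ 2 - c ^ 2) * (2 * s - c) ^ 2 / (8 * s) with hB
  have hp := trig_poly_ineq hs hc hcs h
  have hcB : (1 - s) * (2 * s - c) ≤ c * B := by
    have e : c * B - (1 - s) * (2 * s - c) = (s - c) * c / (8 * s * (1 + s)) *
        (8 * s * (1 + s - 2 * c) - (1 + s) * ((s + c) * (2 * s - c) ^ 2)) := by
      have h2 : (2 * s + c - 2) = c * (1 + s - 2 * c) / (1 + s) := by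
        field_simp; linear_combination 2 * h
      have h3 : c * B - (1 - s) * (2 * s - c) = (s - c) * (2 * s + c - 2) -
         c * ((s ^ 2 - c ^ 2) * (2 * s - c) ^ 2 / (8 * s)) := by rw [hB]; ring
      rw [h3, h2]; field_simp; ring
    have : 0 ≤ c * B - (1 - s) * (2 * s - c) := by
      rw [e]
      exact mul_nonneg (div_nonneg (mul_nonneg (by linarith) hc.le) (by positivity)) (by linarith)
    linarith
  have hs1 : s < 1 := by nlinarith
  have hB0 : 0 ≤ B := by
    by_contra! h0
    nlinarith [mul_pos (sub_pos.2 hs1) hd]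
  have hrB : 1 - s ≤ r * B := by
    refine le_of_mul_le_mul_right ?_ hd
    nlinarith
  have hlast : r * (s * ((s ^ 2 - c ^ 2) * (1 / (1 + r) ^ 2)) / 2) ≤
      r * (s * ((s ^ 2 - c ^ 2) * ((2 * s - c) ^ 2 / (4 * s ^ 2))) / 2) := by gcongr
  have e3 : r * (s * ((s ^ 2 - c ^ 2) * ((2 * s - c) ^ 2 / (4 * s ^ 2))) / 2) =
      r * (1 - c - B) := by rw [hB]; field_simp; ring
  have e4 : s * (1 - r * (s ^ 2 - c ^ 2) / (2 * (1 + r) ^ 2)) =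
     s - r * (s * ((s ^ 2 - c ^ 2) * (1 / (1 + r) ^ 2)) / 2) := by field_simp
  rw [e4]
  linarith

theorem cos_rpow_le {p : ℝ} (hp1 : 1 < p) (hp2 : p < 2) :
    cos (π / (2 * p)) ^ (p - 1) ≤ sin (π / (2 * p)) *
      (1 - (p - 1) * (sin (π / (2 * p)) ^ 2 - cos (π / (2 * p)) ^ 2) / (2 * p ^ 2)) := by
  have hp0 : 0 < p := by linarith
  obtain ⟨z, hz⟩ : ∃ z, z = π / 2 - π / (2 * p) := ⟨_, rfl⟩
  have hzr : z = π / 2 * ((p - 1) / p) := by rw [hz]; field_simp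
  have hz0 : 0 < z := by rw [hzr]; exact mul_pos (by positivity) (div_pos (by linarith) hp0)
  have hz1 : z < π / 4 := by
    have : (p - 1) / p < 1 / 2 := by rw [div_lt_div_iff₀ hp0 (by norm_num)]; linarith
    rw [hzr]; nlinarith [pi_pos]
  have hα : π / (2 * p) = π / 2 - z := by rw [hz]; ring
  rw [hα, cos_pi_div_two_sub, sin_pi_div_two_sub]
  have hc : 0 < sin z := sin_pos_of_pos_of_lt_pi hz0 (by linarith [pi_pos])
  have hs : 0 < cos z := cos_pos_of_mem_Ioo ⟨by linarith, by linarith [pi_pos]⟩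
  have hcs : sin z < cos z := by
    rw [← sin_pi_div_two_sub]
    exact sin_lt_sin_of_lt_of_le_pi_div_two (by linarith) (by linarith) (by linarith)
  have htan := sin_le_four_mul_div_pi_mul_cos hz0.le hz1.le
  have hr : sin z ≤ (p - 1) * (2 * cos z - sin z) := by
    have e : 4 * z / π * cos z = 2 * (p - 1) * cos z / p := by rw [hzr]; field_simp; ring
    rw [e, le_div_iff₀ hp0] at htan
    linarith
  have hb := rpow_one_add_le_one_add_mul_self (s := sin z - 1) (by linarith)
    (show 0 ≤ p - 1 by linarith) (by linarith)
  have := one_sub_le_of_sin_cos hs hc hcs (by rw [add_comm]; exact sin_sq_add_cos_sq z) hr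
  rw [show 1 + (p - 1) = p by ring] at this
  rw [show 1 + (sin z - 1) = sin z by ring] at hb
  linarith

theorem hasDerivAt_re_ofReal_add_I_cpow (r x : ℝ) :
    HasDerivAt (fun x : ℝ => (((x : ℂ) + Complex.I) ^ (r : ℂ)).re)
      (r * (((x : ℂ) + Complex.I) ^ ((r - 1 : ℝ) : ℂ)).re) x := by
  have h : HasDerivAt (fun z : ℂ => (z + Complex.I) ^ (r : ℂ))
      ((r : ℂ) * ((x : ℂ) + Complex.I) ^ ((r : ℂ) - 1) * 1) (x : ℂ) :=
    ((hasDerivAt_id (x : ℂ)).add_const Complex.I).cpow_const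
      (Complex.mem_slitPlane_iff.2 (Or.inr (by simp)))
  refine h.real_of_complex.congr_deriv ?_
  rw [mul_one, Complex.re_ofReal_mul]
  push_cast
  rfl

theorem re_ofReal_add_I_cpow_le {x r : ℝ} (hx : 0 < x) (hr0 : 0 ≤ r) (hr : r ≤ 2) :
    (((x : ℂ) + Complex.I) ^ ((-r : ℝ) : ℂ)).re ≤
      x ^ (-r) * (1 - r / 2 * (1 / (1 + x)) ^ 2) := by
  have hn : ‖(x : ℂ) + Complex.I‖ = √(x ^ 2 + 1) := by
    have := Complex.norm_add_mul_I x 1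
    simpa using this
  have h1 : (((x : ℂ) + Complex.I) ^ ((-r : ℝ) : ℂ)).re ≤ (x ^ 2 + 1) ^ (-r / 2) := by
    refine (Complex.re_le_norm _).trans_eq ?_
    rw [Complex.norm_cpow_real, hn, sqrt_eq_rpow, ← rpow_mul (by positivity)]
    congr 1; ring
  have h2 : (x ^ 2 + 1) ^ (-r / 2) = x ^ (-r) * (1 + -(1 / (x ^ 2 + 1))) ^ (r / 2) := by
    have e : 1 + -(1 / (x ^ 2 + 1)) = x ^ 2 / (x ^ 2 + 1) := by field_simp; ring
    rw [e, div_rpow (by positivity) (by positivity), ← rpow_natCast, ← rpow_mul hx.le, neg_div,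
      rpow_neg (by positivity), rpow_neg hx.le]
    have e2 : ((2 : ℕ) : ℝ) * (r / 2) = r := by push_cast; ring
    rw [e2]
    have : x ^ r ≠ 0 := (rpow_pos_of_pos hx r).ne'
    field_simp
  rw [h2] at h1
  refine h1.trans (mul_le_mul_of_nonneg_left ?_ (rpow_nonneg hx.le _))
  have hle : 1 / (x ^ 2 + 1) ≤ 1 := by
    rw [div_le_one (by positivity)]; nlinarith
  refine (rpow_one_add_le_one_add_mul_self (by linarith) (by linarith) (by linarith)).trans ?_
  have : (1 / (1 + x)) ^ 2 ≤ 1 / (x ^ 2 + 1) := by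
    rw [one_div_pow]
    exact one_div_le_one_div_of_le (by positivity) (by nlinarith)
  nlinarith

theorem weighted_quadratic_le {p m C a w : ℝ} (hp1 : 1 < p) (hp2 : p < 2) (hC0 : 0 ≤ C)
    (ha : a ^ 2 * C ≤ 2) (hw0 : 0 ≤ w) (hw1 : w ≤ 1)
    (hm : m ≤ 1 - (p - 1) * C / (2 * p ^ 2)) :
    C / 8 * (p * (p - 1) + 2 * a * (p - 1) * (2 - p) * w + a ^ 2 * (2 - p) * (3 - p) * w ^ 2) ≤
      p * (1 - m * (1 - (2 - p) / 2 * w ^ 2)) := by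
  have hw2 : w ^ 2 ≤ 1 := by nlinarith
  have hD : p / 2 ≤ 1 - (2 - p) / 2 * w ^ 2 := by nlinarith
  have hA : (p - 1) * C / 4 ≤ p * ((1 - m) * (1 - (2 - p) / 2 * w ^ 2)) := by
    have h1 : (p - 1) * C / (2 * p ^ 2) * (p / 2) ≤ (1 - m) * (1 - (2 - p) / 2 * w ^ 2) := by
      have : 0 ≤ (p - 1) * C / (2 * p ^ 2) :=
        div_nonneg (mul_nonneg (by linarith) hC0) (by positivity)
      exact mul_le_mul (by linarith) hD (by linarith) (by linarith)
    calc (p - 1) * C / 4 = p * ((p - 1) * C / (2 * p ^ 2) * (p / 2)) := by field_simp; ring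
      _ ≤ _ := mul_le_mul_of_nonneg_left h1 (by linarith)
  have hpq : 0 ≤ (p - 1) * (2 - p) := mul_nonneg (by linarith) (by linarith)
  have hamgm : C * (p - 1) * (2 - p) * (2 * a * w) ≤
      C * (p - 1) * (2 - p) * (1 + a ^ 2 * w ^ 2) := by
    refine mul_le_mul_of_nonneg_left ?_ (by rw [mul_assoc]; exact mul_nonneg hC0 hpq)
    nlinarith [sq_nonneg (1 - a * w)]
  have hB : (2 - p) * w ^ 2 * (a ^ 2 * C) ≤ (2 - p) * w ^ 2 * 2 :=
    mul_le_mul_of_nonneg_left ha (mul_nonneg (by linarith) (sq_nonneg w))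
  have hE : (2 - p) * w ^ 2 * 1 ≤ (2 - p) * w ^ 2 * p :=
    mul_le_mul_of_nonneg_left hp1.le (mul_nonneg (by linarith) (sq_nonneg w))
  linarith

/-- The difference of the two sides on the line `y = 1`, as a function of `x ≥ 0`, with the term
`(a - (1 + x)) ^ 2 * (1 + x) ^ (p - 2)` expanded into powers of `1 + x`. -/
noncomputable def gapFun (p T β K a x : ℝ) : ℝ :=
  T * x ^ p - 1 - β * (((x : ℂ) + Complex.I) ^ (p : ℂ)).re -
    K * ((1 + x) ^ p - 2 * a * (1 + x) ^ (p - 1) + a ^ 2 * (1 + x) ^ (p - 2))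

/-- The derivative of `gapFun` in its last variable. -/
noncomputable def gapFunDeriv (p T β K a x : ℝ) : ℝ :=
  T * (p * x ^ (p - 1)) - β * (p * (((x : ℂ) + Complex.I) ^ ((p - 1 : ℝ) : ℂ)).re) -
    K * (p * (1 + x) ^ (p - 1) - 2 * a * ((p - 1) * (1 + x) ^ (p - 2)) +
      a ^ 2 * ((p - 2) * (1 + x) ^ (p - 3)))

theorem hasDerivAt_one_add_rpow (r : ℝ) {x : ℝ} (hx : 0 < 1 + x) :
    HasDerivAt (fun x : ℝ => (1 + x) ^ r) (r * (1 + x) ^ (r - 1)) x := by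
  refine (((hasDerivAt_id x).const_add 1).rpow_const (p := r) (Or.inl hx.ne')).congr_deriv ?_
  simp

theorem hasDerivAt_gapFun (p T β K a : ℝ) {x : ℝ} (hx : 0 < x) :
    HasDerivAt (gapFun p T β K a) (gapFunDeriv p T β K a x) x := by
  have hu : 0 < 1 + x := by linarith
  refine ((((hasDerivAt_rpow_const (p := p) (Or.inl hx.ne')).const_mul T).sub_const 1).sub
    ((hasDerivAt_re_ofReal_add_I_cpow p x).const_mul β)).sub
    ((((hasDerivAt_one_add_rpow p hu).sub
      ((hasDerivAt_one_add_rpow (p - 1) hu).const_mul (2 * a))).add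
      ((hasDerivAt_one_add_rpow (p - 2) hu).const_mul (a ^ 2))).const_mul K) |>.congr_deriv ?_
  rw [gapFunDeriv, show p - 1 - 1 = p - 2 by ring, show p - 2 - 1 = p - 3 by ring]

theorem hasDerivAt_gapFunDeriv (p T β K a : ℝ) {x : ℝ} (hx : 0 < x) :
    HasDerivAt (gapFunDeriv p T β K a)
      (T * (p * ((p - 1) * x ^ (p - 2))) -
        β * (p * ((p - 1) * (((x : ℂ) + Complex.I) ^ ((p - 2 : ℝ) : ℂ)).re)) -
        K * (p * ((p - 1) * (1 + x) ^ (p - 2)) -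
          2 * a * ((p - 1) * ((p - 2) * (1 + x) ^ (p - 3))) +
          a ^ 2 * ((p - 2) * ((p - 3) * (1 + x) ^ (p - 4))))) x := by
  have hu : 0 < 1 + x := by linarith
  refine (((((hasDerivAt_rpow_const (p := p - 1) (Or.inl hx.ne')).const_mul p).const_mul T)).sub
    (((hasDerivAt_re_ofReal_add_I_cpow (p - 1) x).const_mul p).const_mul β)).sub
    (((((hasDerivAt_one_add_rpow (p - 1) hu).const_mul p).sub
      (((hasDerivAt_one_add_rpow (p - 2) hu).const_mul (p - 1)).const_mul (2 * a))).add
      (((hasDerivAt_one_add_rpow (p - 3) hu).const_mul (p - 2)).const_mul (a ^ 2))).const_mul K)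
      |>.congr_deriv ?_
  rw [show p - 1 - 1 = p - 2 by ring, show p - 2 - 1 = p - 3 by ring,
    show p - 3 - 1 = p - 4 by ring]

theorem convexOn_gapFun {p T m C a : ℝ} (hp1 : 1 < p) (hp2 : p < 2) (hT : 0 ≤ T) (hm0 : 0 ≤ m)
    (hC0 : 0 ≤ C) (ha0 : 0 ≤ a) (ha : a ^ 2 * C ≤ 2)
    (hm : m ≤ 1 - (p - 1) * C / (2 * p ^ 2)) :
    ConvexOn ℝ (Set.Ici 0) (gapFun p T (m * T) ((p - 1) / 8 * C * T) a) := by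
  refine convexOn_of_hasDerivWithinAt2_nonneg (convex_Ici 0) ?_
    (fun x hx => (hasDerivAt_gapFun _ _ _ _ _ (by simpa using hx)).hasDerivWithinAt)
    (fun x hx => (hasDerivAt_gapFunDeriv _ _ _ _ _ (by simpa using hx)).hasDerivWithinAt) ?_
  · intro x hx
    rw [Set.mem_Ici] at hx
    have hu : 0 < 1 + x := by linarith
    refine ContinuousAt.continuousWithinAt ?_
    exact (((continuousAt_const.mul
      (continuousAt_rpow_const x p (Or.inr (by linarith)))).sub continuousAt_const).sub
      (continuousAt_const.mul (hasDerivAt_re_ofReal_add_I_cpow p x).continuousAt)).sub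
      (continuousAt_const.mul (((hasDerivAt_one_add_rpow p hu).continuousAt.sub
        (continuousAt_const.mul (hasDerivAt_one_add_rpow (p - 1) hu).continuousAt)).add
        (continuousAt_const.mul (hasDerivAt_one_add_rpow (p - 2) hu).continuousAt)))
  · intro x hx
    have hx : 0 < x := by simpa using hx
    have hu : 0 < 1 + x := by linarith
    have hX : 0 < x ^ (p - 2) := rpow_pos_of_pos hx _
    have hU : (1 + x) ^ (p - 2) ≤ x ^ (p - 2) :=
      rpow_le_rpow_of_nonpos hx (by linarith) (by linarith)
    obtain ⟨w, hw⟩ : ∃ w, w = 1 / (1 + x) := ⟨_, rfl⟩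
    have hw0 : 0 ≤ w := by rw [hw]; positivity
    have hw1 : w ≤ 1 := by rw [hw, div_le_one hu]; linarith
    have h3 : (1 + x) ^ (p - 3) = (1 + x) ^ (p - 2) * w := by
      rw [show p - 3 = p - 2 - 1 by ring, rpow_sub_one hu.ne', hw]; ring
    have h4 : (1 + x) ^ (p - 4) = (1 + x) ^ (p - 2) * w ^ 2 := by
      rw [show p - 4 = p - 2 - 1 - 1 by ring, rpow_sub_one hu.ne', rpow_sub_one hu.ne', hw]
      ring
    have hN := re_ofReal_add_I_cpow_le (r := 2 - p) hx (by linarith) (by linarith)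
    rw [neg_sub, ← hw] at hN
    rw [h3, h4]
    have hq := weighted_quadratic_le hp1 hp2 hC0 ha hw0 hw1 hm
    set N := (((x : ℂ) + Complex.I) ^ ((p - 2 : ℝ) : ℂ)).re
    set X := x ^ (p - 2)
    set U := (1 + x) ^ (p - 2)
    set Q := p * (p - 1) + 2 * a * (p - 1) * (2 - p) * w + a ^ 2 * (2 - p) * (3 - p) * w ^ 2
      with hQ
    have hp1' : 0 ≤ p - 1 := by linarith
    have hp2' : 0 ≤ 2 - p := by linarith
    have hp3' : 0 ≤ 3 - p := by linarith
    have hp0 : 0 ≤ p := by linarith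
    have hQ0 : 0 ≤ Q := by positivity
    have s1 : C / 8 * Q * U ≤ C / 8 * Q * X := by gcongr
    have s2 : m * p * N ≤ m * p * (X * (1 - (2 - p) / 2 * w ^ 2)) := by gcongr
    have s3 := mul_le_mul_of_nonneg_left hq hX.le
    have s4 : 0 ≤ p * X - m * p * N - C / 8 * Q * U := by linarith
    have s5 := mul_nonneg (mul_nonneg hT hp1') s4
    rw [hQ] at s5
    linarith

theorem ConvexOn.le_of_hasDerivAt_zero {S : Set ℝ} {f : ℝ → ℝ} (hf : ConvexOn ℝ S f) {x y : ℝ}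
    (hx : x ∈ S) (hy : y ∈ S) (h : HasDerivAt f 0 x) : f x ≤ f y := by
  rcases lt_trichotomy x y with hxy | rfl | hxy
  · have := hf.le_slope_of_hasDerivAt hx hy hxy h
    rw [slope_def_field, le_div_iff₀ (by linarith)] at this
    linarith
  · rfl
  · have := hf.slope_le_of_hasDerivAt hy hx hxy h
    rw [slope_def_field, div_le_iff₀ (by linarith)] at this
    linarith

theorem re_cot_add_I_cpow {α : ℝ} (h0 : 0 < α) (h1 : α < π) (r : ℝ) :
    ((((cos α / sin α : ℝ) : ℂ) + Complex.I) ^ (r : ℂ)).re = cos (r * α) / sin α ^ r := by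
  have hs : 0 < sin α := sin_pos_of_pos_of_lt_pi h0 h1
  have e : ((cos α / sin α : ℝ) : ℂ) + Complex.I =
      ((1 / sin α : ℝ) : ℂ) * (Complex.cos α + Complex.sin α * Complex.I) := by
    have : Complex.sin α ≠ 0 := by rw [← Complex.ofReal_sin]; exact_mod_cast hs.ne'
    push_cast
    field_simp
  have hn : ‖((cos α / sin α : ℝ) : ℂ) + Complex.I‖ = 1 / sin α := by
    rw [e, norm_mul, Complex.norm_real, Complex.norm_cos_add_sin_mul_I, mul_one,
      Real.norm_of_nonneg (by positivity)]
  have ha : Complex.arg (((cos α / sin α : ℝ) : ℂ) + Complex.I) = α := by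
    rw [e]
    exact Complex.arg_mul_cos_add_sin_mul_I (by positivity) ⟨by linarith, h1.le⟩
  rw [Complex.cpow_ofReal_re, hn, ha, div_rpow zero_le_one hs.le, one_rpow, mul_comm α]
  ring

/-- The inequality on the line `y = 1`, with the angle `π / (2 * p)` called `α`. -/
theorem gapFun_nonneg {p α : ℝ} (hp1 : 1 < p) (hp2 : p < 2) (hα : α = π / (2 * p))
    {x : ℝ} (hx : 0 ≤ x) :
    0 ≤ gapFun p (tan α ^ p) (sin α ^ (p - 1) / cos α)
      ((p - 1) / 8 * (sin α ^ 2 - cos α ^ 2) * tan α ^ p) (1 + cos α / sin α) x := by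
  have hp0 : 0 < p := by linarith
  have hα0 : 0 < α := by rw [hα]; positivity
  have hpα : p * α = π / 2 := by rw [hα]; field_simp
  have hα1 : π / 4 < α := by nlinarith [pi_pos]
  have hα2 : α < π / 2 := by nlinarith [pi_pos]
  have hs : 0 < sin α := sin_pos_of_pos_of_lt_pi hα0 (by linarith)
  have hc : 0 < cos α := cos_pos_of_mem_Ioo ⟨by linarith, hα2⟩
  have hcs : cos α < sin α := by
    rw [← sin_pi_div_two_sub]
    exact sin_lt_sin_of_lt_of_le_pi_div_two (by linarith) (by linarith) (by linarith)
  have hre := fun r : ℝ => re_cot_add_I_cpow hα0 (by linarith : α < π) r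
  have hm := cos_rpow_le hp1 hp2
  rw [← hα] at hm
  have hone := sin_sq_add_cos_sq α
  set s := sin α
  set c := cos α
  have ht : tan α = s / c := tan_eq_sin_div_cos α
  rw [ht]
  have hsp : s ^ p = s ^ (p - 1) * s := by rw [rpow_sub_one hs.ne']; field_simp
  have hcp : c ^ p = c ^ (p - 1) * c := by rw [rpow_sub_one hc.ne']; field_simp
  have hs1 : 0 < s ^ (p - 1) := rpow_pos_of_pos hs _
  have hc1 : 0 < c ^ (p - 1) := rpow_pos_of_pos hc _
  have hT : (s / c) ^ p = s ^ (p - 1) * s / (c ^ (p - 1) * c) := by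
    rw [div_rpow hs.le hc.le, hsp, hcp]
  have hβ : s ^ (p - 1) / c = c ^ (p - 1) / s * (s / c) ^ p := by rw [hT]; field_simp
  have hC : 0 ≤ s ^ 2 - c ^ 2 := by nlinarith
  have hx0 : 0 < c / s := by positivity
  have hu : 0 < 1 + c / s := by positivity
  have hconv : ConvexOn ℝ (Set.Ici 0) (gapFun p ((s / c) ^ p) (s ^ (p - 1) / c)
      ((p - 1) / 8 * (s ^ 2 - c ^ 2) * (s / c) ^ p) (1 + c / s)) := by
    rw [hβ]
    refine convexOn_gapFun hp1 hp2 (by positivity) (by positivity) hC (by positivity) ?_ ?_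
    · have e : (1 + c / s) ^ 2 * (s ^ 2 - c ^ 2) = (s + c) ^ 2 * (s ^ 2 - c ^ 2) / s ^ 2 := by
        field_simp
      rw [e, div_le_iff₀ (by positivity)]
      have : (s + c) ^ 2 * (s ^ 2 - c ^ 2) ≤ 2 * s ^ 2 * (s ^ 2 + c ^ 2) := by
        nlinarith [sq_nonneg (s * (s - c)), mul_pos hs hc, pow_pos hc 4, pow_pos hc 3,
          mul_pos hs (pow_pos hc 3)]
      rw [hone] at this
      linarith
    · rw [div_le_iff₀ hs, mul_comm]
      exact hm
  have hone_add : (1 + c / s) ^ p = (1 + c / s) ^ (p - 2) * (1 + c / s) ^ 2 := by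
    rw [← rpow_natCast, ← rpow_add hu]; congr 1; push_cast; ring
  have hone_add1 : (1 + c / s) ^ (p - 1) = (1 + c / s) ^ (p - 2) * (1 + c / s) := by
    rw [← rpow_add_one hu.ne']; congr 1; ring
  have hone_add2 : (1 + c / s) ^ (p - 2) = (1 + c / s) ^ (p - 3) * (1 + c / s) := by
    rw [← rpow_add_one hu.ne']; congr 1; ring
  have hTx : (s / c) ^ p * (c / s) ^ p = 1 := by
    rw [← mul_rpow (by positivity) (by positivity)]
    have : s / c * (c / s) = 1 := by field_simp
    rw [this, one_rpow]
  have hval : gapFun p ((s / c) ^ p) (s ^ (p - 1) / c)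
      ((p - 1) / 8 * (s ^ 2 - c ^ 2) * (s / c) ^ p) (1 + c / s) (c / s) = 0 := by
    rw [gapFun, hre, hpα, cos_pi_div_two, hTx, hone_add, hone_add1]
    ring
  have hderiv : gapFunDeriv p ((s / c) ^ p) (s ^ (p - 1) / c)
      ((p - 1) / 8 * (s ^ 2 - c ^ 2) * (s / c) ^ p) (1 + c / s) (c / s) = 0 := by
    have hcos : cos ((p - 1) * α) = s := by
      rw [sub_one_mul, hpα, cos_pi_div_two_sub]
    have h1 : (s / c) ^ p * (p * (c / s) ^ (p - 1)) -
        s ^ (p - 1) / c * (p * (s / s ^ (p - 1))) = 0 := by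
      rw [hT, div_rpow hc.le hs.le]
      field_simp
      ring
    rw [gapFunDeriv, hre, hcos, h1, hone_add1, hone_add2]
    ring
  have hd := hasDerivAt_gapFun p ((s / c) ^ p) (s ^ (p - 1) / c)
      ((p - 1) / 8 * (s ^ 2 - c ^ 2) * (s / c) ^ p) (1 + c / s) hx0
  rw [hderiv] at hd
  have := hconv.le_of_hasDerivAt_zero hx0.le (Set.mem_Ici.2 hx) hd
  rwa [hval] at this

theorem re_cpow_abs_im (x y p : ℝ) (hx : 0 ≤ x) :
    (((x : ℂ) + Complex.I * (y : ℂ)) ^ (p : ℂ)).re =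
      (((x : ℂ) + Complex.I * ((|y| : ℝ) : ℂ)) ^ (p : ℂ)).re := by
  rcases abs_choice y with h | h
  · rw [h]
  · rw [h]
    have e : (x : ℂ) + Complex.I * ((-y : ℝ) : ℂ) =
        (starRingEnd ℂ) ((x : ℂ) + Complex.I * (y : ℂ)) := by
      simp
    have harg : Complex.arg ((x : ℂ) + Complex.I * (y : ℂ)) ≠ π := by
      intro hπ
      have := (Complex.arg_eq_pi_iff.1 hπ).1
      simp at this
      linarith
    rw [e, Complex.conj_cpow _ _ harg, Complex.conj_re, Complex.conj_ofReal]

theorem stmt_15 (p : ℝ) (hp1 : 1 < p) (hp2 : p < 2)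
    (β : ℝ) (hβ : β = Real.sin (π / (2 * p)) ^ (p - 1) / Real.cos (π / (2 * p)))
    (κ : ℝ)
    (hκ : κ = -((p - 1) / 8) * Real.tan (π / (2 * p)) ^ (p - 2) * Real.cos (π / p))
    (x y : ℝ) (hxy : (x, y) ≠ (0, 0)) :
    -β * ((((|x| : ℝ) : ℂ) + Complex.I * (y : ℂ)) ^ (p : ℂ)).re ≥
      |y| ^ p - Real.tan (π / (2 * p)) ^ p * |x| ^ p +
        κ * (|y| - Real.tan (π / (2 * p)) * |x|) ^ 2 * (|x| + |y|) ^ (p - 2) := by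
  have hp0 : 0 < p := by linarith
  obtain ⟨α, hα⟩ : ∃ α, α = π / (2 * p) := ⟨_, rfl⟩
  have hα0 : 0 < α := by rw [hα]; positivity
  have hpα : p * α = π / 2 := by rw [hα]; field_simp
  have hα2 : α < π / 2 := by nlinarith [pi_pos]
  have hs : 0 < sin α := sin_pos_of_pos_of_lt_pi hα0 (by linarith)
  have hc : 0 < cos α := cos_pos_of_mem_Ioo ⟨by linarith, hα2⟩
  have hgap := fun {x : ℝ} (hx : 0 ≤ x) => gapFun_nonneg hp1 hp2 hα hx
  have hm := cos_rpow_le hp1 hp2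
  rw [← hα] at hm hβ hκ ⊢
  have hcos : cos (π / p) = -(sin α ^ 2 - cos α ^ 2) := by
    have : π / p = 2 * α := by rw [hα]; field_simp
    rw [this, cos_two_mul']; ring
  rw [hcos] at hκ
  have ht : 0 < tan α := tan_pos_of_pos_of_lt_pi_div_two hα0 hα2
  have htp : tan α ^ p = tan α ^ (p - 2) * tan α ^ 2 := by
    rw [← rpow_natCast, ← rpow_add ht]; congr 1; push_cast; ring
  have hκt : κ * tan α ^ 2 = (p - 1) / 8 * (sin α ^ 2 - cos α ^ 2) * tan α ^ p := by
    rw [hκ, htp]; ring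
  have hcot : cos α / sin α = 1 / tan α := by rw [tan_eq_sin_div_cos, one_div_div]
  rw [re_cpow_abs_im _ _ _ (abs_nonneg x)]
  have hne : |x| ≠ 0 ∨ |y| ≠ 0 := by
    by_contra! h
    exact hxy (Prod.ext (abs_eq_zero.1 h.1) (abs_eq_zero.1 h.2))
  have hX := abs_nonneg x
  have hY := abs_nonneg y
  generalize |x| = X at *
  generalize |y| = Y at *
  rcases hY.eq_or_lt with rfl | hY
  · have hX : 0 < X := lt_of_le_of_ne hX (by simpa [eq_comm] using hne)
    have e : ((X : ℂ) + Complex.I * ((0 : ℝ) : ℂ)) ^ (p : ℂ) = ((X ^ p : ℝ) : ℂ) := by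
      rw [Complex.ofReal_cpow hX.le]; simp
    rw [e, Complex.ofReal_re, zero_rpow hp0.ne', add_zero]
    have hXp : X ^ p = X ^ (p - 2) * X ^ 2 := by
      rw [← rpow_natCast, ← rpow_add hX]; congr 1; push_cast; ring
    have h1 : κ * (0 - tan α * X) ^ 2 * X ^ (p - 2) = κ * tan α ^ 2 * X ^ p := by
      rw [hXp]; ring
    have hβT : β = cos α ^ (p - 1) / sin α * tan α ^ p := by
      rw [hβ, tan_eq_sin_div_cos, div_rpow hs.le hc.le, rpow_sub_one hs.ne', rpow_sub_one hc.ne']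
      have := (rpow_pos_of_pos hc p).ne'
      field_simp
    have hm' : cos α ^ (p - 1) / sin α ≤ 1 - (p - 1) / 8 * (sin α ^ 2 - cos α ^ 2) := by
      have hC : 0 ≤ sin α ^ 2 - cos α ^ 2 := by
        rw [← neg_nonpos, ← hcos]
        refine cos_nonpos_of_pi_div_two_le_of_le ?_ ?_
        · exact div_le_div_of_nonneg_left pi_pos.le hp0 hp2.le
        · rw [add_comm]
          exact (div_le_self pi_pos.le hp1.le).trans (by linarith [pi_pos])
      have h8 : (p - 1) * (sin α ^ 2 - cos α ^ 2) / 8 ≤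
          (p - 1) * (sin α ^ 2 - cos α ^ 2) / (2 * p ^ 2) :=
        div_le_div_of_nonneg_left (mul_nonneg (by linarith) hC) (by positivity) (by nlinarith)
      rw [div_le_iff₀ hs, mul_comm]
      refine hm.trans (mul_le_mul_of_nonneg_left ?_ hs.le)
      linarith
    rw [h1, hκt, hβT]
    have hT : 0 ≤ tan α ^ p * X ^ p := by positivity
    have := mul_le_mul_of_nonneg_right hm' hT
    linarith
  · have hg := hgap (x := X / Y) (div_nonneg hX hY.le)
    have hu : 0 < 1 + X / Y := by positivity
    have e : (X : ℂ) + Complex.I * (Y : ℂ) = (Y : ℂ) * (((X / Y : ℝ) : ℂ) + Complex.I) := by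
      have : (Y : ℂ) ≠ 0 := by exact_mod_cast hY.ne'
      push_cast
      field_simp
    have hre : (((X : ℂ) + Complex.I * (Y : ℂ)) ^ (p : ℂ)).re =
        Y ^ p * ((((X / Y : ℝ) : ℂ) + Complex.I) ^ (p : ℂ)).re := by
      rw [e, Complex.cpow_ofReal_re, Complex.cpow_ofReal_re, norm_mul, Complex.arg_real_mul _ hY,
        Complex.norm_of_nonneg hY.le, mul_rpow hY.le (norm_nonneg _), mul_assoc]
    have h1 : (1 + X / Y) ^ p = (1 + X / Y) ^ (p - 2) * (1 + X / Y) ^ 2 := by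
      rw [← rpow_natCast, ← rpow_add hu]; congr 1; push_cast; ring
    have h2 : (1 + X / Y) ^ (p - 1) = (1 + X / Y) ^ (p - 2) * (1 + X / Y) := by
      rw [← rpow_add_one hu.ne']; congr 1; ring
    have h3 : (X + Y) ^ (p - 2) = Y ^ (p - 2) * (1 + X / Y) ^ (p - 2) := by
      rw [← mul_rpow hY.le hu.le]; congr 1; field_simp; ring
    have h4 : X ^ p = Y ^ p * (X / Y) ^ p := by
      rw [← mul_rpow hY.le (by positivity)]; congr 1; field_simp
    have h5 : Y ^ p = Y ^ (p - 2) * Y ^ 2 := by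
      rw [← rpow_natCast, ← rpow_add hY]; congr 1; push_cast; ring
    rw [gapFun, ← hβ, ← hκt, h1, h2, hcot] at hg
    have h6 : κ * (Y - tan α * X) ^ 2 * (X + Y) ^ (p - 2) = Y ^ p * (κ * tan α ^ 2 *
        ((1 + X / Y) ^ (p - 2) * (1 + X / Y) ^ 2 -
          2 * (1 + 1 / tan α) * ((1 + X / Y) ^ (p - 2) * (1 + X / Y)) +
          (1 + 1 / tan α) ^ 2 * (1 + X / Y) ^ (p - 2))) := by
      rw [h3, h5]; field_simp; ring
    have := mul_nonneg (rpow_nonneg hY.le p) hg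
    rw [h6, hre, h4]
    linarith
end

section
/- Let p ≥ 2 and set μ_p = (1 − √2/2)·(p−2)/p. Then: (1) μ_p ≤ 1 − sin^{p−1}(π/(2p)) / (cos(π/(2p))·sin^{p−1}(π/(2(p−1)))); (2) μ_p ≤ cos^{p−2}(π/(2p))·sin^{p−2}(π/(2p))·cos(π/p) / sin^{p−2}(π/(2p(p−1))); (3) μ_p ≤ cos^{p−1}(π/(2p))/sin(π/(2p)) − 1. -/
open Real

lemma div_le_sin_div {t q : ℝ} (ht₀ : 0 ≤ t) (ht : t ≤ π) (hq : 1 ≤ q) :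
    sin t / q ≤ sin (t / q) := by
  have hq₀ : 0 < q := by linarith
  have hq' : q⁻¹ ≤ 1 := inv_le_one_of_one_le₀ hq
  have h := strictConcaveOn_sin_Icc.concaveOn.2 (x := t) (y := 0) ⟨ht₀, ht⟩
    ⟨le_rfl, pi_pos.le⟩ (inv_nonneg.2 hq₀.le) (sub_nonneg.2 hq') (by ring)
  simpa [div_eq_inv_mul] using h

lemma cos_mul_ge {t a : ℝ} (ht₀ : 0 ≤ t) (ht : t ≤ π / 2) (ha₀ : 0 ≤ a) (ha : a ≤ 1) :
    1 - a * (1 - cos t) ≤ cos (a * t) := by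
  have h := strictConcaveOn_cos_Icc.concaveOn.2 (x := t) (y := 0) ⟨by linarith [pi_pos], ht⟩
    ⟨by linarith [pi_pos], by linarith [pi_pos]⟩ ha₀ (sub_nonneg.2 ha) (by ring)
  simp only [smul_eq_mul, cos_zero, mul_zero, mul_one, add_zero] at h
  linarith

lemma two_mul_cos_le_sin_div_sin_rpow {t q : ℝ} (ht₀ : 0 < t) (ht : t ≤ π / 4) (hq : 1 ≤ q) :
    2 * cos t ≤ (sin (t + t / q) / sin t) ^ q := by
  have hq₀ : 0 < q := by linarith
  have hsin : 0 < sin t := sin_pos_of_pos_of_lt_pi ht₀ (by linarith [pi_pos])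
  have hcos : 0 < cos t := cos_pos_of_mem_Ioo ⟨by linarith [pi_pos], by linarith [pi_pos]⟩
  have hs := div_le_sin_div ht₀.le (by linarith [pi_pos]) hq
  have hc := cos_mul_ge ht₀.le (by linarith [pi_pos]) (inv_nonneg.2 hq₀.le)
    (inv_le_one_of_one_le₀ hq)
  rw [← div_eq_inv_mul, ← div_eq_inv_mul] at hc
  have hratio : 1 + (2 * cos t - 1) / q ≤ sin (t + t / q) / sin t := by
    rw [le_div_iff₀ hsin, sin_add]
    have h₁ := mul_le_mul_of_nonneg_left hs hcos.le
    have h₂ := mul_le_mul_of_nonneg_left hc hsin.le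
    calc (1 + (2 * cos t - 1) / q) * sin t
        = sin t * (1 - (1 - cos t) / q) + cos t * (sin t / q) := by ring
      _ ≤ _ := add_le_add h₂ h₁
  have hcos' : 1 / 2 ≤ cos t := by
    rw [← cos_pi_div_three]
    exact cos_le_cos_of_nonneg_of_le_pi ht₀.le (by linarith [pi_pos]) (by linarith [pi_pos])
  have hnn : 0 ≤ (2 * cos t - 1) / q := div_nonneg (by linarith) hq₀.le
  calc 2 * cos t = 1 + q * ((2 * cos t - 1) / q) := by field_simp; ring
    _ ≤ (1 + (2 * cos t - 1) / q) ^ q :=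
      one_add_mul_self_le_rpow_one_add (by linarith) hq
    _ ≤ _ := rpow_le_rpow (by linarith) hratio hq₀.le

lemma one_sub_mul_inv_sub_one_le_rpow {x y : ℝ} (hx : 0 < x) (hy : 0 ≤ y) :
    1 - y * (x⁻¹ - 1) ≤ x ^ y := by
  rw [rpow_def_of_pos hx]
  have h₁ := one_sub_inv_le_log_of_pos hx
  have h₂ := add_one_le_exp (log x * y)
  nlinarith [mul_le_mul_of_nonneg_right h₁ hy]

lemma one_add_two_mul_le_cos_div_sin {t : ℝ} (ht₀ : 0 < t) (ht : t ≤ π / 4) :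
    1 + 2 * (π / 4 - t) ≤ cos t / sin t := by
  have hsin : 0 < sin t := sin_pos_of_pos_of_lt_pi ht₀ (by linarith [pi_pos])
  obtain ⟨y, rfl⟩ : ∃ y, t = π / 4 - y := ⟨π / 4 - t, by ring⟩
  have hy : 0 ≤ y := by linarith
  have hcos : 0 < cos y := cos_pos_of_mem_Ioo ⟨by linarith [pi_pos], by linarith [pi_pos]⟩
  have htan := le_tan hy (by linarith [pi_pos])
  rw [tan_eq_sin_div_cos, le_div_iff₀ hcos] at htan
  have hsy : 0 ≤ sin y := sin_nonneg_of_nonneg_of_le_pi hy (by linarith [pi_pos])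
  rw [le_div_iff₀ hsin, sin_sub, cos_sub, sin_pi_div_four, cos_pi_div_four]
  have h : (1 + 2 * y) * (cos y - sin y) ≤ cos y + sin y := by
    nlinarith [mul_nonneg hy hsy]
  have := mul_le_mul_of_nonneg_left h (by positivity : (0 : ℝ) ≤ √2 / 2)
  calc _ = √2 / 2 * ((1 + 2 * y) * (cos y - sin y)) := by ring
    _ ≤ _ := this
    _ = _ := by ring

lemma sqrt_two_bounds : 1.414 < √2 ∧ √2 < 1.415 :=
  ⟨lt_sqrt_of_sq_lt (by norm_num), (sqrt_lt' (by norm_num)).2 (by norm_num)⟩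

lemma chord_le_cos {s : ℝ} (hs₀ : 0 ≤ s) (hs₁ : s ≤ 1) :
    1 - (1 - s) * (1 - √2 / 2) ≤ cos ((1 - s) * (π / 4)) := by
  have h := cos_mul_ge (t := π / 4) (a := 1 - s) (by linarith [pi_pos]) (by linarith [pi_pos])
    (by linarith) (by linarith)
  rwa [cos_pi_div_four] at h

lemma le_one_sub_sin_rpow_div {p s t : ℝ} (hp : 2 ≤ p) (hs₀ : 0 ≤ s) (hs₁ : s ≤ 1)
    (ht₀ : 0 < t) (hts : t = (1 - s) * (π / 4)) :
    (1 - √2 / 2) * s ≤ 1 - sin t ^ (p - 1) / (cos t * sin (t + t / (p - 1)) ^ (p - 1)) := by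
  have hπ := pi_pos
  have ht₁ : t ≤ π / 4 := by rw [hts]; nlinarith
  have hsin : 0 < sin t := sin_pos_of_pos_of_lt_pi ht₀ (by linarith)
  have hcos : 0 < cos t := cos_pos_of_mem_Ioo ⟨by linarith, by linarith⟩
  have hut : t / (p - 1) ≤ t := div_le_self ht₀.le (by linarith)
  have hu₀ : 0 < t / (p - 1) := div_pos ht₀ (by linarith)
  have hsinv : 0 < sin (t + t / (p - 1)) := sin_pos_of_pos_of_lt_pi (by linarith) (by linarith)
  have hr : √2 ^ 2 = 2 := sq_sqrt (by norm_num)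
  obtain ⟨hr₁, hr₂⟩ := sqrt_two_bounds
  have hchord : 1 - (1 - s) * (1 - √2 / 2) ≤ cos t := hts ▸ chord_le_cos hs₀ hs₁
  have hR := two_mul_cos_le_sin_div_sin_rpow ht₀ ht₁ (show 1 ≤ p - 1 by linarith)
  rw [div_rpow hsinv.le hsin.le, le_div_iff₀ (rpow_pos_of_pos hsin _)] at hR
  have hκ : √2 / 2 ≤ cos t * (1 - (1 - √2 / 2) * s) := by
    have hμ₁ : 0 ≤ 1 - (1 - √2 / 2) * s := by nlinarith
    refine le_trans ?_ (mul_le_mul_of_nonneg_right hchord hμ₁)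
    nlinarith [mul_nonneg (mul_nonneg hs₀ (sub_nonneg.2 hs₁)) (sq_nonneg (1 - √2 / 2))]
  have hc : √2 / 2 ≤ cos t := by nlinarith
  have h2 : 1 ≤ (2 * cos t) * (cos t * (1 - (1 - √2 / 2) * s)) := by
    nlinarith [mul_le_mul hc hκ (by positivity) hcos.le]
  have hpow := rpow_pos_of_pos hsin (p - 1)
  have hκ₀ : 0 ≤ cos t * (1 - (1 - √2 / 2) * s) := le_trans (by positivity) hκ
  rw [le_sub_comm, div_le_iff₀ (mul_pos hcos (rpow_pos_of_pos hsinv _))]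
  calc sin t ^ (p - 1) ≤ (2 * cos t * (cos t * (1 - (1 - √2 / 2) * s))) * sin t ^ (p - 1) :=
        le_mul_of_one_le_left hpow.le h2
    _ = (2 * cos t * sin t ^ (p - 1)) * (cos t * (1 - (1 - √2 / 2) * s)) := by ring
    _ ≤ sin (t + t / (p - 1)) ^ (p - 1) * (cos t * (1 - (1 - √2 / 2) * s)) :=
        mul_le_mul_of_nonneg_right hR hκ₀
    _ = _ := by ring

lemma le_cos_rpow_mul_sin_rpow_div {p s t : ℝ} (hp : 2 ≤ p) (hs₀ : 0 ≤ s) (hs₁ : s ≤ 1)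
    (ht₀ : 0 < t) (hts : t = (1 - s) * (π / 4)) :
    (1 - √2 / 2) * s ≤
      cos t ^ (p - 2) * sin t ^ (p - 2) * cos (2 * t) / sin (t / (p - 1)) ^ (p - 2) := by
  have hπ := pi_pos
  have ht₁ : t ≤ π / 4 := by rw [hts]; nlinarith
  have hsin : 0 < sin t := sin_pos_of_pos_of_lt_pi ht₀ (by linarith)
  have hcos : 0 < cos t := cos_pos_of_mem_Ioo ⟨by linarith, by linarith⟩
  have hut : t / (p - 1) ≤ t := div_le_self ht₀.le (by linarith)
  have hu₀ : 0 < t / (p - 1) := div_pos ht₀ (by linarith)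
  have hsinu : 0 < sin (t / (p - 1)) := sin_pos_of_pos_of_lt_pi hu₀ (by linarith)
  have hq₀ : 0 < p - 1 := by linarith
  have hπ₂ := pi_lt_d2
  obtain ⟨hr₁, hr₂⟩ := sqrt_two_bounds
  have hcos2 : s ≤ cos (2 * t) := by
    have h := mul_le_sin (x := π / 2 * s) (by positivity) (mul_le_of_le_one_right (by positivity) hs₁)
    rw [show 2 * t = π / 2 - π / 2 * s by rw [hts]; ring, cos_pi_div_two_sub]
    calc s = 2 / π * (π / 2 * s) := by field_simp
      _ ≤ _ := h
  obtain ⟨ρ, hρ⟩ : ∃ ρ, ρ = cos t * sin t / sin (t / (p - 1)) := ⟨_, rfl⟩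
  have hρ₁ : 2 / π * (p - 1) ≤ ρ := by
    have h := mul_le_sin (x := 2 * t) (by linarith) (by linarith)
    rw [sin_two_mul] at h
    rw [hρ, le_div_iff₀ hsinu]
    calc 2 / π * (p - 1) * sin (t / (p - 1)) ≤ 2 / π * (p - 1) * (t / (p - 1)) :=
          mul_le_mul_of_nonneg_left (sin_le hu₀.le) (by positivity)
      _ = 2 / π * t := by field_simp
      _ ≤ cos t * sin t := by linarith
  have hπ₃ : 1 / 2 ≤ 2 / π := by rw [div_le_div_iff₀ (by norm_num) hπ]; linarith
  have hρ₂ : 1 / 2 ≤ ρ := by nlinarith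
  have hpow : 1 / 2 ≤ ρ ^ (p - 2) := by
    rcases le_total 1 ρ with h | h
    · linarith [one_le_rpow h (show 0 ≤ p - 2 by linarith)]
    · have : p - 2 ≤ 1 := by nlinarith
      calc 1 / 2 ≤ ρ := hρ₂
        _ = ρ ^ (1 : ℝ) := (rpow_one ρ).symm
        _ ≤ ρ ^ (p - 2) := rpow_le_rpow_of_exponent_ge (by linarith) h this
  rw [hρ, div_rpow (by positivity) hsinu.le, mul_rpow hcos.le hsin.le] at hpow
  rw [mul_div_right_comm]
  exact mul_le_mul (by linarith) hcos2 hs₀ (by linarith)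

lemma le_cos_rpow_div_sin_sub_one {p s t : ℝ} (hp : 2 ≤ p) (hs₀ : 0 ≤ s) (hs₁ : s ≤ 1)
    (ht₀ : 0 < t) (hts : t = (1 - s) * (π / 4)) (hps : p * (1 - s) = 2) :
    (1 - √2 / 2) * s ≤ cos t ^ (p - 1) / sin t - 1 := by
  have hπ := pi_pos
  have ht₁ : t ≤ π / 4 := by rw [hts]; nlinarith
  have hsin : 0 < sin t := sin_pos_of_pos_of_lt_pi ht₀ (by linarith)
  have hcos : 0 < cos t := cos_pos_of_mem_Ioo ⟨by linarith, by linarith⟩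
  have hπ₁ := pi_gt_d2
  have hπ₂ := pi_lt_d2
  have hr : √2 ^ 2 = 2 := sq_sqrt (by norm_num)
  obtain ⟨hr₁, hr₂⟩ := sqrt_two_bounds
  have hchord : 1 - (1 - s) * (1 - √2 / 2) ≤ cos t := hts ▸ chord_le_cos hs₀ hs₁
  have hc : √2 / 2 ≤ cos t := by nlinarith
  have hcot := one_add_two_mul_le_cos_div_sin ht₀ ht₁
  have hB := one_sub_mul_inv_sub_one_le_rpow hcos (show 0 ≤ p - 2 by linarith)
  have hinv : (cos t)⁻¹ - 1 ≤ √2 / 2 * t ^ 2 := by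
    have h := one_sub_sq_div_two_le_cos (x := t)
    rw [sub_le_iff_le_add, inv_le_iff_one_le_mul₀ hcos]
    nlinarith [mul_le_mul_of_nonneg_right hc (show 0 ≤ √2 / 2 * t ^ 2 by positivity)]
  have hpt : (p - 2) * t ^ 2 = π ^ 2 / 8 * (s * (1 - s)) := by
    rw [hts]; linear_combination π ^ 2 / 16 * (1 - s) * hps
  have hss : 0 ≤ s * (1 - s) := mul_nonneg hs₀ (by linarith)
  have hB' : 1 - 0.88 * (s * (1 - s)) ≤ cos t ^ (p - 2) := by
    have h₁ := mul_le_mul_of_nonneg_left hinv (show 0 ≤ p - 2 by linarith)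
    have h₂ : π ^ 2 * √2 ≤ 14.08 := by
      calc π ^ 2 * √2 ≤ 3.15 ^ 2 * 1.415 := by gcongr
        _ ≤ 14.08 := by norm_num
    nlinarith [mul_le_mul_of_nonneg_right h₂ hss]
  have hcot' : 1 + 1.57 * s ≤ cos t / sin t := by
    nlinarith
  have hsplit : cos t ^ (p - 1) / sin t = cos t / sin t * cos t ^ (p - 2) := by
    rw [show p - 1 = 1 + (p - 2) by ring, rpow_add hcos, rpow_one]; ring
  have hmul : (1 + 1.57 * s) * (1 - 0.88 * (s * (1 - s))) ≤ cos t / sin t * cos t ^ (p - 2) :=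
    mul_le_mul hcot' hB' (by nlinarith) (by positivity)
  have hquad : 0 ≤ 0.39 - 0.5016 * s + 1.3816 * s ^ 2 := by nlinarith [sq_nonneg (s - 0.18)]
  have hμ₂ : (1 - √2 / 2) * s ≤ 0.3 * s := by nlinarith
  rw [hsplit]
  nlinarith [mul_nonneg hs₀ hquad]

theorem stmt_18 (p : ℝ) (hp : 2 ≤ p)
    (μ : ℝ) (hμ : μ = (1 - Real.sqrt 2 / 2) * (p - 2) / p) :
    μ ≤ 1 - Real.sin (π / (2 * p)) ^ (p - 1) /
          (Real.cos (π / (2 * p)) * Real.sin (π / (2 * (p - 1))) ^ (p - 1)) ∧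
    μ ≤ Real.cos (π / (2 * p)) ^ (p - 2) * Real.sin (π / (2 * p)) ^ (p - 2) *
          Real.cos (π / p) / Real.sin (π / (2 * p * (p - 1))) ^ (p - 2) ∧
    μ ≤ Real.cos (π / (2 * p)) ^ (p - 1) / Real.sin (π / (2 * p)) - 1 := by
  have hp₀ : 0 < p := by linarith
  have hq₀ : 0 < p - 1 := by linarith
  have hπ := pi_pos
  have hs₀ : 0 ≤ (p - 2) / p := div_nonneg (by linarith) hp₀.le
  have hs₁ : (p - 2) / p ≤ 1 := by rw [div_le_one hp₀]; linarith
  have ht₀ : 0 < π / (2 * p) := by positivity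
  have hts : π / (2 * p) = (1 - (p - 2) / p) * (π / 4) := by field_simp; ring
  have hv : π / (2 * (p - 1)) = π / (2 * p) + π / (2 * p) / (p - 1) := by field_simp; ring
  have hu : π / (2 * p * (p - 1)) = π / (2 * p) / (p - 1) := by field_simp
  have hw : π / p = 2 * (π / (2 * p)) := by field_simp
  have hps : p * (1 - (p - 2) / p) = 2 := by field_simp; ring
  rw [hμ, mul_div_assoc, hv, hu, hw]
  exact ⟨le_one_sub_sin_rpow_div hp hs₀ hs₁ ht₀ hts,
    le_cos_rpow_mul_sin_rpow_div hp hs₀ hs₁ ht₀ hts,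
    le_cos_rpow_div_sin_sub_one hp hs₀ hs₁ ht₀ hts hps⟩
end
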